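/- Let p ≥ 4 be an even integer, and let E ∈ ℝ be the constant such that max_{x ∈ 𝒮_n} H_n(x;Y^{(n)}) converges to E in probability as n → ∞, where Y^{(n)} is a p-tensor on ℝ^n with i.i.d. N(0,1) entries (E = E_p(𝒮)). Then there exist ε > 0, constants 0 ≤ ν₁ < ν₂ ≤ 1, c > 0, and n₀ such that for all n ≥ n₀, when Y and Y′ are independent p-tensors on ℝ^n with i.i.d. N(0,1) entries, with probability at least 1 − exp(−cn) the following both hold: (a) the family 𝒜(Y,Y′) = { cos(τ)·H_n(·;Y) + sin(τ)·H_n(·;Y′) : τ ∈ [0,π/2] } satisfies the (E−ε, ν₁, ν₂)-overlap gap property on the domain 𝒮_n with overlap R(x,y) = |⟨x,y⟩|/n; and (b) H_n(·;Y) and H_n(·;Y′) are ν₁-separated above E−ε with respect to R. -/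

import Mathlib

open MeasureTheory ProbabilityTheory

/-- The law of a `p`-tensor on `ℝ^n` with i.i.d. `N(0,1)` entries. -/
noncomputable def tensorGaussian (p n : ℕ) : Measure ((Fin p → Fin n) → ℝ) :=
  Measure.pi fun _ => gaussianReal 0 1

/-- The `p`-spin Hamiltonian `H_n(x; Y) = n^{-(p+1)/2} ⟨Y, x^{⊗p}⟩`. -/
noncomputable def Hpspin (p n : ℕ) (Y : (Fin p → Fin n) → ℝ) (x : Fin n → ℝ) : ℝ :=
  (n : ℝ) ^ (-(((p : ℝ) + 1) / 2)) * ∑ j : Fin p → Fin n, Y j * ∏ l, x (j l)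

/-- The sphere `𝒮_n = {x ∈ ℝ^n : ‖x‖₂ = √n}`. -/
def sphereSet (n : ℕ) : Set (Fin n → ℝ) := {x | ∑ i, (x i) ^ 2 = n}

/-- The hypercube `Σ_n = {+1, -1}^n`. -/
def cubeSet (n : ℕ) : Set (Fin n → ℝ) := {x | ∀ i, x i = 1 ∨ x i = -1}

/-- The normalized overlap `R(x, y) = |⟨x, y⟩| / n`. -/
noncomputable def olap (n : ℕ) (x y : Fin n → ℝ) : ℝ := |∑ i, x i * y i| / n

/-- A family `F` of functions on a domain `Dom` satisfies the `(μ, ν₁, ν₂)`-overlap gap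
property for the overlap `R`. -/
def HasOGP {X : Type*} (F : Set (X → ℝ)) (Dom : Set X) (R : X → X → ℝ)
    (μ ν₁ ν₂ : ℝ) : Prop :=
  ∀ f₁ ∈ F, ∀ f₂ ∈ F, ∀ x₁ ∈ Dom, ∀ x₂ ∈ Dom, μ ≤ f₁ x₁ → μ ≤ f₂ x₂ →
    R x₁ x₂ ∈ Set.Icc (0 : ℝ) ν₁ ∪ Set.Icc ν₂ 1

/-- Two functions `f, g` on a domain `Dom` are `ν`-separated above `μ` with respect to the
overlap `R`. -/
def SeparatedAbove {X : Type*} (f g : X → ℝ) (Dom : Set X) (R : X → X → ℝ)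
    (μ ν : ℝ) : Prop :=
  ∀ x ∈ Dom, ∀ y ∈ Dom, μ ≤ f x → μ ≤ g y → R x y ≤ ν

/-- The interpolated family `𝒜(Y, Y') = {cos τ H_n(·;Y) + sin τ H_n(·;Y') : τ ∈ [0, π/2]}`. -/
noncomputable def pspinFamily (p n : ℕ) (Y Y' : (Fin p → Fin n) → ℝ) :
    Set ((Fin n → ℝ) → ℝ) :=
  {h | ∃ τ ∈ Set.Icc (0 : ℝ) (Real.pi / 2),
    h = fun x => Real.cos τ * Hpspin p n Y x + Real.sin τ * Hpspin p n Y' x}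

/-- `f` is a random polynomial of degree at most `D` in the entries of a `p`-tensor:
for each `ω` (the internal randomness), every coordinate of `f ω` is the evaluation of a
multivariate polynomial of total degree at most `D`. -/
def IsRandPolyT (p n D : ℕ) {Ω : Type*}
    (f : Ω → ((Fin p → Fin n) → ℝ) → Fin n → ℝ) : Prop :=
  ∀ ω, ∃ P : Fin n → MvPolynomial (Fin p → Fin n) ℝ,
    (∀ i, (P i).totalDegree ≤ D) ∧ ∀ Y i, f ω Y i = MvPolynomial.eval Y (P i)

/-- `f` `(μ, δ, γ)`-optimizes the `p`-spin Hamiltonian on the sphere `𝒮_n`: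
`E_{Y,ω} ‖f(Y,ω)‖₂² = n`, and with probability at least `1 - δ` both
`H_n(g_f(Y,ω); Y) ≥ μ` and `‖f(Y,ω)‖₂ ≥ γ √n`, where `g_f = √n f / ‖f‖₂`. -/
noncomputable def OptimizesSphere (p n : ℕ) {Ω : Type*} [MeasurableSpace Ω] (Pω : Measure Ω)
    (f : Ω → ((Fin p → Fin n) → ℝ) → Fin n → ℝ) (μ δ γ : ℝ) : Prop :=
  (∫ z, ∑ i, (f z.2 z.1 i) ^ 2 ∂((tensorGaussian p n).prod Pω)) = n ∧
  ENNReal.ofReal (1 - δ) ≤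
    ((tensorGaussian p n).prod Pω)
      {z | μ ≤ Hpspin p n z.1
              (fun i => Real.sqrt n * f z.2 z.1 i / Real.sqrt (∑ j, (f z.2 z.1 j) ^ 2)) ∧
           γ * Real.sqrt n ≤ Real.sqrt (∑ j, (f z.2 z.1 j) ^ 2)}

/-- There is no random degree-`D` polynomial that `(μ, δ, γ)`-optimizes the `p`-spin
Hamiltonian on the sphere `𝒮_n`. -/
def NoRandPolyOptSphere (p n D : ℕ) (μ δ γ : ℝ) : Prop :=
  ∀ (Ω : Type) [MeasurableSpace Ω] (Pω : Measure Ω), IsProbabilityMeasure Pω →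
    ∀ f : Ω → ((Fin p → Fin n) → ℝ) → Fin n → ℝ,
      IsRandPolyT p n D f → ¬ OptimizesSphere p n Pω f μ δ γ

/-- The sign function, applied entrywise to round onto the hypercube. -/
noncomputable def sgn (x : ℝ) : ℝ := if 0 ≤ x then 1 else -1

/-- `f` `(μ, δ, γ, η)`-optimizes the `p`-spin Hamiltonian on the hypercube `Σ_n`:
`E_{Y,ω} ‖f(Y,ω)‖₂² = n`, and with probability at least `1 - δ` both
`H_n(sgn(f(Y,ω)); Y) ≥ μ` and `|{i : |f_i(Y,ω)| ≥ γ}| ≥ (1 - η) n`. -/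
noncomputable def OptimizesIsing (p n : ℕ) {Ω : Type*} [MeasurableSpace Ω] (Pω : Measure Ω)
    (f : Ω → ((Fin p → Fin n) → ℝ) → Fin n → ℝ) (μ δ γ η : ℝ) : Prop :=
  (∫ z, ∑ i, (f z.2 z.1 i) ^ 2 ∂((tensorGaussian p n).prod Pω)) = n ∧
  ENNReal.ofReal (1 - δ) ≤
    ((tensorGaussian p n).prod Pω)
      {z | μ ≤ Hpspin p n z.1 (fun i => sgn (f z.2 z.1 i)) ∧
           (1 - η) * n ≤ (({i | γ ≤ |f z.2 z.1 i|} : Set (Fin n)).ncard : ℝ)}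

/-- There is no random degree-`D` polynomial that `(μ, δ, γ, η)`-optimizes the `p`-spin
Hamiltonian on the hypercube `Σ_n`. -/
def NoRandPolyOptIsing (p n D : ℕ) (μ δ γ η : ℝ) : Prop :=
  ∀ (Ω : Type) [MeasurableSpace Ω] (Pω : Measure Ω), IsProbabilityMeasure Pω →
    ∀ f : Ω → ((Fin p → Fin n) → ℝ) → Fin n → ℝ,
      IsRandPolyT p n D f → ¬ OptimizesIsing p n Pω f μ δ γ η

/-- The maximum of the `p`-spin Hamiltonian over the sphere `𝒮_n`. -/
noncomputable def maxSphere (p n : ℕ) (Y : (Fin p → Fin n) → ℝ) : ℝ :=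
  sSup ((fun x => Hpspin p n Y x) '' sphereSet n)

open MeasureTheory ProbabilityTheory
namespace PS

/-- standard Gaussian -/
noncomputable abbrev gam (J : Type*) [Fintype J] : Measure (J → ℝ) :=
  Measure.pi fun _ => gaussianReal 0 1

lemma integrable_abs_gauss : Integrable (fun x : ℝ => x) (gaussianReal 0 1) := by
  have := memLp_id_gaussianReal (μ := 0) (v := 1) 1
  have h2 : MemLp (fun x : ℝ => x) 1 (gaussianReal 0 1) := by
    have h3 := this
    simp only [ENNReal.coe_one] at h3
    exact h3
  exact memLp_one_iff_integrable.1 h2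

lemma stein1 (g g' : ℝ → ℝ) (hg : ∀ x, HasDerivAt g (g' x) x) (C : ℝ)
    (hb : ∀ x, |g x| ≤ C) (hb' : ∀ x, |g' x| ≤ C) (hc : Continuous g') :
    ∫ s, s * g s ∂(gaussianReal 0 1) = ∫ s, g' s ∂(gaussianReal 0 1) := by
  have hgc : Continuous g := continuous_iff_continuousAt.2 fun x => (hg x).continuousAt
  have hd : ∀ x : ℝ, HasDerivAt (gaussianPDFReal 0 1) (-x * gaussianPDFReal 0 1 x) x := by
    intro x
    have h1 : gaussianPDFReal 0 1 = fun x : ℝ => (Real.sqrt (2 * Real.pi))⁻¹ * Real.exp (- x^2 / 2) := by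
      funext x; simp [gaussianPDFReal]
    rw [h1]
    have : HasDerivAt (fun x : ℝ => - x^2 / 2) (-x) x := by
      have h := ((hasDerivAt_pow 2 x).neg).div_const 2
      have e : -(((2:ℕ):ℝ) * x ^ (2 - 1)) / 2 = -x := by norm_num; ring
      rw [e] at h
      exact h
    have := (this.exp).const_mul ((Real.sqrt (2 * Real.pi))⁻¹)
    refine this.congr_deriv ?_
    ring
  have hI : Integrable (gaussianPDFReal 0 1) := integrable_gaussianPDFReal 0 1
  have hIx : Integrable (fun x => x * gaussianPDFReal 0 1 x) := by
    have h := integrable_abs_gauss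
    rw [gaussianReal_of_var_ne_zero _ one_ne_zero] at h
    have := (integrable_withDensity_iff_integrable_smul' (measurable_gaussianPDF 0 1)
      (by simp [gaussianPDF])).1 h
    refine this.congr (Filter.Eventually.of_forall fun x => ?_)
    simp [gaussianPDF, ENNReal.toReal_ofReal (gaussianPDFReal_nonneg 0 1 x), mul_comm]
  have key := integral_mul_deriv_eq_deriv_mul_of_integrable (u := g) (v := gaussianPDFReal 0 1)
    (u' := g') (v' := fun x => -x * gaussianPDFReal 0 1 x) (fun x _ => hg x) (fun x _ => hd x)
    ?_ ?_ ?_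
  · rw [integral_gaussianReal_eq_integral_smul one_ne_zero,
      integral_gaussianReal_eq_integral_smul one_ne_zero]
    have e1 : ∀ x, g x * (-x * gaussianPDFReal 0 1 x) = -(gaussianPDFReal 0 1 x • (x * g x)) := by
      intro x; simp; ring
    have e2 : ∀ x, g' x * gaussianPDFReal 0 1 x = gaussianPDFReal 0 1 x • g' x := by
      intro x; simp; ring
    simp only [e1, e2, integral_neg, neg_inj] at key
    exact key
  · have := (hIx.neg).bdd_mul (c := C) hgc.aestronglyMeasurable (Filter.Eventually.of_forall hb)
    refine this.congr (Filter.Eventually.of_forall fun x => ?_)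
    simp
  · exact hI.bdd_mul (c := C) hc.aestronglyMeasurable (Filter.Eventually.of_forall hb')
  · exact hI.bdd_mul (c := C) hgc.aestronglyMeasurable (Filter.Eventually.of_forall hb)

variable {J : Type*} [Fintype J]

open Classical in
lemma mp_update (k : J) : MeasurePreserving (fun q : (J → ℝ) × ℝ => Function.update q.1 k q.2)
    ((gam J).prod (gaussianReal 0 1)) (gam J) := by
  have hm : Measurable (fun q : (J → ℝ) × ℝ => Function.update q.1 k q.2) := by
    rw [measurable_pi_iff]
    intro a
    by_cases h : a = k
    · subst h; simpa using measurable_snd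
    · simp only [Function.update_of_ne h]
      exact (measurable_pi_apply a).comp measurable_fst
  refine ⟨hm, ?_⟩
  symm
  apply Measure.pi_eq
  intro s hs
  rw [Measure.map_apply hm (MeasurableSet.univ_pi hs)]
  have : (fun q : (J → ℝ) × ℝ => Function.update q.1 k q.2) ⁻¹' Set.univ.pi s =
      (Set.univ.pi (Function.update s k Set.univ)) ×ˢ s k := by
    ext ⟨y, t⟩
    simp only [Set.mem_preimage, Set.mem_pi, Set.mem_univ, forall_const, Set.mem_prod]
    constructor
    · intro h
      refine ⟨fun i => ?_, by simpa using h k⟩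
      by_cases hi : i = k
      · subst hi; simp
      · simpa [Function.update_of_ne hi] using h i
    · rintro ⟨h1, h2⟩ i
      by_cases hi : i = k
      · subst hi; simpa
      · simpa [Function.update_of_ne hi] using h1 i
  rw [this, Measure.prod_prod, Measure.pi_pi]
  rw [← Finset.mul_prod_erase _ _ (Finset.mem_univ k), ← Finset.mul_prod_erase _ _ (Finset.mem_univ k)]
  simp only [Function.update_self, measure_univ, one_mul]
  rw [mul_comm]
  congr 1
  apply Finset.prod_congr rfl
  intro i hi
  rw [Function.update_of_ne (Finset.ne_of_mem_erase hi)]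

lemma integrable_coord (k : J) : Integrable (fun y : J → ℝ => y k) (gam J) := by
  have := (measurePreserving_eval (fun _ : J => gaussianReal 0 1) k).integrable_comp
    (g := fun x : ℝ => x) (measurable_id.aestronglyMeasurable)
  exact this.2 integrable_abs_gauss

open Classical in
lemma stein (k : J) (F F' : (J → ℝ) → ℝ) (C : ℝ) (hF : Continuous F) (hF' : Continuous F')
    (hb : ∀ x, |F x| ≤ C) (hb' : ∀ x, |F' x| ≤ C)
    (hd : ∀ y s, HasDerivAt (fun s => F (Function.update y k s)) (F' (Function.update y k s)) s) :
    ∫ y, y k * F y ∂(gam J) = ∫ y, F' y ∂(gam J) := by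
  have mp := mp_update k
  have i1 : Integrable (fun y : J → ℝ => y k * F y) (gam J) :=
    (integrable_coord k).mul_bdd (c := C) hF.aestronglyMeasurable (Filter.Eventually.of_forall hb)
  have i2 : Integrable F' (gam J) :=
    Integrable.of_bound hF'.aestronglyMeasurable C (Filter.Eventually.of_forall hb')
  have j1 := (mp.integrable_comp i1.aestronglyMeasurable).2 i1
  have j2 := (mp.integrable_comp i2.aestronglyMeasurable).2 i2
  rw [← mp.map_eq, integral_map mp.aemeasurable (by rw [mp.map_eq]; exact i1.aestronglyMeasurable),
    integral_map mp.aemeasurable (by rw [mp.map_eq]; exact i2.aestronglyMeasurable)]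
  rw [integral_prod (fun q : (J → ℝ) × ℝ => Function.update q.1 k q.2 k * F (Function.update q.1 k q.2)) j1,
    integral_prod (fun q : (J → ℝ) × ℝ => F' (Function.update q.1 k q.2)) j2]
  congr 1
  funext y
  simp only [Function.update_self]
  have cu : Continuous fun s => Function.update y k s := by
    exact continuous_const.update k continuous_id
  exact stein1 _ _ (hd y) C (fun _ => hb _) (fun _ => hb' _) (hF'.comp cu)

end PS
open MeasureTheory ProbabilityTheory
namespace PS

/-- the linear field -/
noncomputable def fld {I L : Type*} [Fintype L] (a : I → L → ℝ) (m : I → ℝ) (y : L → ℝ) (i : I) : ℝ :=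
  (∑ l, a i l * y l) + m i

lemma fld_cont {I L : Type*} [Fintype L] (a : I → L → ℝ) (m : I → ℝ) : Continuous (fld a m) := by
  unfold fld; fun_prop

section lse
variable {I : Type*} [Fintype I]

noncomputable def lse (z : I → ℝ) : ℝ := Real.log (∑ i, Real.exp (z i))
noncomputable def sm (z : I → ℝ) (i : I) : ℝ := Real.exp (z i) / ∑ i, Real.exp (z i)

variable [Nonempty I]

lemma sexp_pos (z : I → ℝ) : 0 < ∑ i, Real.exp (z i) :=
  Finset.sum_pos (fun _ _ => Real.exp_pos _) Finset.univ_nonempty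

lemma sm_nonneg (z : I → ℝ) (i : I) : 0 ≤ sm z i :=
  div_nonneg (Real.exp_pos _).le (sexp_pos z).le

lemma sm_sum (z : I → ℝ) : ∑ i, sm z i = 1 := by
  unfold sm
  rw [← Finset.sum_div, div_self (sexp_pos z).ne']

lemma sm_le_one (z : I → ℝ) (i : I) : sm z i ≤ 1 := by
  rw [← sm_sum z]
  exact Finset.single_le_sum (fun i _ => sm_nonneg z i) (Finset.mem_univ i)

lemma sm_cont (i : I) : Continuous (fun z : I → ℝ => sm z i) := by
  unfold sm
  refine Continuous.div (by fun_prop) (by fun_prop) (fun z => (sexp_pos z).ne')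

lemma lse_cont : Continuous (fun z : I → ℝ => lse z) := by
  unfold lse
  refine Continuous.log (by fun_prop) (fun z => (sexp_pos z).ne')

lemma lse_deriv (z : ℝ → I → ℝ) (z' : I → ℝ) (s : ℝ) (h : ∀ i, HasDerivAt (fun s => z s i) (z' i) s) :
    HasDerivAt (fun s => lse (z s)) (∑ i, z' i * sm (z s) i) s := by
  have h1 : HasDerivAt (fun s => ∑ i, Real.exp (z s i)) (∑ i, Real.exp (z s i) * z' i) s := by
    apply HasDerivAt.fun_sum
    intro i _
    exact (h i).exp
  refine (h1.log (sexp_pos _).ne').congr_deriv ?_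
  unfold sm
  rw [Finset.sum_div]
  exact Finset.sum_congr rfl fun i _ => by ring

lemma sm_deriv (z : ℝ → I → ℝ) (z' : I → ℝ) (s : ℝ) (h : ∀ i, HasDerivAt (fun s => z s i) (z' i) s)
    (i : I) :
    HasDerivAt (fun s => sm (z s) i) (sm (z s) i * (z' i - ∑ j, z' j * sm (z s) j)) s := by
  have h1 : HasDerivAt (fun s => ∑ i, Real.exp (z s i)) (∑ i, Real.exp (z s i) * z' i) s := by
    apply HasDerivAt.fun_sum
    intro i _
    exact (h i).exp
  refine ((h i).exp.div h1 (sexp_pos _).ne').congr_deriv ?_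
  have hp := (sexp_pos (z s)).ne'
  have : ∑ j, z' j * sm (z s) j = (∑ i, Real.exp (z s i) * z' i) / ∑ i, Real.exp (z s i) := by
    unfold sm
    rw [Finset.sum_div]
    exact Finset.sum_congr rfl fun i _ => by ring
  rw [this]
  unfold sm
  field_simp

lemma lse_ge (z : I → ℝ) (i : I) : z i ≤ lse z := by
  unfold lse
  rw [Real.le_log_iff_exp_le (sexp_pos z)]
  exact Finset.single_le_sum (f := fun i => Real.exp (z i)) (fun i _ => (Real.exp_pos _).le) (Finset.mem_univ i)

lemma lse_le (z : I → ℝ) (M : ℝ) (h : ∀ i, z i ≤ M) : lse z ≤ M + Real.log (Fintype.card I) := by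
  unfold lse
  rw [Real.log_le_iff_le_exp (sexp_pos z), Real.exp_add, Real.exp_log (by positivity)]
  calc _ ≤ ∑ i : I, Real.exp M := Finset.sum_le_sum fun i _ => Real.exp_le_exp.2 (h i)
    _ = _ := by simp [mul_comm]

lemma lse_abs (z : I → ℝ) : |lse z| ≤ ∑ i, |z i| + Real.log (Fintype.card I) := by
  have h0 : 0 ≤ Real.log (Fintype.card I) := Real.log_natCast_nonneg _
  have h : ∀ i, |z i| ≤ ∑ i, |z i| := fun i =>
    Finset.single_le_sum (f := fun i => |z i|) (fun i _ => abs_nonneg _) (Finset.mem_univ i)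
  rw [abs_le]
  constructor
  · obtain ⟨i⟩ := ‹Nonempty I›
    have := lse_ge z i
    have := neg_abs_le (z i)
    linarith [h i]
  · exact lse_le z _ fun i => (le_abs_self _).trans (h i)

variable {L : Type*} [Fintype L]

lemma deriv_update_lin [DecidableEq L] (c : L → ℝ) (y : L → ℝ) (k : L) (m s : ℝ) :
    HasDerivAt (fun s => (∑ l, c l * Function.update y k s l) + m) (c k) s := by
  have : ∀ l ∈ Finset.univ, HasDerivAt (fun s => c l * Function.update y k s l) (if l = k then c l else 0) s := by
    intro l _
    by_cases h : l = k
    · subst h; simpa using (hasDerivAt_id s).const_mul (c l)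
    · simp [h]; exact hasDerivAt_const _ _
  refine ((HasDerivAt.fun_sum this).add_const m).congr_deriv ?_
  simp

lemma sm_stein (c : I → L → ℝ) (m : I → ℝ) (i : I) (k : L) :
    ∫ y, y k * sm (fld c m y) i ∂(gam L) =
      ∫ y, sm (fld c m y) i * (c i k - ∑ j, c j k * sm (fld c m y) j) ∂(gam L) := by
  classical
  have hs : ∀ i, Continuous fun y => sm (fld c m y) i := fun i => (sm_cont i).comp (fld_cont c m)
  have hB : ∀ y, |sm (fld c m y) i * (c i k - ∑ j, c j k * sm (fld c m y) j)| ≤ |c i k| + ∑ j, |c j k| := by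
    intro y
    rw [abs_mul, abs_of_nonneg (sm_nonneg _ _)]
    calc _ ≤ 1 * |c i k - ∑ j, c j k * sm (fld c m y) j| :=
          mul_le_mul_of_nonneg_right (sm_le_one _ _) (abs_nonneg _)
      _ ≤ |c i k| + |∑ j, c j k * sm (fld c m y) j| := by rw [one_mul]; exact abs_sub _ _
      _ ≤ _ := by
        gcongr
        refine (Finset.abs_sum_le_sum_abs _ _).trans (Finset.sum_le_sum fun j _ => ?_)
        rw [abs_mul, abs_of_nonneg (sm_nonneg _ _)]
        exact mul_le_of_le_one_right (abs_nonneg _) (sm_le_one _ _)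
  refine stein k (fun y => sm (fld c m y) i) (fun y => sm (fld c m y) i * (c i k - ∑ j, c j k * sm (fld c m y) j))
    (1 + (|c i k| + ∑ j, |c j k|)) (hs i) ?_ ?_ ?_ ?_
  · exact (hs i).mul (continuous_const.sub (continuous_finsetSum _ fun j _ => continuous_const.mul (hs j)))
  · intro y
    rw [abs_of_nonneg (sm_nonneg _ _)]
    have : 0 ≤ |c i k| + ∑ j, |c j k| := by positivity
    linarith [sm_le_one (fld c m y) i]
  · intro y; linarith [hB y]
  · intro y s
    exact sm_deriv (fun s => fld c m (Function.update y k s)) (fun j => c j k) s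
      (fun j => deriv_update_lin (c j) y k (m j) s) i

lemma integrable_lin (b : L → ℝ) : Integrable (fun y : L → ℝ => ∑ l, b l * y l) (gam L) :=
  integrable_finsetSum _ fun l _ => (integrable_coord l).const_mul _

lemma integrable_abs_sum : Integrable (fun y : L → ℝ => ∑ l, |y l|) (gam L) :=
  integrable_finsetSum _ fun l _ => (integrable_coord l).abs

lemma integrable_lse (c : I → L → ℝ) (m : I → ℝ) : Integrable (fun y => lse (fld c m y)) (gam L) := by
  have : Integrable (fun y : L → ℝ => ∑ i, |fld c m y i| + Real.log (Fintype.card I)) (gam L) := by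
    refine (integrable_finsetSum _ fun i _ => ?_).add (integrable_const _)
    unfold fld
    exact ((integrable_lin (c i)).add (integrable_const (m i))).abs
  refine this.mono' (lse_cont.comp (fld_cont c m)).aestronglyMeasurable ?_
  exact Filter.Eventually.of_forall fun y => lse_abs _

/-- derivative along a moving family -/
lemma lse_int_deriv (c c' : ℝ → I → L → ℝ) (m : I → ℝ) (B : ℝ)
    (hc : ∀ θ i l, HasDerivAt (fun θ => c θ i l) (c' θ i l) θ) (hB : ∀ θ i l, |c' θ i l| ≤ B) (θ : ℝ) :
    HasDerivAt (fun θ => ∫ y, lse (fld (c θ) m y) ∂(gam L))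
      (∫ y, ∑ i, (∑ l, c' θ i l * y l) * sm (fld (c θ) m y) i ∂(gam L)) θ := by
  refine (hasDerivAt_integral_of_dominated_loc_of_deriv_le (F := fun θ y => lse (fld (c θ) m y))
    (F' := fun θ y => ∑ i, (∑ l, c' θ i l * y l) * sm (fld (c θ) m y) i)
    (bound := fun y => ∑ i : I, B * ∑ l, |y l|) (s := Set.univ) Filter.univ_mem ?_ ?_ ?_ ?_ ?_ ?_).2
  · exact Filter.Eventually.of_forall fun θ => (integrable_lse _ _).aestronglyMeasurable
  · exact integrable_lse _ _
  · apply Continuous.aestronglyMeasurable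
    refine continuous_finsetSum _ fun i _ => Continuous.mul (by fun_prop) ((sm_cont i).comp (fld_cont _ m))
  · refine Filter.Eventually.of_forall fun y θ _ => ?_
    rw [Real.norm_eq_abs]
    refine (Finset.abs_sum_le_sum_abs _ _).trans (Finset.sum_le_sum fun i _ => ?_)
    rw [abs_mul, abs_of_nonneg (sm_nonneg _ _)]
    refine (mul_le_of_le_one_right (abs_nonneg _) (sm_le_one _ _)).trans ?_
    rw [Finset.mul_sum]
    refine (Finset.abs_sum_le_sum_abs _ _).trans (Finset.sum_le_sum fun l _ => ?_)
    rw [abs_mul]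
    exact mul_le_mul_of_nonneg_right (hB _ _ _) (abs_nonneg _)
  · exact integrable_finsetSum _ fun i _ => integrable_abs_sum.const_mul _
  · refine Filter.Eventually.of_forall fun y θ _ => ?_
    refine lse_deriv (fun θ => fld (c θ) m y) (fun i => ∑ l, c' θ i l * y l) θ fun i => ?_
    unfold fld
    refine HasDerivAt.add_const _ (HasDerivAt.fun_sum fun l _ => ?_)
    exact (hc θ i l).mul_const _

lemma sm_int_bdd (c : I → L → ℝ) (m : I → ℝ) (g : (L → ℝ) → ℝ) (hg : Integrable g (gam L)) (i : I) :
    Integrable (fun y => g y * sm (fld c m y) i) (gam L) := by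
  refine hg.mul_bdd (c := 1) ((sm_cont i).comp (fld_cont _ m)).aestronglyMeasurable
    (Filter.Eventually.of_forall fun y => ?_)
  rw [Real.norm_eq_abs, abs_of_nonneg (sm_nonneg _ _)]
  exact sm_le_one _ _

lemma lse_int_deriv_nonneg (c c' : I → L → ℝ) (m : I → ℝ)
    (h : ∀ i j, 0 ≤ ∑ l, (c' i l - c' j l) * (c i l - c j l)) :
    0 ≤ ∫ y, ∑ i, (∑ l, c' i l * y l) * sm (fld c m y) i ∂(gam L) := by
  have e1 : ∫ y, ∑ i, (∑ l, c' i l * y l) * sm (fld c m y) i ∂(gam L) =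
      ∑ i, ∑ l, c' i l * ∫ y, y l * sm (fld c m y) i ∂(gam L) := by
    have : ∀ y : L → ℝ, ∑ i, (∑ l, c' i l * y l) * sm (fld c m y) i =
      ∑ i, ∑ l, c' i l * (y l * sm (fld c m y) i) := by
      intro y
      refine Finset.sum_congr rfl fun i _ => ?_
      rw [Finset.sum_mul]
      exact Finset.sum_congr rfl fun l _ => by ring
    simp_rw [this]
    rw [integral_finsetSum _ fun i _ => integrable_finsetSum _ fun l _ =>
      (sm_int_bdd c m _ (integrable_coord l) i).const_mul _]
    refine Finset.sum_congr rfl fun i _ => ?_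
    rw [integral_finsetSum _ fun l _ => (sm_int_bdd c m _ (integrable_coord l) i).const_mul _]
    exact Finset.sum_congr rfl fun l _ => integral_const_mul _ _
  rw [e1]
  simp_rw [sm_stein c m]
  have hs : ∀ i, Continuous fun y => sm (fld c m y) i := fun i => (sm_cont i).comp (fld_cont c m)
  have hI : ∀ i l, Integrable (fun y => sm (fld c m y) i * (c i l - ∑ j, c j l * sm (fld c m y) j)) (gam L) := by
    intro i l
    have h1 : Integrable (fun y => (c i l - ∑ j, c j l * sm (fld c m y) j)) (gam L) := by
      refine (integrable_const _).sub (integrable_finsetSum _ fun j _ => ?_)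
      exact sm_int_bdd c m _ (integrable_const _) j
    refine (sm_int_bdd c m _ h1 i).congr (Filter.Eventually.of_forall fun y => ?_)
    simp only [mul_comm]
  have e2 : ∑ i, ∑ l, c' i l * ∫ y, sm (fld c m y) i * (c i l - ∑ j, c j l * sm (fld c m y) j) ∂(gam L) =
      ∫ y, ∑ i, ∑ l, c' i l * (sm (fld c m y) i * (c i l - ∑ j, c j l * sm (fld c m y) j)) ∂(gam L) := by
    rw [integral_finsetSum _ fun i _ => integrable_finsetSum _ fun l _ => (hI i l).const_mul _]
    refine Finset.sum_congr rfl fun i _ => ?_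
    rw [integral_finsetSum _ fun l _ => (hI i l).const_mul _]
    exact Finset.sum_congr rfl fun l _ => (integral_const_mul _ _).symm
  rw [e2]
  refine integral_nonneg fun y => ?_
  set q := fun i => sm (fld c m y) i with hq
  have hq1 : ∑ i, q i = 1 := sm_sum _
  have hq0 : ∀ i, 0 ≤ q i := fun i => sm_nonneg _ _
  have e3 : ∑ i, ∑ l, c' i l * (q i * (c i l - ∑ j, c j l * q j)) =
      ∑ i, ∑ j, q i * q j * ∑ l, c' i l * (c i l - c j l) := by
    refine Finset.sum_congr rfl fun i _ => ?_
    have : ∀ l, (c i l - ∑ j, c j l * q j) = ∑ j, q j * (c i l - c j l) := by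
      intro l
      simp_rw [mul_sub, Finset.sum_sub_distrib, ← Finset.sum_mul, hq1, one_mul, mul_comm]
    simp_rw [this, Finset.mul_sum]
    rw [Finset.sum_comm]
    exact Finset.sum_congr rfl fun l _ => Finset.sum_congr rfl fun j _ => by ring
  have e4 : ∑ i, ∑ j, q i * q j * ∑ l, c' i l * (c i l - c j l) =
      ∑ i, ∑ j, q i * q j * ∑ l, c' j l * (c j l - c i l) := by
    rw [Finset.sum_comm]
    exact Finset.sum_congr rfl fun l _ => Finset.sum_congr rfl fun j _ => by ring
  have e5 : (∑ i, ∑ j, q i * q j * ∑ l, c' i l * (c i l - c j l)) +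
      ∑ i, ∑ j, q i * q j * ∑ l, c' j l * (c j l - c i l) =
      ∑ i, ∑ j, q i * q j * ∑ l, (c' i l - c' j l) * (c i l - c j l) := by
    rw [← Finset.sum_add_distrib]
    refine Finset.sum_congr rfl fun i _ => ?_
    rw [← Finset.sum_add_distrib]
    refine Finset.sum_congr rfl fun j _ => ?_
    rw [← mul_add, ← Finset.sum_add_distrib]
    congr 1
    exact Finset.sum_congr rfl fun l _ => by ring
  have e6 : 0 ≤ ∑ i, ∑ j, q i * q j * ∑ l, (c' i l - c' j l) * (c i l - c j l) :=
    Finset.sum_nonneg fun i _ => Finset.sum_nonneg fun j _ =>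
      mul_nonneg (mul_nonneg (hq0 i) (hq0 j)) (h i j)
  change 0 ≤ ∑ i, ∑ l, c' i l * (q i * (c i l - ∑ j, c j l * q j))
  rw [e3]
  linarith

variable {J J' : Type*} [Fintype J] [Fintype J']

lemma lse_sf_aux (a : I → J → ℝ) (b : I → J' → ℝ) (m : I → ℝ)
    (h : ∀ i j, ∑ l, (a i l - a j l)^2 ≤ ∑ l, (b i l - b j l)^2) :
    ∫ y, lse (fld (fun i => Sum.elim (a i) (fun _ : J' => (0:ℝ))) m y) ∂(gam (J ⊕ J')) ≤
    ∫ y, lse (fld (fun i => Sum.elim (fun _ : J => (0:ℝ)) (b i)) m y) ∂(gam (J ⊕ J')) := by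
  let c : ℝ → I → J ⊕ J' → ℝ := fun θ i => Sum.elim (fun l => Real.cos θ * a i l) (fun l => Real.sin θ * b i l)
  let c' : ℝ → I → J ⊕ J' → ℝ := fun θ i => Sum.elim (fun l => -Real.sin θ * a i l) (fun l => Real.cos θ * b i l)
  have hd := fun θ => lse_int_deriv c c' m (∑ i, ((∑ l, |a i l|) + ∑ l, |b i l|)) (by
    rintro θ i (l | l)
    · exact (Real.hasDerivAt_cos θ).mul_const _
    · exact (Real.hasDerivAt_sin θ).mul_const _) (by
    intro θ i l
    have h1 : (∑ l, |a i l|) + ∑ l, |b i l| ≤ ∑ i, ((∑ l, |a i l|) + ∑ l, |b i l|) :=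
      Finset.single_le_sum (f := fun i => (∑ l, |a i l|) + ∑ l, |b i l|) (fun i _ => by positivity) (Finset.mem_univ i)
    refine le_trans ?_ h1
    rcases l with l | l
    · have h2 : |a i l| ≤ ∑ l, |a i l| := Finset.single_le_sum (f := fun l => |a i l|) (fun _ _ => abs_nonneg _) (Finset.mem_univ l)
      have h3 : 0 ≤ ∑ l, |b i l| := by positivity
      have : |c' θ i (Sum.inl l)| ≤ |a i l| := by
        simp only [c', Sum.elim_inl, abs_mul, abs_neg]
        exact mul_le_of_le_one_left (abs_nonneg _) (Real.abs_sin_le_one θ)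
      linarith
    · have h2 : |b i l| ≤ ∑ l, |b i l| := Finset.single_le_sum (f := fun l => |b i l|) (fun _ _ => abs_nonneg _) (Finset.mem_univ l)
      have h3 : 0 ≤ ∑ l, |a i l| := by positivity
      have : |c' θ i (Sum.inr l)| ≤ |b i l| := by
        simp only [c', Sum.elim_inr, abs_mul]
        exact mul_le_of_le_one_left (abs_nonneg _) (Real.abs_cos_le_one θ)
      linarith) θ
  have hmono : MonotoneOn (fun θ => ∫ y, lse (fld (c θ) m y) ∂(gam (J ⊕ J'))) (Set.Icc 0 (Real.pi / 2)) := by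
    refine monotoneOn_of_deriv_nonneg (convex_Icc _ _) (fun θ _ => (hd θ).continuousAt.continuousWithinAt)
      (fun θ _ => (hd θ).differentiableAt.differentiableWithinAt) ?_
    intro θ hθ
    rw [interior_Icc] at hθ
    rw [(hd θ).deriv]
    apply lse_int_deriv_nonneg
    intro i j
    have e : ∑ l, (c' θ i l - c' θ j l) * (c θ i l - c θ j l) = Real.sin θ * Real.cos θ *
        (∑ l, (b i l - b j l)^2 - ∑ l, (a i l - a j l)^2) := by
      rw [Fintype.sum_sum_type, mul_sub, Finset.mul_sum, Finset.mul_sum, sub_eq_neg_add, ← Finset.sum_neg_distrib]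
      congr 1 <;> refine Finset.sum_congr rfl fun l _ => ?_
      · simp only [c, c', Sum.elim_inl]; ring
      · simp only [c, c', Sum.elim_inr]; ring
    rw [e]
    have h1 := Real.sin_nonneg_of_mem_Icc ⟨hθ.1.le, by linarith [hθ.2, Real.pi_pos]⟩
    have h2 := Real.cos_nonneg_of_mem_Icc ⟨by linarith [hθ.1, Real.pi_pos], hθ.2.le⟩
    have := h i j
    exact mul_nonneg (mul_nonneg h1 h2) (by linarith)
  have := hmono (Set.left_mem_Icc.2 (by positivity)) (Set.right_mem_Icc.2 (by positivity)) (by positivity : (0:ℝ) ≤ Real.pi / 2)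
  simpa only [c, Real.cos_zero, Real.sin_zero, Real.cos_pi_div_two, Real.sin_pi_div_two, one_mul, zero_mul] using this

lemma mp_inl : MeasurePreserving (fun y : J ⊕ J' → ℝ => fun j => y (Sum.inl j)) (gam (J ⊕ J')) (gam J) :=
  measurePreserving_fst.comp (measurePreserving_sumPiEquivProdPi (fun _ : J ⊕ J' => gaussianReal 0 1))

lemma mp_inr : MeasurePreserving (fun y : J ⊕ J' → ℝ => fun j => y (Sum.inr j)) (gam (J ⊕ J')) (gam J') :=
  measurePreserving_snd.comp (measurePreserving_sumPiEquivProdPi (fun _ : J ⊕ J' => gaussianReal 0 1))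

lemma lse_sf (a : I → J → ℝ) (b : I → J' → ℝ) (m : I → ℝ)
    (h : ∀ i j, ∑ l, (a i l - a j l)^2 ≤ ∑ l, (b i l - b j l)^2) :
    ∫ y, lse (fld a m y) ∂(gam J) ≤ ∫ y, lse (fld b m y) ∂(gam J') := by
  have := lse_sf_aux a b m h
  have ca : Continuous fun y => lse (fld a m y) := lse_cont.comp (fld_cont a m)
  have cb : Continuous fun y => lse (fld b m y) := lse_cont.comp (fld_cont b m)
  rw [← (mp_inl (J := J) (J' := J')).map_eq, ← (mp_inr (J := J) (J' := J')).map_eq]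
  rw [integral_map (mp_inl (J := J) (J' := J')).aemeasurable ca.aestronglyMeasurable,
   integral_map (mp_inr (J := J) (J' := J')).aemeasurable cb.aestronglyMeasurable]
  have e1 : ∀ y, fld (fun i => Sum.elim (a i) fun _ : J' => (0:ℝ)) m y = fld a m (fun j => y (Sum.inl j)) := by
    intro y; funext i; simp [fld]
  have e2 : ∀ y, fld (fun i => Sum.elim (fun _ : J => (0:ℝ)) (b i)) m y = fld b m (fun j => y (Sum.inr j)) := by
    intro y; funext i; simp [fld]
  simp_rw [e1, e2] at this
  exact this

end lse
end PS
open MeasureTheory ProbabilityTheory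
set_option linter.unusedSectionVars false
namespace PS

def BV {K J : Type*} (a : K → J → ℝ) : Prop := ∃ C, ∀ k j, |a k j| ≤ C
def BM {K : Type*} (m : K → ℝ) : Prop := ∃ C, ∀ k, |m k| ≤ C

/-- supremum of the field -/
noncomputable def sp {K J : Type*} [Fintype J] (a : K → J → ℝ) (m : K → ℝ) (y : J → ℝ) : ℝ :=
  ⨆ k, fld a m y k

/-- expected supremum -/
noncomputable def GS {K J : Type*} [Fintype J] (a : K → J → ℝ) (m : K → ℝ) : ℝ :=
  ∫ y, sp a m y ∂(gam J)

section basic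
variable {K J : Type*} [Fintype J] {a : K → J → ℝ} {m : K → ℝ}

lemma BV.of_finite {K J : Type*} [Finite K] [Finite J] (a : K → J → ℝ) : BV a := by
  classical
  have := Fintype.ofFinite K
  have := Fintype.ofFinite J
  refine ⟨∑ k, ∑ j, |a k j|, fun k j => ?_⟩
  calc |a k j| ≤ ∑ j, |a k j| := Finset.single_le_sum (f := fun j => |a k j|) (fun _ _ => abs_nonneg _) (Finset.mem_univ j)
    _ ≤ _ := Finset.single_le_sum (f := fun k => ∑ j, |a k j|) (fun _ _ => by positivity) (Finset.mem_univ k)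

lemma BM.of_finite {K : Type*} [Finite K] (m : K → ℝ) : BM m := by
  have := Fintype.ofFinite K
  exact ⟨∑ k, |m k|, fun k => Finset.single_le_sum (f := fun j => |m j|) (fun _ _ => abs_nonneg _) (Finset.mem_univ k)⟩

lemma BV.comp {K' : Type*} (h : BV a) (f : K' → K) : BV (fun k => a (f k)) := by
  obtain ⟨C, h⟩ := h; exact ⟨C, fun k j => h _ _⟩
lemma BM.comp {K' : Type*} (h : BM m) (f : K' → K) : BM (fun k => m (f k)) := by
  obtain ⟨C, h⟩ := h; exact ⟨C, fun k => h _⟩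
lemma BV.elim {J' : Type*} {b : K → J' → ℝ} (h : BV a) (h' : BV b) : BV (fun k => Sum.elim (a k) (b k)) := by
  obtain ⟨C, h⟩ := h; obtain ⟨C', h'⟩ := h'
  refine ⟨max C C', ?_⟩
  rintro k (j | j)
  · exact (h k j).trans (le_max_left _ _)
  · exact (h' k j).trans (le_max_right _ _)
lemma BV.smul (h : BV a) (r : ℝ) : BV (fun k j => r * a k j) := by
  obtain ⟨C, h⟩ := h
  exact ⟨|r| * C, fun k j => by rw [abs_mul]; exact mul_le_mul_of_nonneg_left (h k j) (abs_nonneg _)⟩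
lemma BM.smul (h : BM m) (r : ℝ) : BM (fun k => r * m k) := by
  obtain ⟨C, h⟩ := h
  exact ⟨|r| * C, fun k => by rw [abs_mul]; exact mul_le_mul_of_nonneg_left (h k) (abs_nonneg _)⟩
lemma BV.add {b : K → J → ℝ} (h : BV a) (h' : BV b) : BV (fun k j => a k j + b k j) := by
  obtain ⟨C, h⟩ := h; obtain ⟨C', h'⟩ := h'
  exact ⟨C + C', fun k j => (abs_add_le _ _).trans (add_le_add (h k j) (h' k j))⟩
lemma BM.add {m' : K → ℝ} (h : BM m) (h' : BM m') : BM (fun k => m k + m' k) := by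
  obtain ⟨C, h⟩ := h; obtain ⟨C', h'⟩ := h'
  exact ⟨C + C', fun k => (abs_add_le _ _).trans (add_le_add (h k) (h' k))⟩
lemma BM.const (c : ℝ) : BM (fun _ : K => c) := ⟨|c|, fun _ => le_rfl⟩
lemma BV.const (c : ℝ) : BV (fun (_ : K) (_ : J) => c) := ⟨|c|, fun _ _ => le_rfl⟩

lemma fld_abs_le {C : ℝ} {C' : ℝ} (h : ∀ k j, |a k j| ≤ C) (h' : ∀ k, |m k| ≤ C') (y : J → ℝ) (k : K) :
    |fld a m y k| ≤ C * ∑ j, |y j| + C' := by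
  unfold fld
  refine (abs_add_le _ _).trans (add_le_add ?_ (h' k))
  rw [Finset.mul_sum]
  refine (Finset.abs_sum_le_sum_abs _ _).trans (Finset.sum_le_sum fun j _ => ?_)
  rw [abs_mul]
  exact mul_le_mul_of_nonneg_right (h k j) (abs_nonneg _)

lemma BM.fld (h : BV a) (h' : BM m) (y : J → ℝ) : BM (fld a m y) := by
  obtain ⟨C, h⟩ := h; obtain ⟨C', h'⟩ := h'
  exact ⟨_, fun k => fld_abs_le h h' y k⟩

lemma fld_bddAbove (h : BV a) (h' : BM m) (y : J → ℝ) : BddAbove (Set.range (PS.fld a m y)) := by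
  obtain ⟨C, hC⟩ := BM.fld h h' y
  refine ⟨C, ?_⟩
  rintro _ ⟨k, rfl⟩
  exact (le_abs_self _).trans (hC k)

lemma le_sp (h : BV a) (h' : BM m) (y : J → ℝ) (k : K) : PS.fld a m y k ≤ sp a m y :=
  le_ciSup (fld_bddAbove h h' y) k

variable [Nonempty K]

lemma sp_le {y : J → ℝ} {B : ℝ} (h : ∀ k, PS.fld a m y k ≤ B) : sp a m y ≤ B := ciSup_le h

lemma sp_abs_le {C : ℝ} {C' : ℝ} (h : ∀ k j, |a k j| ≤ C) (h' : ∀ k, |m k| ≤ C') (y : J → ℝ) :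
    |sp a m y| ≤ C * ∑ j, |y j| + C' := by
  rw [abs_le]
  constructor
  · obtain ⟨k⟩ := ‹Nonempty K›
    have h1 := le_sp (a := a) (m := m) ⟨C, h⟩ ⟨C', h'⟩ y k
    have h2 := fld_abs_le h h' y k
    have := neg_abs_le (fld a m y k)
    linarith
  · exact sp_le fun k => (le_abs_self _).trans (fld_abs_le h h' y k)

lemma sp_cont (h : BV a) (h' : BM m) : Continuous (sp a m) := by
  have ⟨C, hC⟩ := h
  have hC0 : ∀ k j, |a k j| ≤ |C| := fun k j => (hC k j).trans (le_abs_self _)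
  have key : ∀ y y', sp a m y - sp a m y' ≤ |C| * ∑ j, |y j - y' j| := by
    intro y y'
    rw [sub_le_iff_le_add]
    refine sp_le fun k => ?_
    have h1 := le_sp h h' y' k
    have : fld a m y k - fld a m y' k ≤ |C| * ∑ j, |y j - y' j| := by
      have := fld_abs_le (a := a) (m := fun _ => 0) hC0 (C' := 0) (by simp) (fun j => y j - y' j) k
      have e : fld a (fun _ => 0) (fun j => y j - y' j) k = fld a m y k - fld a m y' k := by
        simp [fld, mul_sub]
      rw [e] at this
      linarith [le_abs_self (fld a m y k - fld a m y' k)]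
    linarith
  rw [continuous_iff_continuousAt]
  intro y
  rw [ContinuousAt, tendsto_iff_dist_tendsto_zero]
  have h0 : Filter.Tendsto (fun z : J → ℝ => |C| * ∑ j, |z j - y j|) (nhds y) (nhds 0) := by
    have : Continuous (fun z : J → ℝ => |C| * ∑ j, |z j - y j|) := by fun_prop
    have := this.tendsto y
    simpa using this
  refine squeeze_zero (fun _ => dist_nonneg) (fun z => ?_) h0
  rw [Real.dist_eq, abs_le]
  constructor
  · have := key y z
    simp_rw [abs_sub_comm (y _)] at this
    linarith
  · exact key z y

lemma sp_int (h : BV a) (h' : BM m) : Integrable (sp a m) (gam J) := by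
  have ⟨C, hC⟩ := h
  have ⟨C', hC'⟩ := h'
  refine Integrable.mono' ((integrable_abs_sum.const_mul C).add (integrable_const C')) (sp_cont h h').aestronglyMeasurable ?_
  exact Filter.Eventually.of_forall fun y => sp_abs_le hC hC' y

lemma GS_reindex {K' : Type*} [Nonempty K'] (h : BV a) (h' : BM m) (f : K' → K) :
    GS (fun k => a (f k)) (fun k => m (f k)) ≤ GS a m :=
  integral_mono (sp_int (h.comp f) (h'.comp f)) (sp_int h h') fun y => sp_le fun k => le_sp h h' y (f k)

omit [Nonempty K] in
lemma GS_surj {K' : Type*} (f : K' → K) (hf : Function.Surjective f) :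
    GS (fun k => a (f k)) (fun k => m (f k)) = GS a m := by
  unfold GS
  congr 1; funext y
  exact hf.iSup_comp (fld a m y)

lemma GS_mono_m {m' : K → ℝ} (h : BV a) (h' : BM m) (h'' : BM m') (hm : ∀ k, m k ≤ m' k) : GS a m ≤ GS a m' :=
  integral_mono (sp_int h h') (sp_int h h'') fun y => sp_le fun k => by
    refine le_trans ?_ (le_sp h h'' y k)
    unfold fld; linarith [hm k]

lemma GS_add {b : K → J → ℝ} {m' : K → ℝ} (h : BV a) (h' : BM m) (hb : BV b) (hb' : BM m') :
    GS (fun k j => a k j + b k j) (fun k => m k + m' k) ≤ GS a m + GS b m' := by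
  unfold GS
  rw [← integral_add (sp_int h h') (sp_int hb hb')]
  refine integral_mono (sp_int (h.add hb) (h'.add hb')) ((sp_int h h').add (sp_int hb hb')) fun y => sp_le fun k => ?_
  have h1 := le_sp h h' y k
  have h2 := le_sp hb hb' y k
  have e : fld (fun k j => a k j + b k j) (fun k => m k + m' k) y k = fld a m y k + fld b m' y k := by
    simp [fld, add_mul, Finset.sum_add_distrib]; ring
  rw [e]
  exact add_le_add h1 h2

omit [Nonempty K] in
lemma GS_smul (r : ℝ) (hr : 0 ≤ r) :
    GS (fun k j => r * a k j) (fun k => r * m k) = r * GS a m := by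
  unfold GS
  rw [← integral_const_mul]
  congr 1; funext y
  unfold sp
  rw [Real.mul_iSup_of_nonneg hr]
  congr 1; funext k
  simp [fld, mul_add, Finset.mul_sum, mul_assoc]

lemma GS_add_const (c : ℝ) (h : BV a) (h' : BM m) : GS a (fun k => m k + c) = GS a m + c := by
  have : ∀ y, sp a (fun k => m k + c) y = sp a m y + c := by
    intro y
    unfold sp
    rw [ciSup_add (fld_bddAbove h h' y)]
    congr 1; funext k
    simp [fld]; ring
  unfold GS
  simp_rw [this]
  rw [integral_add (sp_int h h') (integrable_const c)]
  simp

lemma integral_coord (j : J) : ∫ y, y j ∂(gam J) = 0 := by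
  have mp := measurePreserving_eval (fun _ : J => gaussianReal 0 1) j
  have : ∫ y, y j ∂(gam J) = ∫ x, x ∂(Measure.map (Function.eval j) (gam J)) :=
    (integral_map mp.aemeasurable measurable_id.aestronglyMeasurable).symm
  rw [this, mp.map_eq]
  simp

lemma GS_ge (h : BV a) (h' : BM m) (k : K) : m k ≤ GS a m := by
  have : ∫ y, fld a m y k ∂(gam J) = m k := by
    unfold fld
    rw [integral_add (integrable_lin (a k)) (integrable_const _), integral_finsetSum _ fun l _ => (integrable_coord l).const_mul _]
    simp [integral_const_mul, integral_coord]
  rw [← this]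
  refine integral_mono ?_ (sp_int h h') fun y => le_sp h h' y k
  exact (integrable_lin (a k)).add (integrable_const _)

lemma GS_fubini {J' : Type*} [Fintype J'] {b : K → J' → ℝ} (h : BV a) (hb : BV b) (h' : BM m) :
    Integrable (fun y => GS b (fld a m y)) (gam J) ∧
    GS (fun k => Sum.elim (a k) (b k)) m = ∫ y, GS b (fld a m y) ∂(gam J) := by
  have hI := sp_int (h.elim hb) h'
  have mp := (measurePreserving_sumPiEquivProdPi_symm (fun _ : J ⊕ J' => gaussianReal 0 1))
  have hI2 := (mp.integrable_comp hI.aestronglyMeasurable).2 hI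
  have e : ∀ q : (J → ℝ) × (J' → ℝ), (sp (fun k => Sum.elim (a k) (b k)) m ∘ (MeasurableEquiv.sumPiEquivProdPi (fun _ : J ⊕ J' => ℝ)).symm) q =
     sp b (fld a m q.1) q.2 := by
    rintro ⟨y, y'⟩
    simp only [Function.comp, sp]
    congr 1; funext k
    simp [fld, MeasurableEquiv.sumPiEquivProdPi, Equiv.sumPiEquivProdPi]
    ring
  have hI3 : Integrable (fun q : (J → ℝ) × (J' → ℝ) => sp b (fld a m q.1) q.2) ((gam J).prod (gam J')) :=
    hI2.congr (Filter.Eventually.of_forall e)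
  refine ⟨hI3.integral_prod_left, ?_⟩
  rw [GS, ← mp.integral_comp (MeasurableEquiv.measurableEmbedding _)]
  have : ∀ x : (J → ℝ) × (J' → ℝ), sp (fun k => Sum.elim (a k) (b k)) m ((MeasurableEquiv.sumPiEquivProdPi fun _ : J ⊕ J' => ℝ).symm x) =
    sp b (fld a m x.1) x.2 := e
  simp_rw [this]
  exact integral_prod _ hI3

end basic
end PS
open MeasureTheory ProbabilityTheory
set_option linter.unusedSectionVars false
namespace PS
section sf
variable {K J J' : Type*} [Fintype J] [Fintype J'] {a : K → J → ℝ} {b : K → J' → ℝ} {m : K → ℝ}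

lemma GS_sf_fin [Finite K] [Nonempty K]
    (h : ∀ i j, ∑ l, (a i l - a j l)^2 ≤ ∑ l, (b i l - b j l)^2) : GS a m ≤ GS b m := by
  have := Fintype.ofFinite K
  have key : ∀ β : ℝ, 0 < β → β * GS a m ≤ β * GS b m + Real.log (Fintype.card K) := by
    intro β hβ
    have h1 : β * GS a m ≤ ∫ y, lse (fld (fun k j => β * a k j) (fun k => β * m k) y) ∂(gam J) := by
      rw [← GS_smul β hβ.le]
      refine integral_mono (sp_int (BV.of_finite _) (BM.of_finite _)) (integrable_lse _ _) fun y => sp_le fun k => lse_ge _ k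
    have h2 : ∫ y, lse (fld (fun k j => β * b k j) (fun k => β * m k) y) ∂(gam J') ≤ β * GS b m + Real.log (Fintype.card K) := by
      rw [← GS_smul β hβ.le]
      have hi := (sp_int (BV.of_finite (fun k j => β * b k j)) (BM.of_finite (fun k => β * m k)))
      calc _ ≤ ∫ y, (sp (fun k j => β * b k j) (fun k => β * m k) y + Real.log (Fintype.card K)) ∂(gam J') := by
            refine integral_mono (integrable_lse _ _) (hi.add (integrable_const _)) fun y => lse_le _ _ fun k =>
              le_sp (BV.of_finite _) (BM.of_finite _) y k
        _ = _ := by rw [integral_add hi (integrable_const _)]; simp [GS]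
    have h3 := lse_sf (fun k j => β * a k j) (fun k j => β * b k j) (fun k => β * m k) (by
      intro i j
      have e : ∀ x y : ℝ, (β * x - β * y)^2 = β^2 * (x - y)^2 := fun x y => by ring
      simp_rw [e, ← Finset.mul_sum]
      exact mul_le_mul_of_nonneg_left (h i j) (by positivity))
    linarith
  have hl : 0 ≤ Real.log (Fintype.card K) := Real.log_natCast_nonneg _
  refine le_of_forall_pos_le_add fun ε hε => ?_
  have hb : 0 < (Real.log (Fintype.card K) + 1) / ε := by positivity
  have := key _ hb
  have e : Real.log (Fintype.card K) ≤ (Real.log (Fintype.card K) + 1) / ε * ε := by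
    rw [div_mul_cancel₀ _ hε.ne']; linarith
  refine le_of_mul_le_mul_left ?_ hb
  rw [mul_add]; linarith

lemma GS_finapprox [Nonempty K] (h : BV a) (h' : BM m) (B : ℝ)
    (hT : ∀ T : Finset K, T.Nonempty → GS (fun k : T => a k) (fun k : T => m k) ≤ B) : GS a m ≤ B := by
  classical
  let P : K → (J → ℝ) × ℝ := fun k => (a k, m k)
  let S : Set ((J → ℝ) × ℝ) := Set.range P
  have : Nonempty S := ⟨⟨P (Classical.arbitrary K), Set.mem_range_self _⟩⟩
  have hk : ∀ n, ∃ k, P k = (TopologicalSpace.denseSeq S n : (J → ℝ) × ℝ) := fun n =>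
    (TopologicalSpace.denseSeq S n).2
  choose κ hκ using hk
  let T : ℕ → Finset K := fun n => (Finset.range (n+1)).image κ
  have hTn : ∀ n, (T n).Nonempty := fun n => ⟨κ 0, Finset.mem_image_of_mem _ (by simp)⟩
  have hne : ∀ n, Nonempty (T n) := fun n => (hTn n).to_subtype
  have ⟨C, hC⟩ := h
  have ⟨C', hC'⟩ := h'
  have hlim : Filter.Tendsto (fun n => ∫ y, sp (fun k : T n => a k) (fun k : T n => m k) y ∂(gam J)) Filter.atTop
      (nhds (∫ y, sp a m y ∂(gam J))) := by
    refine tendsto_integral_of_dominated_convergence (fun y => C * ∑ j, |y j| + C') ?_ ?_ ?_ ?_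
    · intro n
      exact (sp_int (h.comp _) (h'.comp _)).aestronglyMeasurable
    · exact (integrable_abs_sum.const_mul C).add (integrable_const C')
    · intro n
      exact Filter.Eventually.of_forall fun y => sp_abs_le (fun k j => hC _ _) (fun k => hC' _) y
    · refine Filter.Eventually.of_forall fun y => ?_
      rw [Metric.tendsto_atTop]
      intro ε hε
      obtain ⟨k, hk⟩ := exists_lt_of_lt_ciSup (show sp a m y - ε < ⨆ k, fld a m y k by unfold sp; linarith)
      let U : Set S := {q | sp a m y - ε < (∑ j, q.1.1 j * y j) + q.1.2}
      have hU : IsOpen U := isOpen_lt continuous_const (by fun_prop)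
      obtain ⟨n, hn⟩ := (TopologicalSpace.denseRange_denseSeq S).exists_mem_open hU ⟨⟨P k, Set.mem_range_self _⟩, hk⟩
      refine ⟨n, fun N hN => ?_⟩
      have h1 : sp a m y - ε < fld a m y (κ n) := by
        have : sp a m y - ε < (∑ j, (TopologicalSpace.denseSeq S n : (J → ℝ) × ℝ).1 j * y j) + (TopologicalSpace.denseSeq S n : (J → ℝ) × ℝ).2 := hn
        rw [← hκ n] at this
        exact this
      have hmem : κ n ∈ T N := Finset.mem_image_of_mem _ (by simp; omega)
      have h2 : fld a m y (κ n) ≤ sp (fun k : T N => a k) (fun k : T N => m k) y :=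
        le_sp (a := fun k : T N => a k) (m := fun k : T N => m k) (h.comp _) (h'.comp _) y ⟨κ n, hmem⟩
      have h3 : sp (fun k : T N => a k) (fun k : T N => m k) y ≤ sp a m y := sp_le fun k => le_sp h h' y k
      rw [Real.dist_eq, abs_lt]
      constructor <;> linarith
  exact le_of_tendsto' hlim fun n => hT _ (hTn n)

/-- Sudakov–Fernique -/
theorem SF [Nonempty K] (ha : BV a) (hb : BV b) (hm : BM m)
    (h : ∀ i j, ∑ l, (a i l - a j l)^2 ≤ ∑ l, (b i l - b j l)^2) : GS a m ≤ GS b m := by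
  refine GS_finapprox ha hm _ fun T hT => ?_
  have := hT.to_subtype
  exact (GS_sf_fin (b := fun k : T => b k) fun i j => h i j).trans (GS_reindex hb hm _)

theorem SF_eq [Nonempty K] (ha : BV a) (hb : BV b) (hm : BM m)
    (h : ∀ i j, ∑ l, (a i l - a j l)^2 = ∑ l, (b i l - b j l)^2) : GS a m = GS b m :=
  le_antisymm (SF ha hb hm fun i j => (h i j).le) (SF hb ha hm fun i j => (h i j).ge)

end sf
end PS
open MeasureTheory ProbabilityTheory
set_option linter.unusedSectionVars false
namespace PS

lemma BV.of_sq {K J : Type*} [Fintype J] {a : K → J → ℝ} (C : ℝ) (h : ∀ k, ∑ j, (a k j)^2 ≤ C) : BV a := by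
  refine ⟨C + 1, fun k j => ?_⟩
  have h1 : (a k j)^2 ≤ C := (Finset.single_le_sum (f := fun j => (a k j)^2) (fun _ _ => sq_nonneg _) (Finset.mem_univ j)).trans (h k)
  rw [abs_le]
  constructor <;> nlinarith [sq_nonneg (a k j - 1), sq_nonneg (a k j + 1)]

section gen
variable {K J J' : Type*} [Fintype J] [Fintype J'] {a : K → J → ℝ} {b : K → J' → ℝ} {m m' : K → ℝ} [Nonempty K]

lemma GS_elim_add (ha : BV a) (hb : BV b) (hm : BM m) (hm' : BM m') :
    GS (fun k => Sum.elim (a k) (b k)) (fun k => m k + m' k) ≤ GS a m + GS b m' := by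
  have h0 : BV (fun (_ : K) (_ : J') => (0:ℝ)) := BV.const 0
  have h0' : BV (fun (_ : K) (_ : J) => (0:ℝ)) := BV.const 0
  have h1 : GS a m = GS (fun k => Sum.elim (a k) (fun _ : J' => (0:ℝ))) m :=
    SF_eq ha (ha.elim h0) hm fun i j => by simp
  have h2 : GS b m' = GS (fun k => Sum.elim (fun _ : J => (0:ℝ)) (b k)) m' :=
    SF_eq hb (h0'.elim hb) hm' fun i j => by simp
  rw [h1, h2]
  have := GS_add (ha.elim h0) hm (h0'.elim hb) hm'
  convert this using 2
  funext k j
  rcases j with j | j <;> simp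

lemma GS_elim_add0 (ha : BV a) (hb : BV b) (hm : BM m) :
    GS (fun k => Sum.elim (a k) (b k)) m ≤ GS a m + GS b (fun _ => 0) := by
  have := GS_elim_add ha hb hm (BM.const (K := K) 0)
  simpa using this

noncomputable def kap : ℝ := ∫ y : Unit → ℝ, |y ()| ∂(gam Unit)

lemma GS_scalar (w : K → ℝ) (W : ℝ) (hw : ∀ k, |w k| ≤ W) : GS (fun k (_ : Unit) => w k) (fun _ => 0) ≤ W * kap := by
  unfold kap
  rw [← integral_const_mul]
  refine integral_mono (sp_int ⟨W, fun k _ => hw k⟩ (BM.const 0)) ((integrable_coord ()).abs.const_mul W) fun y => ?_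
  refine sp_le fun k => ?_
  simp only [fld, Finset.univ_unique, Finset.sum_singleton, add_zero]
  refine (le_abs_self _).trans ?_
  rw [abs_mul]
  exact mul_le_mul_of_nonneg_right (hw k) (abs_nonneg _)

end gen

lemma kap_nonneg : 0 ≤ kap := integral_nonneg fun _ => abs_nonneg _

lemma kap_pos : 0 < kap := by
  rcases kap_nonneg.lt_or_eq with h | h
  · exact h
  exfalso
  have h1 : (fun y : Unit → ℝ => |y ()|) =ᵐ[gam Unit] 0 :=
    (integral_eq_zero_iff_of_nonneg (fun _ => abs_nonneg _) (integrable_coord ()).abs).1 h.symm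
  have mp := measurePreserving_eval (fun _ : Unit => gaussianReal 0 1) ()
  have h2 : ∀ᵐ x ∂(gaussianReal 0 1), x ∈ ({0} : Set ℝ) := by
    rw [← mp.map_eq, ae_map_iff mp.aemeasurable (p := fun x => x ∈ ({0} : Set ℝ)) (measurableSet_singleton 0)]
    filter_upwards [h1] with y hy
    simpa using hy
  have : NullSingletonClass (gaussianReal 0 1) := nullSingletonClass_gaussianReal one_ne_zero
  have h3 : (gaussianReal 0 1) ({0} : Set ℝ) = 0 := measure_singleton _
  have h4 : (gaussianReal 0 1) ({0} : Set ℝ)ᶜ = 0 := h2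
  have h5 : (gaussianReal 0 1) Set.univ ≤ 0 := by
    rw [← Set.union_compl_self ({0} : Set ℝ)]
    refine (measure_union_le _ _).trans ?_
    rw [h3, h4]; simp
  simp at h5

lemma greedy {T : Type*} [Finite T] (m : T → ℝ) (r : T → T → Prop) (hr : ∀ x, r x x) (hs : ∀ x y, r x y → r y x) :
    ∃ s : T → T, (∀ x, m x ≤ m (s x) ∧ r (s x) x) ∧ ∀ x x', s x ≠ s x' → ¬ r (s x) (s x') := by
  classical
  have := Fintype.ofFinite T
  suffices ∀ A : Finset T, ∃ s : T → T, (∀ x ∈ A, s x ∈ A ∧ m x ≤ m (s x) ∧ r (s x) x) ∧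
      ∀ x ∈ A, ∀ x' ∈ A, s x ≠ s x' → ¬ r (s x) (s x') by
    obtain ⟨s, h1, h2⟩ := this Finset.univ
    exact ⟨s, fun x => (h1 x (Finset.mem_univ x)).2, fun x x' => h2 x (Finset.mem_univ x) x' (Finset.mem_univ x')⟩
  intro A
  induction A using Finset.induction_on_min_value m with
  | empty => exact ⟨id, by simp, by simp⟩
  | insert a A ha hmin ih =>
    obtain ⟨s, h1, h2⟩ := ih
    by_cases hex : ∃ x ∈ A, r (s x) a
    · obtain ⟨x0, hx0, hrx⟩ := hex
      refine ⟨Function.update s a (s x0), ?_, ?_⟩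
      · intro x hx
        rcases Finset.mem_insert.1 hx with rfl | hxA
        · simp only [Function.update_self]
          exact ⟨Finset.mem_insert_of_mem (h1 x0 hx0).1, hmin _ (h1 x0 hx0).1, hrx⟩
        · rw [Function.update_of_ne (by rintro rfl; exact ha hxA)]
          exact ⟨Finset.mem_insert_of_mem (h1 x hxA).1, (h1 x hxA).2⟩
      · have key : ∀ x ∈ insert a A, ∃ z ∈ A, Function.update s a (s x0) x = s z := by
          intro x hx
          rcases Finset.mem_insert.1 hx with rfl | hxA
          · exact ⟨x0, hx0, by simp⟩
          · exact ⟨x, hxA, Function.update_of_ne (by rintro rfl; exact ha hxA) _ _⟩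
        intro x hx x' hx'
        obtain ⟨z, hz, ez⟩ := key x hx
        obtain ⟨z', hz', ez'⟩ := key x' hx'
        rw [ez, ez']
        exact h2 z hz z' hz'
    · push Not at hex
      refine ⟨Function.update s a a, ?_, ?_⟩
      · intro x hx
        rcases Finset.mem_insert.1 hx with rfl | hxA
        · simp only [Function.update_self]
          exact ⟨Finset.mem_insert_self _ _, le_rfl, hr _⟩
        · rw [Function.update_of_ne (by rintro rfl; exact ha hxA)]
          exact ⟨Finset.mem_insert_of_mem (h1 x hxA).1, (h1 x hxA).2⟩
      · intro x hx x' hx'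
        rcases Finset.mem_insert.1 hx with rfl | hxA
        · rcases Finset.mem_insert.1 hx' with rfl | hxA'
          · simp
          · rw [Function.update_self, Function.update_of_ne (by rintro rfl; exact ha hxA')]
            exact fun _ h => hex x' hxA' (hs _ _ h)
        · rw [Function.update_of_ne (by rintro rfl; exact ha hxA)]
          rcases Finset.mem_insert.1 hx' with rfl | hxA'
          · rw [Function.update_self]
            exact fun _ h => hex x hxA h
          · rw [Function.update_of_ne (by rintro rfl; exact ha hxA')]
            exact h2 x hxA x' hxA'

/-- the sphere as a type -/
abbrev Sph (n : ℕ) := {x : Fin n → ℝ // x ∈ sphereSet n}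

noncomputable def Rs {n : ℕ} (x y : Fin n → ℝ) : ℝ := (∑ i, x i * y i) / n
noncomputable def hv (p : ℕ) {n : ℕ} (x : Fin n → ℝ) : (Fin p → Fin n) → ℝ :=
  fun j => (n : ℝ) ^ (-(((p : ℝ) + 1) / 2)) * ∏ l, x (j l)
noncomputable def lv {n : ℕ} (x : Fin n → ℝ) : Fin n → ℝ := fun i => x i / n

lemma H_eq (p n : ℕ) (Y : (Fin p → Fin n) → ℝ) (x : Fin n → ℝ) : Hpspin p n Y x = ∑ j, hv p x j * Y j := by
  unfold Hpspin hv
  rw [Finset.mul_sum]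
  exact Finset.sum_congr rfl fun j _ => by ring

section sph
variable {n : ℕ} [NeZero n]

lemma npos : (0:ℝ) < n := Nat.cast_pos.2 (NeZero.pos n)

lemma Rs_comm (x y : Fin n → ℝ) : Rs x y = Rs y x := by
  unfold Rs; congr 1; exact Finset.sum_congr rfl fun i _ => mul_comm _ _

lemma sph_sq (x : Sph n) : ∑ i, (x.1 i)^2 = n := x.2

lemma Rs_self (x : Sph n) : Rs x.1 x.1 = 1 := by
  unfold Rs
  have := sph_sq x
  simp_rw [sq] at this
  rw [this, div_self (npos (n := n)).ne']

lemma Rs_cs (x y : Fin n → ℝ) : (Rs x y)^2 ≤ Rs x x * Rs y y := by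
  unfold Rs
  rw [div_pow, div_mul_div_comm, ← sq]
  gcongr
  have := Finset.sum_mul_sq_le_sq_mul_sq Finset.univ x y
  simp_rw [sq (x _), sq (y _)] at this
  exact this

lemma Rs_abs (x y : Sph n) : |Rs x.1 y.1| ≤ 1 := by
  have := Rs_cs x.1 y.1
  rw [Rs_self, Rs_self] at this
  rw [← sq_le_one_iff_abs_le_one]; linarith

lemma Rs_le (x y : Sph n) : Rs x.1 y.1 ≤ 1 := (abs_le.1 (Rs_abs x y)).2
lemma Rs_ge (x y : Sph n) : -1 ≤ Rs x.1 y.1 := (abs_le.1 (Rs_abs x y)).1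

lemma hv_inner (p : ℕ) (x y : Fin n → ℝ) : ∑ j, hv p x j * hv p y j = (Rs x y)^p / n := by
  have e : ∀ j : Fin p → Fin n, hv p x j * hv p y j =
      ((n:ℝ) ^ (-(((p : ℝ) + 1) / 2)))^2 * ∏ l, (x (j l) * y (j l)) := by
    intro j; unfold hv; rw [Finset.prod_mul_distrib]; ring
  simp_rw [e, ← Finset.mul_sum]
  rw [← Fintype.sum_pow (fun i => x i * y i) p]
  unfold Rs
  rw [div_pow, ← Real.rpow_natCast (_ ^ _) 2, ← Real.rpow_mul (npos (n := n)).le]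
  have : (-(((p : ℝ) + 1) / 2)) * ((2:ℕ):ℝ) = -((p + 1 : ℕ) : ℝ) := by push_cast; ring
  rw [this, Real.rpow_neg (npos (n := n)).le, Real.rpow_natCast, pow_succ]
  field_simp

lemma hv_inc (p : ℕ) (x y : Sph n) : ∑ j, (hv p x.1 j - hv p y.1 j)^2 = (2 - 2 * (Rs x.1 y.1)^p) / n := by
  have e : ∀ j : Fin p → Fin n, (hv p x.1 j - hv p y.1 j)^2 = hv p x.1 j * hv p x.1 j + hv p y.1 j * hv p y.1 j - 2 * (hv p x.1 j * hv p y.1 j) := by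
    intro j; ring
  simp_rw [e, Finset.sum_sub_distrib, Finset.sum_add_distrib, ← Finset.mul_sum, hv_inner, Rs_self]
  ring

lemma lv_inc (x y : Sph n) : ∑ j, (lv x.1 j - lv y.1 j)^2 = (2 - 2 * Rs x.1 y.1) / n := by
  have e : ∀ j : Fin n, (lv x.1 j - lv y.1 j)^2 = (x.1 j ^ 2 + y.1 j ^ 2 - 2 * (x.1 j * y.1 j)) / n^2 := by
    intro j; unfold lv; ring
  have := npos (n := n)
  simp_rw [e]
  rw [← Finset.sum_div, Finset.sum_sub_distrib, Finset.sum_add_distrib, ← Finset.mul_sum, sph_sq, sph_sq]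
  unfold Rs
  field_simp
  ring

lemma hv_BV (p : ℕ) : BV (fun x : Sph n => hv p x.1) := by
  refine BV.of_sq (1 / n) fun x => ?_
  simp_rw [sq]
  rw [hv_inner, Rs_self]; simp

lemma lv_BV : BV (fun x : Sph n => lv x.1) := by
  refine BV.of_sq 1 fun x => ?_
  unfold lv
  simp_rw [div_pow]
  rw [← Finset.sum_div, sph_sq, sq, div_mul_cancel_left₀ (npos (n := n)).ne']
  exact inv_le_one_of_one_le₀ (Nat.one_le_cast.2 (NeZero.pos n))

instance : Nonempty (Sph n) := ⟨⟨fun _ => 1, by simp [sphereSet]⟩⟩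

end sph
end PS
open MeasureTheory ProbabilityTheory
set_option linter.unusedSectionVars false
namespace PS

section L1
variable {n : ℕ} [NeZero n]

lemma Rs_add_left (x x' y : Fin n → ℝ) : Rs (fun i => x i + x' i) y = Rs x y + Rs x' y := by
  unfold Rs; rw [← add_div, ← Finset.sum_add_distrib]; congr 1
  exact Finset.sum_congr rfl fun i _ => by ring
lemma Rs_smul_left (c : ℝ) (x y : Fin n → ℝ) : Rs (fun i => c * x i) y = c * Rs x y := by
  unfold Rs; rw [← mul_div_assoc, Finset.mul_sum]; congr 1
  exact Finset.sum_congr rfl fun i _ => by ring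
lemma Rs_add_right (x y y' : Fin n → ℝ) : Rs x (fun i => y i + y' i) = Rs x y + Rs x y' := by
  rw [Rs_comm, Rs_add_left, Rs_comm y, Rs_comm y']
lemma Rs_smul_right (c : ℝ) (x y : Fin n → ℝ) : Rs x (fun i => c * y i) = c * Rs x y := by
  rw [Rs_comm, Rs_smul_left, Rs_comm y]

lemma Rs_tri (x x' u : Sph n) (σ : ℝ) (hσ : σ = 1 ∨ σ = -1) (h : 3/4 ≤ σ * Rs u.1 x.1) (h' : 3/4 ≤ σ * Rs u.1 x'.1) :
    0 ≤ Rs x.1 x'.1 := by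
  have h1 := Rs_cs (fun i => x.1 i + x'.1 i) u.1
  rw [Rs_add_left, Rs_add_left, Rs_add_right, Rs_add_right, Rs_self, Rs_self, Rs_self, Rs_comm x'.1 x.1, Rs_comm x.1 u.1, Rs_comm x'.1 u.1] at h1
  rcases hσ with rfl | rfl <;> nlinarith

lemma pow_even_le {p : ℕ} (hp : 4 ≤ p) (hpe : Even p) (r : ℝ) (c : ℝ) (hc : c ≤ 1) (h : |r| ≤ c) : r^p ≤ c^4 := by
  rw [← hpe.pow_abs]
  calc |r|^p ≤ c^p := pow_le_pow_left₀ (abs_nonneg _) h p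
    _ ≤ c^4 := pow_le_pow_of_le_one ((abs_nonneg _).trans h) hc hp

lemma pow_even_le_one {p : ℕ} (hp : 4 ≤ p) (hpe : Even p) (r : ℝ) (h : |r| ≤ 1) : r^p ≤ 1 := by
  simpa using pow_even_le hp hpe r 1 le_rfl h

lemma L1_cond {p : ℕ} (hp : 4 ≤ p) (hpe : Even p) {T : Type*} [Finite T] [Nonempty T] (ι : T → Sph n) (m : T → ℝ) (t : ℝ) (ht : 0 ≤ t) :
    GS (fun k i => t * lv (ι k).1 i) m ≤ GS (fun k j => (4*t) * hv p (ι k).1 j) m + 2*t*kap/√n := by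
  classical
  have hn := npos (n := n)
  obtain ⟨s, hs1, hs2⟩ := greedy m (fun k k' => 3/4 ≤ |Rs (ι k).1 (ι k').1|) (fun k => by rw [Rs_self]; norm_num)
    (fun k k' h => by rwa [Rs_comm])
  let σ : T → ℝ := fun k => if 0 ≤ Rs (ι (s k)).1 (ι k).1 then 1 else -1
  have hσ : ∀ k, σ k = 1 ∨ σ k = -1 := fun k => by simp only [σ]; split_ifs <;> simp
  have hσR : ∀ k, 3/4 ≤ σ k * Rs (ι (s k)).1 (ι k).1 := by
    intro k
    have := (hs1 k).2
    simp only [σ]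
    split_ifs with h
    · rw [abs_of_nonneg h] at this; linarith
    · rw [abs_of_neg (not_le.1 h)] at this; linarith
  have hBV1 : BV (fun k j => (2*t) * hv p (ι k).1 j) := BV.of_finite _
  have hBV2 : BV (fun k j => (2*t) * hv p (ι (s k)).1 j) := BV.of_finite _
  have hBV3 : BV (fun k (_ : Unit) => 2*t*σ k/√n) := BV.of_finite _
  have step1 : GS (fun k i => t * lv (ι k).1 i) m ≤
      GS (fun k => Sum.elim (Sum.elim (fun j => (2*t) * hv p (ι k).1 j) (fun j => (2*t) * hv p (ι (s k)).1 j))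
        (fun _ : Unit => 2*t*σ k/√n)) m := by
    refine SF (BV.of_finite _) (BV.of_finite _) (BM.of_finite _) fun k k' => ?_
    simp only [Fintype.sum_sum_type, Sum.elim_inl, Sum.elim_inr, Finset.univ_unique, Finset.sum_singleton, ← mul_sub, ← sub_div, mul_pow, div_pow, ← Finset.mul_sum, lv_inc, hv_inc, Real.sq_sqrt hn.le]
    set R := Rs (ι k).1 (ι k').1
    set Q := Rs (ι (s k)).1 (ι (s k')).1
    have hR : |R| ≤ 1 := Rs_abs _ _
    have hQ : |Q| ≤ 1 := Rs_abs _ _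
    have hRp := pow_even_le_one hp hpe R hR
    have hQp := pow_even_le_one hp hpe Q hQ
    have main : 2 - 2*R ≤ 4*((2 - 2*R^p) + (2-2*Q^p) + (σ k - σ k')^2) := by
      have hR' := (abs_le.1 hR).1
      by_cases h1 : s k = s k'
      · by_cases h2 : σ k = σ k'
        · have h0 : 0 ≤ R := by
            refine Rs_tri _ _ (ι (s k)) (σ k) (hσ k) (hσR k) ?_
            rw [h1, h2]; exact hσR k'
          have : R^p ≤ R := by
            calc R^p ≤ R^1 := pow_le_pow_of_le_one h0 (abs_le.1 hR).2 (by omega)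
              _ = R := pow_one R
          nlinarith [sq_nonneg (σ k - σ k')]
        · have : (σ k - σ k')^2 = 4 := by
            rcases hσ k with h | h <;> rcases hσ k' with h' | h'
            · exact absurd (h.trans h'.symm) h2
            · rw [h, h']; norm_num
            · rw [h, h']; norm_num
            · exact absurd (h.trans h'.symm) h2
          linarith
      · have := hs2 k k' h1
        push Not at this
        have h4 := pow_even_le hp hpe Q (3/4) (by norm_num) this.le
        nlinarith [sq_nonneg (σ k - σ k')]
    have ht2 : 0 ≤ t^2 / n := by positivity
    calc t^2 * ((2 - 2*R)/n) = t^2/n * (2 - 2*R) := by ring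
      _ ≤ t^2/n * (4*((2 - 2*R^p) + (2-2*Q^p) + (σ k - σ k')^2)) := mul_le_mul_of_nonneg_left main ht2
      _ = _ := by ring
  have step2 : GS (fun k => Sum.elim (Sum.elim (fun j => (2*t) * hv p (ι k).1 j) (fun j => (2*t) * hv p (ι (s k)).1 j))
        (fun _ : Unit => 2*t*σ k/√n)) m ≤ GS (fun k => Sum.elim (Sum.elim (fun j => (2*t) * hv p (ι k).1 j) (fun j => (2*t) * hv p (ι (s k)).1 j))
        (fun _ : Unit => 2*t*σ k/√n)) (fun k => 1/2 * m k + 1/2 * m (s k)) := by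
    refine GS_mono_m (BV.of_finite _) (BM.of_finite _) (BM.of_finite _) fun k => ?_
    linarith [(hs1 k).1]
  have step3 := GS_elim_add0 (hBV1.elim hBV2) hBV3 (BM.of_finite (fun k => 1/2 * m k + 1/2 * m (s k)))
  have step4 := GS_elim_add hBV1 hBV2 (BM.of_finite (fun k => 1/2 * m k)) (BM.of_finite (fun k => 1/2 * m (s k)))
  have step5 : GS (fun k j => (2*t) * hv p (ι (s k)).1 j) (fun k => 1/2 * m (s k)) ≤ GS (fun k j => (2*t) * hv p (ι k).1 j) (fun k => 1/2 * m k) :=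
    GS_reindex hBV1 (BM.of_finite (fun k => 1/2 * m k)) s
  have step6 : GS (fun k j => (4*t) * hv p (ι k).1 j) m = 2 * GS (fun k j => (2*t) * hv p (ι k).1 j) (fun k => 1/2 * m k) := by
    rw [← GS_smul 2 (by norm_num)]
    congr 1
    · funext k j; ring
    · funext k; ring
  have step7 : GS (fun k (_ : Unit) => 2*t*σ k/√n) (fun _ => 0) ≤ 2*t/√n * kap := by
    refine GS_scalar _ _ fun k => ?_
    rw [abs_div, abs_mul, abs_of_nonneg (by positivity : 0 ≤ 2*t), abs_of_nonneg (Real.sqrt_nonneg _)]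
    have : |σ k| = 1 := by rcases hσ k with h | h <;> rw [h] <;> norm_num
    rw [this, mul_one]
  have e : 2*t/√n * kap = 2*t*kap/√n := by ring
  linarith

/-- the ground state energy at size `n` -/
noncomputable def En (p n : ℕ) : ℝ := GS (fun x : Sph n => hv p x.1) (fun _ => 0)

lemma L1 {p : ℕ} (hp : 4 ≤ p) (hpe : Even p) (t : ℝ) (ht : 0 ≤ t) :
    GS (fun x : Sph n => Sum.elim (hv p x.1) (fun i => t * lv x.1 i)) (fun _ => 0) ≤
      √(1 + 16*t^2) * En p n + 2*t*kap/√n := by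
  refine GS_finapprox ((hv_BV p).elim (lv_BV.smul t)) (BM.const 0) _ fun T hT => ?_
  have := hT.to_subtype
  let ι : T → Sph n := fun k => k.1
  have b1 : BV (fun k => hv p (ι k).1) := BV.of_finite _
  have b2 : BV (fun k i => t * lv (ι k).1 i) := BV.of_finite _
  have b3 : BV (fun k j => (4*t) * hv p (ι k).1 j) := BV.of_finite _
  have f1 := GS_fubini b1 b2 (BM.const (K := T) 0)
  have f2 := GS_fubini b1 b3 (BM.const (K := T) 0)
  have s1 : GS (fun k => Sum.elim (hv p (ι k).1) (fun i => t * lv (ι k).1 i)) (fun _ => 0) ≤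
     GS (fun k => Sum.elim (hv p (ι k).1) (fun j => (4*t) * hv p (ι k).1 j)) (fun _ => 0) + 2*t*kap/√n := by
    rw [f1.2, f2.2]
    have : (2*t*kap/√n) = ∫ _ : ((Fin p → Fin n) → ℝ), (2*t*kap/√n) ∂(gam (Fin p → Fin n)) := by simp
    rw [this, ← integral_add f2.1 (integrable_const _)]
    exact integral_mono f1.1 (f2.1.add (integrable_const _)) fun y => L1_cond hp hpe ι _ t ht
  have s2 : GS (fun k => Sum.elim (hv p (ι k).1) (fun j => (4*t) * hv p (ι k).1 j)) (fun _ => 0) =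
      GS (fun k j => √(1+16*t^2) * hv p (ι k).1 j) (fun k => √(1+16*t^2) * 0) := by
    simp only [mul_zero]
    refine SF_eq (b1.elim b3) (BV.of_finite _) (BM.const 0) fun k k' => ?_
    simp only [Fintype.sum_sum_type, Sum.elim_inl, Sum.elim_inr, ← mul_sub, mul_pow, ← Finset.mul_sum, Real.sq_sqrt (by positivity : 0 ≤ 1+16*t^2)]
    ring
  rw [GS_smul _ (Real.sqrt_nonneg _)] at s2
  have s3 : GS (fun k => hv p (ι k).1) (fun _ => 0) ≤ En p n := GS_reindex (hv_BV p) (BM.const 0) ι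
  have := mul_le_mul_of_nonneg_left s3 (Real.sqrt_nonneg (1+16*t^2))
  change GS (fun k => Sum.elim (hv p (ι k).1) (fun i => t * lv (ι k).1 i)) (fun _ => 0) ≤ _
  linarith

/-- pair vectors -/
noncomputable def pv (p : ℕ) (t : ℝ) (q : Sph n × Sph n) :
    ((Fin p → Fin n) ⊕ Fin n) ⊕ ((Fin p → Fin n) ⊕ Fin n) → ℝ :=
  Sum.elim (Sum.elim (hv p q.1.1) (fun i => t * lv q.1.1 i)) (Sum.elim (hv p q.2.1) (fun i => t * lv q.2.1 i))

lemma pv_BV (p : ℕ) (t : ℝ) : BV (fun q : Sph n × Sph n => pv p t q) := by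
  have h := ((hv_BV (n := n) p).elim (lv_BV.smul t))
  exact (h.comp (Prod.fst (β := Sph n))).elim (h.comp (Prod.snd (α := Sph n)))

lemma pv_inc (p : ℕ) (t : ℝ) (q q' : Sph n × Sph n) : ∑ j, (pv p t q j - pv p t q' j)^2 =
    (2 - 2 * Rs q.1.1 q'.1.1 ^ p)/n + t^2 * ((2 - 2 * Rs q.1.1 q'.1.1)/n) +
    ((2 - 2 * Rs q.2.1 q'.2.1 ^ p)/n + t^2 * ((2 - 2 * Rs q.2.1 q'.2.1)/n)) := by
  simp only [pv, Fintype.sum_sum_type, Sum.elim_inl, Sum.elim_inr, ← mul_sub, mul_pow, ← Finset.mul_sum, hv_inc, lv_inc]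

lemma L2 {p : ℕ} (hp : 4 ≤ p) (hpe : Even p) (t : ℝ) (ht : 0 ≤ t) :
    GS (fun q : Sph n × Sph n => pv p t q) (fun _ => 0) ≤ 2 * (√(1 + 16*t^2) * En p n + 2*t*kap/√n) := by
  have h := ((hv_BV (n := n) p).elim (lv_BV.smul t))
  have h1 := h.comp (Prod.fst (β := Sph n))
  have h2 := h.comp (Prod.snd (α := Sph n))
  have := GS_elim_add0 h1 h2 (BM.const 0)
  have r1 := GS_reindex h (BM.const 0) (Prod.fst (β := Sph n))
  have r2 := GS_reindex h (BM.const 0) (Prod.snd (α := Sph n))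
  have l1 := L1 (n := n) hp hpe t ht
  unfold pv
  linarith

end L1
end PS
open MeasureTheory ProbabilityTheory
set_option linter.unusedSectionVars false
namespace PS

section iso
variable {n : ℕ} [NeZero n]

/-- surjective isometries of the sphere -/
def Iso (g : Sph n → Sph n) : Prop := Function.Surjective g ∧ ∀ x y, Rs (g x).1 (g y).1 = Rs x.1 y.1

lemma GS_iso (p : ℕ) (t : ℝ) {g₁ g₂ : Sph n → Sph n} (h₁ : Iso g₁) (h₂ : Iso g₂) (m : Sph n × Sph n → ℝ) (hm : BM m) :
    GS (fun q => pv p t q) (fun q => m (g₁ q.1, g₂ q.2)) = GS (fun q => pv p t q) m := by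
  have hs : Function.Surjective (fun q : Sph n × Sph n => (g₁ q.1, g₂ q.2)) := h₁.1.prodMap h₂.1
  rw [← GS_surj (a := fun q => pv p t q) (m := m) _ hs]
  refine SF_eq (pv_BV p t) ((pv_BV p t).comp _) (hm.comp _) fun q q' => ?_
  rw [pv_inc, pv_inc, h₁.2, h₂.2]

lemma Iso.comp {g₁ g₂ : Sph n → Sph n} (h₁ : Iso g₁) (h₂ : Iso g₂) : Iso (fun x => g₁ (g₂ x)) :=
  ⟨h₁.1.comp h₂.1, fun x y => by rw [h₁.2, h₂.2]⟩

lemma Iso.id : Iso (fun x : Sph n => x) := ⟨fun x => ⟨x, rfl⟩, fun _ _ => rfl⟩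

lemma mem_sph_iff (x : Fin n → ℝ) : x ∈ sphereSet n ↔ Rs x x = 1 := by
  have := npos (n := n)
  unfold Rs sphereSet
  simp only [Set.mem_ofPred_eq, ← sq]
  rw [div_eq_one_iff_eq this.ne']

noncomputable def isoOf (g : (Fin n → ℝ) → (Fin n → ℝ)) (h : ∀ x y, Rs (g x) (g y) = Rs x y) (x : Sph n) : Sph n :=
  ⟨g x.1, by rw [mem_sph_iff, h, Rs_self]⟩

lemma isoOf_iso (g g' : (Fin n → ℝ) → (Fin n → ℝ)) (h : ∀ x y, Rs (g x) (g y) = Rs x y)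
    (hg : ∀ x, g (g' x) = x) : Iso (isoOf g h) := by
  refine ⟨fun x => ⟨⟨g' x.1, ?_⟩, ?_⟩, fun x y => h _ _⟩
  · rw [mem_sph_iff, ← h, hg, Rs_self]
  · exact Subtype.ext (hg x.1)

lemma sgn_inv (ε : Fin n → ℝ) (hε : ∀ i, ε i = 1 ∨ ε i = -1) : ∀ i, ε i * ε i = 1 := fun i => by
  rcases hε i with h | h <;> rw [h] <;> norm_num

lemma exists_iso_sign (ε : Fin n → ℝ) (hε : ∀ i, ε i = 1 ∨ ε i = -1) : ∃ g : Sph n → Sph n, Iso g ∧ ∀ x i, (g x).1 i = ε i * x.1 i := by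
  have h2 := sgn_inv ε hε
  refine ⟨isoOf (fun x i => ε i * x i) ?_, isoOf_iso _ (fun x i => ε i * x i) _ ?_, fun x i => rfl⟩
  · intro x y; unfold Rs; congr 1
    refine Finset.sum_congr rfl fun i _ => ?_
    linear_combination (x i * y i) * h2 i
  · intro x; funext i; linear_combination (x i) * h2 i

lemma exists_iso_perm (σ : Equiv.Perm (Fin n)) : ∃ g : Sph n → Sph n, Iso g ∧ ∀ x i, (g x).1 i = x.1 (σ i) := by
  refine ⟨isoOf (fun x i => x (σ i)) ?_, isoOf_iso _ (fun x i => x (σ.symm i)) _ ?_, fun x i => rfl⟩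
  · intro x y; unfold Rs; congr 1
    exact Equiv.sum_comp σ (fun i => x i * y i)
  · intro x; funext i; simp

lemma exists_iso_mat (U V : Matrix (Fin n) (Fin n) ℝ) (h : U * V = 1) (hV : V = U.transpose) : ∃ g : Sph n → Sph n, Iso g ∧ ∀ x, (g x).1 = V.mulVec x.1 := by
  have h' : V * U = 1 := mul_eq_one_comm.1 h
  refine ⟨isoOf (fun x => V.mulVec x) ?_, isoOf_iso _ (fun x => U.mulVec x) _ ?_, fun x => rfl⟩
  · intro x y; unfold Rs; congr 1
    change (V.mulVec x) ⬝ᵥ (V.mulVec y) = x ⬝ᵥ y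
    rw [Matrix.dotProduct_mulVec, ← Matrix.mulVec_transpose, Matrix.mulVec_mulVec, hV, Matrix.transpose_transpose, ← hV, h, Matrix.one_mulVec]
  · intro x; rw [Matrix.mulVec_mulVec, h', Matrix.one_mulVec]

lemma sph_mul_abs (x y : Sph n) (i : Fin n) : |x.1 i * y.1 i| ≤ n := by
  have h : ∀ x : Sph n, (x.1 i)^2 ≤ n := fun x => by
    rw [← sph_sq x]
    exact Finset.single_le_sum (f := fun i => (x.1 i)^2) (fun _ _ => sq_nonneg _) (Finset.mem_univ i)
  rw [abs_le]
  constructor <;> nlinarith [h x, h y, sq_nonneg (x.1 i + y.1 i), sq_nonneg (x.1 i - y.1 i)]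

noncomputable def dm (d : Fin n → ℝ) (q : Sph n × Sph n) : ℝ := (∑ i, d i * (q.1.1 i * q.2.1 i)) / n

lemma dm_BM (d : Fin n → ℝ) : BM (dm d) := by
  have hn := npos (n := n)
  refine ⟨∑ i, |d i|, fun q => ?_⟩
  unfold dm
  rw [abs_div, abs_of_pos hn, div_le_iff₀ hn, Finset.sum_mul]
  refine (Finset.abs_sum_le_sum_abs _ _).trans (Finset.sum_le_sum fun i _ => ?_)
  rw [abs_mul]
  exact mul_le_mul_of_nonneg_left (sph_mul_abs _ _ i) (abs_nonneg _)

noncomputable def fd (p : ℕ) (t : ℝ) (d : Fin n → ℝ) : ℝ := GS (fun q : Sph n × Sph n => pv p t q) (dm d)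

lemma fd_convex (p : ℕ) (t : ℝ) : ConvexOn ℝ Set.univ (fd (n := n) p t) := by
  refine ⟨convex_univ, fun d _ d' _ α β hα hβ hab => ?_⟩
  have b := pv_BV (n := n) p t
  have := GS_add (b.smul α) ((dm_BM d).smul α) (b.smul β) ((dm_BM d').smul β)
  rw [GS_smul α hα, GS_smul β hβ] at this
  simp only [smul_eq_mul]
  refine le_trans (le_of_eq ?_) this
  unfold fd
  congr 1
  · funext q j; rw [← add_mul, hab, one_mul]
  · funext q; unfold dm
    rw [← mul_div_assoc, ← mul_div_assoc, ← add_div, Finset.mul_sum, Finset.mul_sum, ← Finset.sum_add_distrib]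
    congr 1
    refine Finset.sum_congr rfl fun i _ => ?_
    simp; ring

noncomputable def phi (n p : ℕ) (t : ℝ) (lam : ℝ) : ℝ := GS (fun q : Sph n × Sph n => pv p t q) (fun q => lam * Rs q.1.1 q.2.1)

lemma phi_eq (p : ℕ) (t lam : ℝ) : phi n p t lam = fd p t (fun _ : Fin n => lam) := by
  unfold phi fd
  congr 1; funext q
  unfold dm Rs
  rw [← Finset.mul_sum, mul_div_assoc]

lemma fd_ge_phi (p : ℕ) (t : ℝ) (d : Fin n → ℝ) : phi n p t ((∑ i, d i) / n) ≤ fd p t d := by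
  have hn := npos (n := n)
  have hk : ∀ k : Fin n, fd p t (fun i => d (i + k)) = fd p t d := by
    intro k
    obtain ⟨g, hg, hgx⟩ := exists_iso_perm (n := n) (Equiv.addRight k)
    have := GS_iso p t hg hg (dm (fun i => d (i + k))) (dm_BM _)
    unfold fd
    rw [← this]
    congr 1; funext q
    unfold dm
    congr 1
    rw [← Equiv.sum_comp (Equiv.addRight k) (fun i => d i * (q.1.1 i * q.2.1 i))]
    simp [hgx]
  have := (fd_convex (n := n) p t).map_sum_le (t := Finset.univ) (w := fun _ : Fin n => 1 / (n:ℝ)) (p := fun k i => d (i + k))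
    (fun _ _ => by positivity) (by simp [hn.ne']) (fun _ _ => Set.mem_univ _)
  simp only [hk, smul_eq_mul, Finset.sum_const, Finset.card_univ, Fintype.card_fin, nsmul_eq_mul] at this
  rw [phi_eq]
  have e : (fun _ : Fin n => (∑ i, d i) / n) = ∑ k : Fin n, (1 / (n:ℝ)) • fun i => d (i + k) := by
    funext i
    simp only [Finset.sum_apply, Pi.smul_apply, smul_eq_mul, ← Finset.mul_sum]
    rw [← Equiv.sum_comp (Equiv.addLeft i) d]
    simp only [Equiv.coe_addLeft]
    ring
  rw [e]
  refine this.trans (le_of_eq ?_)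
  field_simp

lemma phi_convex (p : ℕ) (t : ℝ) : ConvexOn ℝ Set.univ (phi n p t) := by
  refine ⟨convex_univ, fun d _ d' _ α β hα hβ hab => ?_⟩
  rw [phi_eq, phi_eq, phi_eq]
  exact (fd_convex (n := n) p t).2 (Set.mem_univ _) (Set.mem_univ _) hα hβ hab

lemma phi_even (p : ℕ) (t lam : ℝ) : phi n p t (-lam) = phi n p t lam := by
  obtain ⟨g, hg, hgx⟩ := exists_iso_sign (n := n) (fun _ => -1) (fun _ => Or.inr rfl)
  have := GS_iso p t hg Iso.id (dm (fun _ => lam)) (dm_BM _)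
  rw [phi_eq, phi_eq]
  unfold fd
  rw [← this]
  congr 1; funext q
  unfold dm
  simp [hgx]

lemma phi_mono (p : ℕ) (t : ℝ) {a b : ℝ} (ha : 0 ≤ a) (hab : a ≤ b) : phi n p t a ≤ phi n p t b := by
  have := (phi_convex (n := n) p t).le_max_of_mem_Icc (x := -b) (y := b) (z := a) (Set.mem_univ _) (Set.mem_univ _) ⟨by linarith, hab⟩
  rwa [phi_even, max_self] at this

lemma phi_lip (p : ℕ) (t a b : ℝ) : phi n p t a ≤ phi n p t b + |a - b| := by
  have bm : ∀ c : ℝ, BM (fun q : Sph n × Sph n => c * Rs q.1.1 q.2.1) := fun c =>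
    BM.smul ⟨1, fun q => Rs_abs _ _⟩ c
  unfold phi
  rw [← GS_add_const _ (pv_BV p t) (bm b)]
  refine GS_mono_m (pv_BV p t) (bm a) ((bm b).add (BM.const _)) fun q => ?_
  have h1 : (a - b) * Rs q.1.1 q.2.1 ≤ |a - b| := by
    refine (le_abs_self _).trans ?_
    rw [abs_mul]
    exact mul_le_of_le_one_right (abs_nonneg _) (Rs_abs _ _)
  linarith

lemma phi_cont (p : ℕ) (t : ℝ) : Continuous (phi n p t) :=
  (LipschitzWith.of_le_add (f := phi n p t) (fun x y => by
    simpa [Real.dist_eq] using phi_lip (n := n) p t x y)).continuous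

end iso
end PS
open MeasureTheory ProbabilityTheory
set_option linter.unusedSectionVars false
namespace PS

section mat
variable {n : ℕ} [NeZero n]

lemma spec (G : Matrix (Fin n) (Fin n) ℝ) (hG : ∀ i j, G i j = G j i) :
    ∃ (U : Matrix (Fin n) (Fin n) ℝ) (l : Fin n → ℝ), U * U.transpose = 1 ∧ G = U * Matrix.diagonal l * U.transpose := by
  have h : G.IsHermitian := by
    ext i j; simp [hG i j]
  refine ⟨h.eigenvectorUnitary, h.eigenvalues, ?_, ?_⟩
  · have := Matrix.mem_unitaryGroup_iff.1 h.eigenvectorUnitary.2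
    simpa [Matrix.star_eq_conjTranspose] using this
  · have := h.spectral_theorem
    rw [Unitary.conjStarAlgAut_apply] at this
    simpa [Matrix.star_eq_conjTranspose, Function.comp_def] using this

lemma frob (U : Matrix (Fin n) (Fin n) ℝ) (l : Fin n → ℝ) (hU : U * U.transpose = 1) (G : Matrix (Fin n) (Fin n) ℝ)
    (hG : G = U * Matrix.diagonal l * U.transpose) : ∑ i, ∑ j, (G i j)^2 = ∑ i, (l i)^2 := by
  have hU' : U.transpose * U = 1 := mul_eq_one_comm.1 hU
  have e1 : ∑ i, ∑ j, (G i j)^2 = (G * G.transpose).trace := by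
    simp [Matrix.trace, Matrix.mul_apply, sq]
  have e2 : G * G.transpose = U * (Matrix.diagonal l * Matrix.diagonal l) * U.transpose := by
    rw [hG, Matrix.transpose_mul, Matrix.transpose_mul, Matrix.transpose_transpose, Matrix.diagonal_transpose]
    calc U * Matrix.diagonal l * U.transpose * (U * (Matrix.diagonal l * U.transpose)) =
        U * Matrix.diagonal l * (U.transpose * U) * (Matrix.diagonal l * U.transpose) := by simp only [Matrix.mul_assoc]
      _ = _ := by rw [hU', Matrix.mul_one]; simp only [Matrix.mul_assoc]
  rw [e1, e2, Matrix.trace_mul_comm, ← Matrix.mul_assoc, hU', Matrix.one_mul, Matrix.diagonal_mul_diagonal, Matrix.trace_diagonal]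
  simp [sq]

noncomputable def wv (q : Sph n × Sph n) : Fin n × Fin n → ℝ :=
  fun ij => (q.1.1 ij.1 * q.2.1 ij.2 + q.1.1 ij.2 * q.2.1 ij.1) / n

lemma wv_inc (q q' : Sph n × Sph n) : ∑ j, (wv q j - wv q' j)^2 ≤
    4 * n * ((2 - 2 * Rs q.1.1 q'.1.1)/n + (2 - 2 * Rs q.2.1 q'.2.1)/n) := by
  have hn := npos (n := n)
  let v : Sph n × Sph n → Fin n → Fin n → ℝ := fun q i j => q.1.1 i * q.2.1 j / n
  have i1 : ∀ q q', ∑ i, ∑ j, v q i j * v q' i j = Rs q.1.1 q'.1.1 * Rs q.2.1 q'.2.1 := by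
    intro q q'
    unfold Rs
    rw [div_mul_div_comm, Finset.sum_mul_sum, Finset.sum_div]
    refine Finset.sum_congr rfl fun i _ => ?_
    rw [Finset.sum_div]
    refine Finset.sum_congr rfl fun j _ => ?_
    simp only [v]; ring
  have i2 : ∑ i, ∑ j, (v q i j - v q' i j)^2 = 2 - 2 * (Rs q.1.1 q'.1.1 * Rs q.2.1 q'.2.1) := by
    have e : ∀ i j, (v q i j - v q' i j)^2 = v q i j * v q i j + v q' i j * v q' i j - 2 * (v q i j * v q' i j) := fun i j => by ring
    simp_rw [e, Finset.sum_sub_distrib, Finset.sum_add_distrib, ← Finset.mul_sum, i1, Rs_self]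
    ring
  have i3 : ∑ j, (wv q j - wv q' j)^2 ≤ 2 * ∑ i, ∑ j, (v q i j - v q' i j)^2 + 2 * ∑ i, ∑ j, (v q j i - v q' j i)^2 := by
    rw [Fintype.sum_prod_type, Finset.mul_sum, Finset.mul_sum, ← Finset.sum_add_distrib]
    refine Finset.sum_le_sum fun i _ => ?_
    rw [Finset.mul_sum, Finset.mul_sum, ← Finset.sum_add_distrib]
    refine Finset.sum_le_sum fun j _ => ?_
    have : wv q (i,j) - wv q' (i,j) = (v q i j - v q' i j) + (v q j i - v q' j i) := by
      simp only [wv, v]; ring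
    rw [this]
    nlinarith [sq_nonneg ((v q i j - v q' i j) - (v q j i - v q' j i))]
  rw [Finset.sum_comm (f := fun i j => (v q j i - v q' j i)^2), i2] at i3
  have hr : 4 * n * ((2 - 2 * Rs q.1.1 q'.1.1)/n + (2 - 2 * Rs q.2.1 q'.2.1)/n) = 4 * ((2 - 2 * Rs q.1.1 q'.1.1) + (2 - 2 * Rs q.2.1 q'.2.1)) := by
    field_simp
  rw [hr]
  have a1 := Rs_le q.1 q'.1
  have a2 := Rs_le q.2 q'.2
  nlinarith [mul_nonneg (sub_nonneg.2 a1) (sub_nonneg.2 a2)]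

lemma wv_BV : BV (fun q : Sph n × Sph n => wv q) := by
  have hn := npos (n := n)
  refine ⟨2, fun q j => ?_⟩
  have h : ∀ (x : Sph n) i, (x.1 i)^2 ≤ n := fun x i => by
    rw [← sph_sq x]
    exact Finset.single_le_sum (f := fun i => (x.1 i)^2) (fun _ _ => sq_nonneg _) (Finset.mem_univ i)
  unfold wv
  rw [abs_div, abs_of_pos hn, div_le_iff₀ hn, abs_le]
  have a1 := h q.1 j.1
  have a2 := h q.1 j.2
  have a3 := h q.2 j.1
  have a4 := h q.2 j.2
  constructor <;> nlinarith [sq_nonneg (q.1.1 j.1 + q.2.1 j.2), sq_nonneg (q.1.1 j.1 - q.2.1 j.2), sq_nonneg (q.1.1 j.2 + q.2.1 j.1), sq_nonneg (q.1.1 j.2 - q.2.1 j.1)]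

lemma wv_fld (A : Fin n × Fin n → ℝ) (q : Sph n × Sph n) :
    ∑ j, wv q j * A j = (∑ i, ∑ j, q.1.1 i * (A (i,j) + A (j,i)) * q.2.1 j) / n := by
  have e : ∑ j, wv q j * A j = (∑ i, ∑ j, q.1.1 i * A (i,j) * q.2.1 j) / n + (∑ i, ∑ j, q.1.1 j * A (i,j) * q.2.1 i) / n := by
    rw [Fintype.sum_prod_type, ← add_div, ← Finset.sum_add_distrib, Finset.sum_div]
    refine Finset.sum_congr rfl fun i _ => ?_
    rw [← Finset.sum_add_distrib, Finset.sum_div]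
    refine Finset.sum_congr rfl fun j _ => ?_
    simp only [wv]; ring
  rw [e, Finset.sum_comm (f := fun i j => q.1.1 j * A (i,j) * q.2.1 i), ← add_div, ← Finset.sum_add_distrib]
  congr 1
  refine Finset.sum_congr rfl fun i _ => ?_
  rw [← Finset.sum_add_distrib]
  refine Finset.sum_congr rfl fun j _ => ?_
  ring

lemma mat_bound (p : ℕ) (t c u : ℝ) (hc : 0 ≤ c) (hu : 0 ≤ u) (A : Fin n × Fin n → ℝ) :
    phi n p t (max (c / (n * √n) * (2 * u * ((∑ i, ∑ j, |A (i,j) + A (j,i)|) / n) - u^2 * sp (fun q : Sph n × Sph n => wv q) (fun _ => 0) A)) 0) ≤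
    GS (fun q : Sph n × Sph n => pv p t q) (fld (fun q ij => c / √n * wv q ij) (fun _ => 0) A) := by
  have hn := npos (n := n)
  have hsn : 0 < √(n:ℝ) := Real.sqrt_pos.2 hn
  let G : Matrix (Fin n) (Fin n) ℝ := fun i j => A (i,j) + A (j,i)
  obtain ⟨U, l, hU, hG⟩ := spec G (fun i j => add_comm _ _)
  have hF := frob U l hU G hG
  obtain ⟨g, hg, hgx⟩ := exists_iso_mat U U.transpose hU rfl
  have hq : ∀ q : Sph n × Sph n, ∑ j, wv q j * A j = (∑ i, l i * ((g q.1).1 i * (g q.2).1 i)) / n := by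
    intro q
    rw [wv_fld]
    congr 1
    have e1 : ∑ i, ∑ j, q.1.1 i * (A (i,j) + A (j,i)) * q.2.1 j = q.1.1 ⬝ᵥ G.mulVec q.2.1 := by
      simp only [dotProduct, Matrix.mulVec, Finset.mul_sum, G, mul_assoc]
    rw [e1, hG, ← Matrix.mulVec_mulVec, ← Matrix.mulVec_mulVec, Matrix.dotProduct_mulVec, ← Matrix.mulVec_transpose, ← hgx, ← hgx]
    simp only [dotProduct, Matrix.mulVec_diagonal]
    exact Finset.sum_congr rfl fun i _ => by ring
  set Λ := sp (fun q : Sph n × Sph n => wv q) (fun _ => 0) A with hΛ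
  have hle : ∀ q : Sph n × Sph n, (∑ i, l i * ((g q.1).1 i * (g q.2).1 i)) / n ≤ Λ := by
    intro q
    rw [← hq]
    have := le_sp wv_BV (BM.const 0) A q
    simpa [fld] using this
  have hl : ∀ i, |l i| ≤ Λ := by
    intro i
    have hs : ∀ ε : ℝ, ε^2 = 1 → ∃ x : Sph n, (g x).1 = Pi.single i (ε * √n) := by
      intro ε hε
      obtain ⟨x, hx⟩ := hg.1 ⟨Pi.single i (ε * √n), by
        unfold sphereSet
        simp [Pi.single_apply, ite_pow, mul_pow, hε, Real.sq_sqrt hn.le]⟩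
      exact ⟨x, by rw [hx]⟩
    obtain ⟨x1, h1⟩ := hs 1 (by norm_num)
    obtain ⟨x2, h2⟩ := hs (-1) (by norm_num)
    have k1 := hle (x1, x1)
    have k2 := hle (x1, x2)
    have ss : √(n:ℝ) * √n = n := Real.mul_self_sqrt hn.le
    simp only [h1, h2, Pi.single_apply, mul_ite, ite_mul, mul_zero, zero_mul, Finset.sum_ite_eq', Finset.mem_univ, if_true, one_mul, ite_self] at k1 k2
    simp at k1 k2
    rw [neg_div, mul_div_assoc, div_self hn.ne', mul_one] at k2
    rw [abs_le]; constructor <;> linarith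
  set N := ∑ i, |l i| with hN
  have hN0 : 0 ≤ N := Finset.sum_nonneg fun _ _ => abs_nonneg _
  have hΛ0 : 0 ≤ Λ := (abs_nonneg _).trans (hl 0)
  set W := (∑ i, ∑ j, |A (i,j) + A (j,i)|) / n with hW
  have hW0 : 0 ≤ W := by positivity
  have hW2 : W^2 ≤ N * Λ := by
    have e1 : W^2 ≤ ∑ i, ∑ j, (G i j)^2 := by
      have cs := Finset.sum_mul_sq_le_sq_mul_sq (Finset.univ : Finset (Fin n × Fin n)) (fun _ => (1:ℝ)) (fun ij => |G ij.1 ij.2|)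
      simp only [one_mul, Fintype.sum_prod_type, one_pow, sq_abs, Finset.sum_const, Finset.card_univ, Fintype.card_fin, nsmul_eq_mul, mul_one] at cs
      rw [hW, div_pow, div_le_iff₀ (by positivity)]
      refine cs.trans (le_of_eq ?_)
      rw [Fintype.card_prod, Fintype.card_fin]; push_cast; ring
    refine e1.trans ?_
    rw [hF, hN, Finset.sum_mul]
    refine Finset.sum_le_sum fun i _ => ?_
    rw [← sq_abs, sq]
    exact mul_le_mul_of_nonneg_left (hl i) (abs_nonneg _)
  have hNs : 2 * u * W - u^2 * Λ ≤ N := by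
    have : 2 * u * W ≤ N + u^2 * Λ := by
      refine abs_le_of_sq_le_sq' ?_ (by positivity) |>.2
      have : (2*u*W)^2 ≤ 4 * u^2 * (N * Λ) := by
        calc (2*u*W)^2 = 4 * u^2 * W^2 := by ring
          _ ≤ _ := mul_le_mul_of_nonneg_left hW2 (by positivity)
      nlinarith [sq_nonneg (N - u^2 * Λ)]
    linarith
  have hcn : 0 ≤ c / (n * √n) := by positivity
  obtain ⟨g', hg', hgx'⟩ := exists_iso_sign (n := n) (fun i => if 0 ≤ l i then 1 else -1) (fun i => by split_ifs <;> simp)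
  have hfd : GS (fun q : Sph n × Sph n => pv p t q) (fld (fun q ij => c / √n * wv q ij) (fun _ => 0) A) =
      fd p t (fun i => c / √n * |l i|) := by
    unfold fd
    rw [← GS_iso p t (hg'.comp hg) hg (dm (fun i => c / √n * |l i|)) (dm_BM _)]
    congr 1; funext q
    unfold fld dm
    simp only [mul_assoc, ← Finset.mul_sum, hq, add_zero, hgx']
    rw [← mul_div_assoc]
    congr 2
    refine Finset.sum_congr rfl fun i _ => ?_
    split_ifs with h
    · rw [abs_of_nonneg h]; ring
    · rw [abs_of_neg (not_le.1 h)]; ring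
  rw [hfd]
  refine le_trans ?_ (fd_ge_phi p t _)
  refine phi_mono p t (le_max_right _ _) ?_
  rw [← Finset.mul_sum, ← hN]
  have e : c / √n * N / n = c / (n * √n) * N := by field_simp
  rw [e]
  refine max_le (mul_le_mul_of_nonneg_left hNs hcn) (by positivity)

end mat
end PS
open MeasureTheory ProbabilityTheory
set_option linter.unusedSectionVars false
namespace PS

lemma gauss_sq : Integrable (fun x : ℝ => x^2) (gaussianReal 0 1) ∧ ∫ x, x^2 ∂gaussianReal 0 1 = 1 := by
  have h : MemLp (id : ℝ → ℝ) 2 (gaussianReal 0 1) := by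
    simpa using memLp_id_gaussianReal (μ := 0) (v := 1) 2
  refine ⟨h.integrable_sq, ?_⟩
  have := variance_of_integral_eq_zero (X := (id : ℝ → ℝ)) (μ := gaussianReal 0 1) aemeasurable_id (by simp)
  rw [variance_id_gaussianReal] at this
  simpa using this.symm

section
variable {J : Type*} [Fintype J]

lemma coord_sq (k : J) : Integrable (fun y : J → ℝ => (y k)^2) (gam J) ∧ ∫ y, (y k)^2 ∂gam J = 1 := by
  have mp := measurePreserving_eval (fun _ : J => gaussianReal 0 1) k
  have hm : AEStronglyMeasurable (fun x : ℝ => x^2) (gaussianReal 0 1) := by fun_prop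
  refine ⟨(mp.integrable_comp hm).2 gauss_sq.1, ?_⟩
  have := integral_map (φ := Function.eval k) (μ := gam J) mp.aemeasurable (f := fun x : ℝ => x^2) (by rw [mp.map_eq]; exact hm)
  rw [mp.map_eq, gauss_sq.2] at this
  exact this.symm

lemma sp_bool (b : J → ℝ) (y : J → ℝ) : sp (fun (s : Bool) l => (if s then 1 else -1) * b l) (fun _ => 0) y = |∑ l, b l * y l| := by
  have e : ∀ s : Bool, fld (fun (s : Bool) l => (if s then (1:ℝ) else -1) * b l) (fun _ => 0) y s = (if s then 1 else -1) * ∑ l, b l * y l := by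
    intro s
    simp [fld, Finset.mul_sum, mul_assoc]
  apply le_antisymm
  · refine sp_le fun s => ?_
    rw [e]
    cases s
    · simp [neg_le_abs]
    · simp [le_abs_self]
  · have k := fun s => le_sp (BV.of_finite (fun (s : Bool) l => (if s then (1:ℝ) else -1) * b l)) (BM.const 0) y s
    have k1 := k true
    have k2 := k false
    rw [e] at k1 k2
    simp only [if_true, Bool.false_eq_true, if_false, one_mul, neg_mul] at k1 k2
    refine abs_le.2 ⟨?_, ?_⟩
    · simpa using (neg_le.1 k2)
    · simpa using k1

lemma abs_int (b : J → ℝ) : Integrable (fun y => |∑ l, b l * y l|) (gam J) := (integrable_lin b).abs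

lemma kap_le (b : J → ℝ) (hb : 1 ≤ ∑ l, (b l)^2) : kap ≤ ∫ y, |∑ l, b l * y l| ∂gam J := by
  have h := SF (a := fun (s : Bool) (l : Unit) => (if s then (1:ℝ) else -1) * (fun _ => 1) l) (b := fun (s : Bool) l => (if s then (1:ℝ) else -1) * b l) (m := fun _ => 0)
    (BV.of_finite _) (BV.of_finite _) (BM.const 0) (by
      intro s s'
      cases s <;> cases s' <;> simp
      · have : ∀ l, (-b l - b l)^2 = 4 * (b l)^2 := fun l => by ring
        simp_rw [this, ← Finset.mul_sum]; norm_num; linarith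
      · have : ∀ l, (b l + b l)^2 = 4 * (b l)^2 := fun l => by ring
        simp_rw [this, ← Finset.mul_sum]; norm_num; linarith)
  unfold GS at h
  simp_rw [sp_bool] at h
  simpa [kap] using h
end

section
variable {n : ℕ} [NeZero n]

lemma GS_lv : GS (fun x : Sph n => lv x.1) (fun _ => 0) ≤ 1 := by
  have hn := npos (n := n)
  have i : Integrable (fun g : Fin n → ℝ => (1/2 : ℝ) + (∑ i, (g i)^2) * (1 / (2 * n))) (gam (Fin n)) :=
    (integrable_const _).add ((integrable_finsetSum _ fun i _ => (coord_sq i).1).mul_const _)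
  have := integral_mono (μ := gam (Fin n)) (sp_int (a := fun x : Sph n => lv x.1) (m := fun _ => 0) lv_BV (BM.const 0)) i (fun g => by
    refine sp_le fun x => ?_
    have hx := sph_sq x
    have : ∀ i, lv x.1 i * g i ≤ ((x.1 i)^2 + (g i)^2) * (1 / (2 * n)) := fun i => by
      have : ((x.1 i)^2 + (g i)^2) * (1 / (2 * n)) - lv x.1 i * g i = (x.1 i - g i)^2 * (1/(2*n)) := by
        unfold lv; field_simp; ring
      have h2 : 0 ≤ (x.1 i - g i)^2 * (1/(2*n)) := by positivity
      linarith
    have := Finset.sum_le_sum fun i (_ : i ∈ Finset.univ) => this i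
    rw [← Finset.sum_mul, Finset.sum_add_distrib, hx] at this
    unfold fld
    refine (add_zero _).le.trans (this.trans (le_of_eq ?_))
    rw [add_mul]; congr 1; field_simp)
  refine this.trans (le_of_eq ?_)
  rw [integral_add (integrable_const _) ((integrable_finsetSum _ fun i _ => (coord_sq i).1).mul_const _), integral_mul_const, integral_finsetSum _ fun i _ => (coord_sq i).1]
  simp_rw [fun i : Fin n => (coord_sq i).2]
  simp; field_simp; norm_num

lemma GS_wv : GS (fun q : Sph n × Sph n => wv q) (fun _ => 0) ≤ 4 * √n := by
  have hn := npos (n := n)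
  have hl : BV (fun x : Sph n => lv x.1) := lv_BV
  have b1 : BV (fun (q : Sph n × Sph n) i => 2 * √n * lv q.1.1 i) := (hl.smul _).comp (fun q : Sph n × Sph n => q.1)
  have b2 : BV (fun (q : Sph n × Sph n) i => 2 * √n * lv q.2.1 i) := (hl.smul _).comp (fun q : Sph n × Sph n => q.2)
  have h1 := SF (a := fun q : Sph n × Sph n => wv q) (b := fun q : Sph n × Sph n => Sum.elim (fun i => 2 * √n * lv q.1.1 i) (fun i => 2 * √n * lv q.2.1 i)) (m := fun _ => 0)
    wv_BV (b1.elim b2) (BM.const 0) (fun q q' => by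
      refine (wv_inc q q').trans (le_of_eq ?_)
      rw [Fintype.sum_sum_type]
      simp only [Sum.elim_inl, Sum.elim_inr, ← mul_sub, mul_pow, ← Finset.mul_sum, lv_inc, Real.sq_sqrt hn.le]
      ring)
  have h2 := GS_elim_add0 b1 b2 (BM.const 0)
  have h3 := GS_reindex (hl.smul (2 * √n)) (BM.const 0) (fun q : Sph n × Sph n => q.1)
  have h4 := GS_reindex (hl.smul (2 * √n)) (BM.const 0) (fun q : Sph n × Sph n => q.2)
  have h5 := GS_smul (a := fun x : Sph n => lv x.1) (m := fun _ => 0) (2 * √n) (by positivity)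
  simp only [mul_zero] at h5
  have h6 := mul_le_mul_of_nonneg_left (GS_lv (n := n)) (show 0 ≤ 2 * √(n:ℝ) by positivity)
  linarith

lemma W_int : Integrable (fun A : Fin n × Fin n → ℝ => (∑ i, ∑ j, |A (i,j) + A (j,i)|) / n) (gam (Fin n × Fin n)) ∧
    n * kap ≤ ∫ A, (∑ i, ∑ j, |A (i,j) + A (j,i)|) / n ∂gam (Fin n × Fin n) := by
  have hn := npos (n := n)
  have i1 : ∀ i j : Fin n, Integrable (fun A : Fin n × Fin n → ℝ => |A (i,j) + A (j,i)|) (gam (Fin n × Fin n)) :=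
    fun i j => ((integrable_coord _).add (integrable_coord _)).abs
  have i2 : ∀ i : Fin n, Integrable (fun A : Fin n × Fin n → ℝ => ∑ j, |A (i,j) + A (j,i)|) (gam (Fin n × Fin n)) :=
    fun i => integrable_finsetSum _ fun j _ => i1 i j
  have i3 := integrable_finsetSum Finset.univ fun i _ => i2 i
  refine ⟨i3.div_const _, ?_⟩
  rw [integral_div, integral_finsetSum _ fun i _ => i2 i]
  simp_rw [fun i => integral_finsetSum Finset.univ fun j _ => i1 i j]
  have hk : ∀ i j : Fin n, kap ≤ ∫ A : Fin n × Fin n → ℝ, |A (i,j) + A (j,i)| ∂gam (Fin n × Fin n) := by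
    intro i j
    have := kap_le (J := Fin n × Fin n) (fun l => (Pi.single (i,j) 1 : Fin n × Fin n → ℝ) l + (Pi.single (j,i) 1 : Fin n × Fin n → ℝ) l) (by
      refine le_trans ?_ (Finset.single_le_sum (f := fun l => ((Pi.single (i,j) 1 : Fin n × Fin n → ℝ) l + (Pi.single (j,i) 1 : Fin n × Fin n → ℝ) l)^2) (fun _ _ => sq_nonneg _) (Finset.mem_univ (i,j)))
      simp only [Pi.single_eq_same]
      have : 0 ≤ (Pi.single (j,i) 1 : Fin n × Fin n → ℝ) (i,j) := by
        rw [Pi.single_apply]; split_ifs <;> norm_num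
      nlinarith)
    refine this.trans (le_of_eq ?_)
    congr 1; funext A
    simp [add_mul, Finset.sum_add_distrib, Pi.single_apply]
  rw [le_div_iff₀ hn]
  calc (n:ℝ) * kap * n = ∑ i : Fin n, ∑ j : Fin n, kap := by simp; ring
    _ ≤ _ := Finset.sum_le_sum fun i _ => Finset.sum_le_sum fun j _ => hk i j

lemma L3 (p : ℕ) (t lam : ℝ) (hl : 0 ≤ lam) :
    phi n p t lam ≤ GS (fun q : Sph n × Sph n => pv p (√(t^2 + 64 * lam^2 / kap^4)) q) (fun _ => 0) := by
  have hn := npos (n := n)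
  have hsn : 0 < √(n:ℝ) := Real.sqrt_pos.2 hn
  have hk := kap_pos
  set c := 4 * lam / kap^2 with hc
  set u := kap * √n / 4 with hu
  have hc0 : 0 ≤ c := by positivity
  have hu0 : 0 ≤ u := by positivity
  let ψ : (Fin n × Fin n → ℝ) → ℝ := fun A => c / (n * √n) * (2 * u * ((∑ i, ∑ j, |A (i,j) + A (j,i)|) / n) - u^2 * sp (fun q : Sph n × Sph n => wv q) (fun _ => 0) A)
  have iΛ := sp_int (a := fun q : Sph n × Sph n => wv q) (m := fun _ => 0) wv_BV (BM.const 0)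
  have iψ : Integrable ψ (gam (Fin n × Fin n)) := ((W_int.1.const_mul _).sub (iΛ.const_mul _)).const_mul _
  have hψ : lam ≤ ∫ A, ψ A ∂gam (Fin n × Fin n) := by
    simp only [ψ]
    rw [integral_const_mul, integral_sub (W_int.1.const_mul _) (iΛ.const_mul _), integral_const_mul, integral_const_mul]
    have h1 := (W_int (n := n)).2
    have h2 : ∫ A, sp (fun q : Sph n × Sph n => wv q) (fun _ => 0) A ∂gam (Fin n × Fin n) ≤ 4 * √n := GS_wv
    have h3 : kap^2 * (n * √n) / 4 ≤ 2 * u * (∫ A, (∑ i, ∑ j, |A (i,j) + A (j,i)|) / n ∂gam (Fin n × Fin n)) - u^2 * ∫ A, sp (fun q : Sph n × Sph n => wv q) (fun _ => 0) A ∂gam (Fin n × Fin n) := by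
      have a1 := mul_le_mul_of_nonneg_left h1 (show 0 ≤ 2 * u by positivity)
      have a2 := mul_le_mul_of_nonneg_left h2 (sq_nonneg u)
      have a3 : 2 * u * (n * kap) - u^2 * (4 * √n) = kap^2 * (n * √n) / 4 := by
        rw [hu]
        have : √(n:ℝ)^2 = n := Real.sq_sqrt hn.le
        ring_nf
        rw [show √(n:ℝ)^3 = √n^2 * √n by ring, this]; ring
      linarith
    calc lam = c / (n * √n) * (kap^2 * (n * √n) / 4) := by rw [hc]; field_simp
      _ ≤ _ := mul_le_mul_of_nonneg_left h3 (by positivity)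
  have iψ' : Integrable (fun A => max (ψ A) 0) (gam (Fin n × Fin n)) := iψ.pos_part
  have iφ : Integrable (fun A => phi n p t (max (ψ A) 0)) (gam (Fin n × Fin n)) := by
    refine Integrable.mono' ((integrable_const |phi n p t 0|).add iψ'.abs) ((phi_cont p t).comp_aestronglyMeasurable iψ'.aestronglyMeasurable) (Filter.Eventually.of_forall fun A => ?_)
    simp only [Pi.add_apply]
    have h1 := phi_lip (n := n) p t (max (ψ A) 0) 0
    have h2 := phi_lip (n := n) p t 0 (max (ψ A) 0)
    rw [abs_sub_comm] at h2
    rw [sub_zero] at h1 h2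
    rw [Real.norm_eq_abs, abs_le]
    have := neg_abs_le (phi n p t 0)
    have := le_abs_self (phi n p t 0)
    constructor <;> linarith
  have hwB : BV (fun (q : Sph n × Sph n) ij => c / √n * wv q ij) := wv_BV.smul _
  obtain ⟨fi, fe⟩ := GS_fubini (a := fun (q : Sph n × Sph n) ij => c / √n * wv q ij) (b := fun q => pv p t q) (m := fun _ => 0) hwB (pv_BV p t) (BM.const 0)
  calc phi n p t lam ≤ phi n p t (∫ A, max (ψ A) 0 ∂gam (Fin n × Fin n)) :=
        phi_mono p t hl (hψ.trans (integral_mono iψ iψ' fun A => le_max_left _ _))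
    _ ≤ ∫ A, phi n p t (max (ψ A) 0) ∂gam (Fin n × Fin n) :=
        (phi_convex p t).map_integral_le (phi_cont p t).continuousOn isClosed_univ (by simp) iψ' iφ
    _ ≤ ∫ A, GS (fun q : Sph n × Sph n => pv p t q) (fld (fun q ij => c / √n * wv q ij) (fun _ => 0) A) ∂gam (Fin n × Fin n) :=
        integral_mono iφ fi fun A => mat_bound p t c u hc0 hu0 A
    _ = _ := fe.symm
    _ ≤ _ := by
        refine SF (hwB.elim (pv_BV p t)) (pv_BV p _) (BM.const 0) fun q q' => ?_
        rw [Fintype.sum_sum_type]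
        simp only [Sum.elim_inl, Sum.elim_inr, pv_inc]
        simp only [← mul_sub, mul_pow, ← Finset.mul_sum]
        have := mul_le_mul_of_nonneg_left (wv_inc q q') (sq_nonneg (c / √n))
        refine (add_le_add_left this _).trans (le_of_eq ?_)
        rw [Real.sq_sqrt (by positivity), div_pow, Real.sq_sqrt hn.le]
        have : 64 * lam^2 / kap^4 = 4 * c^2 := by rw [hc]; field_simp; ring
        rw [this]
        field_simp; ring
end
end PS
open MeasureTheory ProbabilityTheory
set_option linter.unusedSectionVars false
namespace PS

lemma tangent {p : ℕ} (hp : Even p) (hp1 : 1 ≤ p) (s ρ : ℝ) (hρ : 0 < ρ) : ρ^p + p * ρ^(p-1) * (s - ρ) ≤ s^p := by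
  have h0 : 0 ≤ |s|/ρ := by positivity
  have h := one_add_mul_le_pow (a := |s|/ρ - 1) (by linarith) p
  have e : (1 + (|s|/ρ - 1))^p = s^p / ρ^p := by
    rw [add_sub_cancel, div_pow, hp.pow_abs]
  rw [e, le_div_iff₀ (by positivity)] at h
  refine le_trans ?_ h
  have e2 : ρ^p = ρ^(p-1) * ρ := by rw [← pow_succ]; congr 1; omega
  have e3 : (1 + p * (|s|/ρ - 1)) * ρ^p = ρ^p + p * ρ^(p-1) * (|s| - ρ) := by
    rw [e2]; field_simp
  rw [e3]
  have := le_abs_self s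
  gcongr

lemma D_bound {p : ℕ} (hp : 4 ≤ p) (hpe : Even p) (r r1 r2 a b : ℝ) (hr : 0 < r) (h1 : r ≤ r1) (h1' : r1 ≤ 2*r)
    (h2 : r ≤ r2) (h2' : r2 ≤ 2 * r) (hr1 : 2 * r ≤ 1) (X : ℝ) (hX : 0 ≤ X) (hab : r1 + r2 - a - b ≤ X) :
    r1^p + r2^p - a^p - b^p ≤ p^2 * (r1-r2)^2 / 2 + p * (2*r)^(p-1) * X := by
  set ρ := (r1+r2)/2 with hρ
  have hρ0 : 0 < ρ := by rw [hρ]; linarith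
  have ta := tangent hpe (by omega) a ρ hρ0
  have tb := tangent hpe (by omega) b ρ hρ0
  have t1 := tangent hpe (by omega) ρ r1 (by linarith)
  have t2 := tangent hpe (by omega) ρ r2 (by linarith)
  have m := abs_pow_sub_pow_le r1 r2 (p-1)
  have mm : max |r1| |r2| ^ (p-1-1) ≤ 1 := by
    refine pow_le_one₀ (by positivity) (max_le ?_ ?_) <;> rw [abs_of_nonneg] <;> linarith
  have hp1 : ((p-1 : ℕ) : ℝ) ≤ p := by exact_mod_cast Nat.sub_le _ _
  have m2 : |r1^(p-1) - r2^(p-1)| ≤ |r1 - r2| * p := by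
    refine m.trans ?_
    calc |r1-r2| * ((p-1:ℕ):ℝ) * max |r1| |r2| ^ (p-1-1) ≤ |r1-r2| * ((p-1:ℕ):ℝ) * 1 := by gcongr
      _ ≤ _ := by rw [mul_one]; gcongr
  have m3 : (r1 - r2) * (r1^(p-1) - r2^(p-1)) ≤ (r1-r2)^2 * p := by
    calc _ ≤ |(r1 - r2) * (r1^(p-1) - r2^(p-1))| := le_abs_self _
      _ = |r1-r2| * |r1^(p-1) - r2^(p-1)| := abs_mul _ _
      _ ≤ |r1-r2| * (|r1 - r2| * p) := by gcongr
      _ = |r1-r2|^2 * p := by ring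
      _ = _ := by rw [sq_abs]
  have f1 : r1^p + r2^p - 2*ρ^p ≤ p^2 * (r1-r2)^2/2 := by
    have : (p:ℝ)/2 * ((r1 - r2) * (r1^(p-1) - r2^(p-1))) ≤ p/2 * ((r1-r2)^2 * p) := by gcongr
    have e : p * r1^(p-1) * (ρ - r1) + p * r2^(p-1) * (ρ - r2) = - ((p:ℝ)/2 * ((r1 - r2) * (r1^(p-1) - r2^(p-1)))) := by
      rw [hρ]; ring
    nlinarith
  have f2 : p * ρ^(p-1) * (r1 + r2 - a - b) ≤ p * (2*r)^(p-1) * X := by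
    have : ρ ≤ 2 * r := by rw [hρ]; linarith
    calc p * ρ^(p-1) * (r1 + r2 - a - b) ≤ p * ρ^(p-1) * X := by gcongr
      _ ≤ _ := by gcongr
  have e : p * ρ^(p-1) * (a - ρ) + p * ρ^(p-1) * (b - ρ) = - (p * ρ^(p-1) * (r1 + r2 - a - b)) := by
    rw [hρ]; ring
  linarith

section
variable {n : ℕ} [NeZero n]

lemma B1 {p : ℕ} (hp : 4 ≤ p) (hpe : Even p) {T : Type*} [Nonempty T] (f : T → Sph n × Sph n) (r t lam s : ℝ) (hl : 0 ≤ lam)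
    (hs : s = t^2 + 64 * lam^2 / kap^4) (hr : ∀ k, r ≤ Rs (f k).1.1 (f k).2.1) :
    GS (fun k => pv p t (f k)) (fun _ => 0) ≤ 2 * ((1 + 8 * s) * En p n + 2 * √s * kap / √n) - lam * r := by
  have hk := kap_pos
  have hs0 : 0 ≤ s := by rw [hs]; positivity
  have bm : BM (fun q : Sph n × Sph n => lam * Rs q.1.1 q.2.1) := ⟨lam, fun q => by
    rw [abs_mul, abs_of_nonneg hl]; exact mul_le_of_le_one_right hl (Rs_abs _ _)⟩
  have bv := pv_BV (n := n) p t
  have h1 := GS_mono_m (a := fun k => pv p t (f k)) (m := fun _ => (0:ℝ)) (m' := fun k => lam * Rs (f k).1.1 (f k).2.1 + (-(lam * r))) (bv.comp f) (BM.const 0) (BM.add (bm.comp f) (BM.const _))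
    (fun k => by have := mul_le_mul_of_nonneg_left (hr k) hl; linarith)
  rw [GS_add_const (a := fun k => pv p t (f k)) (m := fun k => lam * Rs (f k).1.1 (f k).2.1) _ (bv.comp f) (bm.comp f)] at h1
  have h2 := GS_reindex (a := fun q => pv p t q) (m := fun q : Sph n × Sph n => lam * Rs q.1.1 q.2.1) bv bm f
  have h3 := L3 (n := n) p t lam hl
  rw [← hs] at h3
  have h4 := L2 (n := n) hp hpe (√s) (Real.sqrt_nonneg _)
  rw [Real.sq_sqrt hs0] at h4
  have h5 : √(1+16*s) ≤ 1 + 8 * s := by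
    rw [Real.sqrt_le_left (by positivity)]; nlinarith
  have hE : 0 ≤ En p n := GS_ge (hv_BV p) (BM.const 0) (Classical.arbitrary (Sph n))
  have h6 := mul_le_mul_of_nonneg_right h5 hE
  unfold phi at h3
  linarith

noncomputable def av (p : ℕ) (c1 s1 c2 s2 : ℝ) (q : Sph n × Sph n) : (Fin p → Fin n) ⊕ (Fin p → Fin n) → ℝ :=
  Sum.elim (fun j => c1 * hv p q.1.1 j + c2 * hv p q.2.1 j) (fun j => s1 * hv p q.1.1 j + s2 * hv p q.2.1 j)

lemma av_BV (p : ℕ) (c1 s1 c2 s2 : ℝ) : BV (fun q : Sph n × Sph n => av p c1 s1 c2 s2 q) := by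
  have h : BV (fun x : Sph n => hv p x.1) := hv_BV p
  have hx := h.comp (fun q : Sph n × Sph n => q.1)
  have hy := h.comp (fun q : Sph n × Sph n => q.2)
  exact BV.elim (BV.add (hx.smul c1) (hy.smul c2)) (BV.add (hx.smul s1) (hy.smul s2))

lemma av_inc (p : ℕ) {c1 s1 c2 s2 : ℝ} (h1 : c1^2+s1^2 = 1) (h2 : c2^2+s2^2=1) (q q' : Sph n × Sph n) :
    ∑ j, (av p c1 s1 c2 s2 q j - av p c1 s1 c2 s2 q' j)^2 =
      (2 - 2 * Rs q.1.1 q'.1.1 ^ p)/n + (2 - 2 * Rs q.2.1 q'.2.1^p)/n +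
      2 * (c1*c2+s1*s2) * ((Rs q.1.1 q.2.1^p + Rs q'.1.1 q'.2.1^p - Rs q.1.1 q'.2.1^p - Rs q'.1.1 q.2.1^p)/n) := by
  rw [← hv_inc, ← hv_inc, Fintype.sum_sum_type]
  simp only [add_div, sub_div, ← hv_inner]
  rw [← Finset.sum_add_distrib, ← Finset.sum_add_distrib, ← Finset.sum_add_distrib, ← Finset.sum_sub_distrib, ← Finset.sum_sub_distrib, Finset.mul_sum, ← Finset.sum_add_distrib]
  refine Finset.sum_congr rfl fun j _ => ?_
  simp only [av, Sum.elim_inl, Sum.elim_inr]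
  have e1 : s1^2 = 1 - c1^2 := by linarith
  have e2 : s2^2 = 1 - c2^2 := by linarith
  ring_nf
  rw [e1, e2]
  ring

lemma Rs_mixed (x x' y y' : Sph n) : Rs x.1 y.1 + Rs x'.1 y'.1 - Rs x.1 y'.1 - Rs x'.1 y.1 ≤ (1 - Rs x.1 x'.1) + (1 - Rs y.1 y'.1) := by
  have hn := npos (n := n)
  have hx := sph_sq x
  have hx' := sph_sq x'
  have hy := sph_sq y
  have hy' := sph_sq y'
  have key : 0 ≤ ∑ i, (x.1 i - x'.1 i - (y.1 i - y'.1 i))^2 := Finset.sum_nonneg fun _ _ => sq_nonneg _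
  have e : ∀ i, (x.1 i - x'.1 i - (y.1 i - y'.1 i))^2 = (x.1 i)^2 + (x'.1 i)^2 + (y.1 i)^2 + (y'.1 i)^2 - 2 * (x.1 i * x'.1 i) - 2 * (y.1 i * y'.1 i)
     - 2 * (x.1 i * y.1 i) - 2 * (x'.1 i * y'.1 i) + 2 * (x.1 i * y'.1 i) + 2 * (x'.1 i * y.1 i) := fun i => by ring
  simp_rw [e, Finset.sum_add_distrib, Finset.sum_sub_distrib, Finset.sum_add_distrib, ← Finset.mul_sum, hx, hx', hy, hy'] at key
  unfold Rs
  have h : ∀ a : ℝ, a = a / n * n := fun a => by field_simp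
  rw [h (∑ i, x.1 i * x'.1 i), h (∑ i, y.1 i * y'.1 i), h (∑ i, x.1 i * y.1 i), h (∑ i, x'.1 i * y'.1 i), h (∑ i, x.1 i * y'.1 i), h (∑ i, x'.1 i * y.1 i)] at key
  nlinarith

lemma B2 {p : ℕ} (hp : 4 ≤ p) (hpe : Even p) {T : Type*} [Nonempty T] (f : T → Sph n × Sph n) (r : ℝ) (hr : 0 < r) (hr1 : 2*r ≤ 1)
    (hr : ∀ k, r ≤ Rs (f k).1.1 (f k).2.1) {c1 s1 c2 s2 : ℝ} (h1 : c1^2+s1^2 = 1) (h2 : c2^2+s2^2=1) (hk : 0 ≤ c1*c2+s1*s2)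
    (h : c1*c2+s1*s2 = 0 ∨ ∀ k, Rs (f k).1.1 (f k).2.1 ≤ 2 * r) :
    GS (fun k => av p c1 s1 c2 s2 (f k)) (fun _ => 0) ≤ GS (fun k => pv p (√(p*(2*r)^(p-1))) (f k)) (fun _ => 0) + p / √n * kap := by
  have hn := npos (n := n)
  have bv := (pv_BV (n := n) p (√(p*(2*r)^(p-1)))).comp f
  have habs : ∀ k, |p / √n * Rs (f k).1.1 (f k).2.1| ≤ p / √n := fun k => by
    rw [abs_mul, abs_of_nonneg (by positivity)]
    exact mul_le_of_le_one_right (by positivity) (Rs_abs _ _)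
  have bs : BV (fun k (_ : Unit) => p / √n * Rs (f k).1.1 (f k).2.1) := ⟨_, fun k _ => habs k⟩
  refine le_trans ?_ (add_le_add_right (GS_scalar (fun k => p / √n * Rs (f k).1.1 (f k).2.1) (p / √n) habs) _)
  refine le_trans ?_ (GS_elim_add0 bv bs (BM.const 0))
  refine SF ((av_BV p c1 s1 c2 s2).comp f) (bv.elim bs) (BM.const 0) fun k k' => ?_
  rw [av_inc p h1 h2, Fintype.sum_sum_type]
  simp only [Sum.elim_inl, Sum.elim_inr, pv_inc]
  simp only [Finset.univ_unique, Finset.sum_singleton]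
  rw [Real.sq_sqrt (by positivity), ← mul_sub, mul_pow (p / √n : ℝ), div_pow, Real.sq_sqrt hn.le]
  have a1 := Rs_le (f k).1 (f k').1
  have a2 := Rs_le (f k).2 (f k').2
  set X := (1 - Rs (f k).1.1 (f k').1.1) + (1 - Rs (f k).2.1 (f k').2.1) with hX
  have hX0 : 0 ≤ X := by rw [hX]; linarith
  set D := Rs (f k).1.1 (f k).2.1^p + Rs (f k').1.1 (f k').2.1^p - Rs (f k).1.1 (f k').2.1^p - Rs (f k').1.1 (f k).2.1^p with hD
  set Bd := p^2 * (Rs (f k).1.1 (f k).2.1-Rs (f k').1.1 (f k').2.1)^2 / 2 + p * (2*r)^(p-1) * X with hB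
  have hB0 : 0 ≤ Bd := by positivity
  have hk1 : c1*c2+s1*s2 ≤ 1 := by nlinarith [sq_nonneg (c1-c2), sq_nonneg (s1-s2)]
  have key : (c1*c2+s1*s2) * D ≤ Bd := by
    rcases h with h | h
    · rw [h, zero_mul]; exact hB0
    · have := D_bound hp hpe r _ _ (Rs (f k).1.1 (f k').2.1) (Rs (f k').1.1 (f k).2.1) (by assumption) (hr k) (h k) (hr k') (h k') hr1 X hX0 (Rs_mixed _ _ _ _)
      calc (c1*c2+s1*s2) * D ≤ (c1*c2+s1*s2) * Bd := mul_le_mul_of_nonneg_left this hk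
        _ ≤ Bd := mul_le_of_le_one_left hB0 hk1
  have : 2 * (c1*c2+s1*s2) * (D/n) ≤ 2 * Bd / n := by
    rw [← mul_div_assoc, div_le_div_iff_of_pos_right hn]; linarith
  refine (add_le_add_right this _).trans (le_of_eq ?_)
  rw [hB, hX]; field_simp; ring
end

lemma B3 {p : ℕ} (hp : 4 ≤ p) (hpe : Even p) (M : ℝ) (hM : 0 ≤ M) : ∃ r > (0:ℝ), 2 * r ≤ 1 ∧ ∃ η > (0:ℝ), ∃ C : ℝ,
    ∀ (n : ℕ) [NeZero n], En p n ≤ M → ∀ {T : Type} [Nonempty T] (f : T → Sph n × Sph n), (∀ k, r ≤ Rs (f k).1.1 (f k).2.1) →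
    ∀ {c1 s1 c2 s2 : ℝ}, c1^2+s1^2 = 1 → c2^2+s2^2=1 → 0 ≤ c1*c2+s1*s2 →
    (c1*c2+s1*s2 = 0 ∨ ∀ k, Rs (f k).1.1 (f k).2.1 ≤ 2 * r) →
    GS (fun k => av p c1 s1 c2 s2 (f k)) (fun _ => 0) ≤ 2 * En p n - η + C / √n := by
  have hk := kap_pos
  have hp0 : (0:ℝ) < p := by exact_mod_cast (by omega : 0 < p)
  set θ := kap^4 / (4096 * (M+1)) with hθ
  have hθ0 : 0 < θ := by positivity
  set r := min (1/2) (θ / (512 * (M+1) * p)) with hr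
  have hr0 : 0 < r := by rw [hr]; positivity
  have hr1 : 2 * r ≤ 1 := by have := min_le_left (1/2) (θ / (512 * (M+1) * p)); rw [← hr] at this; linarith
  have hr2 : 512 * (M+1) * p * r ≤ θ := by
    have := min_le_right (1/2) (θ / (512 * (M+1) * p)); rw [← hr] at this
    rwa [le_div_iff₀' (by positivity)] at this
  set t := √(p*(2*r)^(p-1)) with ht
  have ht2 : t^2 = p*(2*r)^(p-1) := Real.sq_sqrt (by positivity)
  set s := t^2 + 64 * (θ*r)^2 / kap^4 with hs
  refine ⟨r, hr0, hr1, θ * r^2/2, by positivity, 4 * √s * kap + p * kap, ?_⟩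
  intro n _ hE T _ f hf c1 s1 c2 s2 h1 h2 h3 h4
  have hn := npos (n := n)
  have b2 := B2 hp hpe f r hr0 hr1 hf h1 h2 h3 h4
  have b1 := B1 hp hpe f r t (θ*r) s (by positivity) hs hf
  have hE0 : 0 ≤ En p n := GS_ge (hv_BV p) (BM.const 0) (Classical.arbitrary (Sph n))
  have k1 : t^2 ≤ 8 * p * r^3 := by
    rw [ht2]
    have : (2*r)^(p-1) ≤ (2*r)^3 := pow_le_pow_of_le_one (by positivity) hr1 (by omega)
    calc p*(2*r)^(p-1) ≤ p * (2*r)^3 := by gcongr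
      _ = _ := by ring
  have k2 : 16 * M * t^2 ≤ θ * r^2 / 4 := by
    calc 16 * M * t^2 ≤ 16 * (M+1) * (8 * p * r^3) := by gcongr; linarith
      _ = (512 * (M+1) * p * r) * r^2 / 4 := by ring
      _ ≤ _ := by gcongr
  have k3 : 16 * M * (64 * (θ*r)^2 / kap^4) ≤ θ * r^2 / 4 := by
    calc 16 * M * (64 * (θ*r)^2 / kap^4) ≤ 16 * (M+1) * (64 * (θ*r)^2 / kap^4) := by gcongr; linarith
      _ = (4096 * (M+1) * θ / kap^4) * (θ * r^2/4) := by ring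
      _ = θ * r^2/4 := by rw [hθ]; field_simp
  have k4 : 16 * s * En p n ≤ θ * r^2/2 := by
    have hs0 : 0 ≤ s := by rw [hs]; positivity
    calc 16 * s * En p n ≤ 16 * s * M := by gcongr
      _ = 16 * M * t^2 + 16 * M * (64 * (θ*r)^2 / kap^4) := by rw [hs]; ring
      _ ≤ _ := by linarith
  refine b2.trans ((add_le_add_left b1 _).trans ?_)
  have e : (4 * √s * kap + p * kap) / √n = 2 * (2 * √s * kap / √n) + p / √n * kap := by ring
  rw [e]
  nlinarith
end PS
open MeasureTheory ProbabilityTheory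
set_option linter.unusedSectionVars false
namespace PS

lemma mp_uncurry (N : ℕ) (J : Type*) [Fintype J] : MeasurePreserving (fun (Y : Fin N → J → ℝ) (ij : Fin N × J) => Y ij.1 ij.2)
    (Measure.pi fun _ : Fin N => gam J) (gam (Fin N × J)) := by
  have hm : Measurable (fun (Y : Fin N → J → ℝ) (ij : Fin N × J) => Y ij.1 ij.2) := by fun_prop
  refine ⟨hm, ?_⟩
  symm
  refine Measure.pi_eq fun s hs => ?_
  rw [Measure.map_apply hm (MeasurableSet.univ_pi hs)]
  have : (fun (Y : Fin N → J → ℝ) (ij : Fin N × J) => Y ij.1 ij.2) ⁻¹' (Set.univ.pi s) = Set.univ.pi (fun i => Set.univ.pi fun j => s (i,j)) := by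
    ext Y; simp
  rw [this, Measure.pi_pi]
  simp_rw [Measure.pi_pi]
  rw [Fintype.prod_prod_type]

section
variable {K J : Type*} [Fintype J] [Nonempty K] {a : K → J → ℝ}

def cp (N : ℕ) (a : K → J → ℝ) (ik : Fin N × K) (ij : Fin N × J) : ℝ := if ik.1 = ij.1 then a ik.2 ij.2 else 0

lemma cp_BV (N : ℕ) (h : BV a) : BV (cp N a) := by
  obtain ⟨C, hC⟩ := h
  refine ⟨max C 0, fun k j => ?_⟩
  unfold cp; split_ifs
  · exact (hC _ _).trans (le_max_left _ _)
  · simp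

lemma le_cp {N : ℕ} (h : BV a) (Y : Fin N → J → ℝ) (i : Fin N) :
    sp a (fun _ => 0) (Y i) ≤ sp (cp N a) (fun _ => 0) (fun ij => Y ij.1 ij.2) := by
  refine sp_le fun k => ?_
  have := le_sp (cp_BV N h) (BM.const 0) (fun ij => Y ij.1 ij.2) (i, k)
  refine le_trans (le_of_eq ?_) this
  unfold fld cp
  rw [Fintype.sum_prod_type]
  simp

lemma gmax (N : ℕ) [NeZero N] (l : ℝ) (hl : 0 < l) :
    GS (fun (i i' : Fin N) => if i = i' then (1:ℝ) else 0) (fun _ => 0) ≤ Real.log N / l + l / 2 := by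
  set b := Real.log N + l^2/2 with hb
  have ie : ∀ i : Fin N, Integrable (fun y : Fin N → ℝ => Real.exp (l * y i)) (gam (Fin N)) ∧ ∫ y : Fin N → ℝ, Real.exp (l * y i) ∂gam (Fin N) = Real.exp (l^2/2) := by
    intro i
    have mp := measurePreserving_eval (fun _ : Fin N => gaussianReal 0 1) i
    have hm : AEStronglyMeasurable (fun x : ℝ => Real.exp (l * x)) (gaussianReal 0 1) := by fun_prop
    refine ⟨(mp.integrable_comp hm).2 (integrable_exp_mul_gaussianReal l), ?_⟩
    have := integral_map (φ := Function.eval i) (μ := gam (Fin N)) mp.aemeasurable (f := fun x : ℝ => Real.exp (l * x)) (by rw [mp.map_eq]; exact hm)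
    rw [mp.map_eq] at this
    rw [show (∫ y : Fin N → ℝ, Real.exp (l * y i) ∂gam (Fin N)) = ∫ x, Real.exp (l * x) ∂gaussianReal 0 1 from this.symm]
    have := congrFun (mgf_fun_id_gaussianReal (μ := 0) (v := 1)) l
    unfold mgf at this
    rw [this]; simp
  have iS := integrable_finsetSum Finset.univ fun i _ => (ie i).1
  have iT : Integrable (fun y : Fin N → ℝ => (b - 1 + Real.exp (-b) * ∑ i, Real.exp (l * y i)) * (1/l)) (gam (Fin N)) :=
    ((integrable_const _).add (iS.const_mul _)).mul_const _
  have := integral_mono (μ := gam (Fin N)) (sp_int (a := fun (i i' : Fin N) => if i = i' then (1:ℝ) else 0) (m := fun _ => 0) (BV.of_finite _) (BM.const 0)) iT (fun y => by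
    refine sp_le fun i => ?_
    have e : fld (fun (i i' : Fin N) => if i = i' then (1:ℝ) else 0) (fun _ => 0) y i = y i := by simp [fld]
    rw [e, mul_one_div, le_div_iff₀ hl]
    have h1 := Real.add_one_le_exp (l * y i - b)
    have h2 : Real.exp (l * y i) ≤ ∑ i, Real.exp (l * y i) := Finset.single_le_sum (f := fun i => Real.exp (l * y i)) (fun _ _ => (Real.exp_pos _).le) (Finset.mem_univ i)
    have h3 := mul_le_mul_of_nonneg_left h2 (Real.exp_pos (-b)).le
    rw [← Real.exp_add, show -b + l * y i = l * y i - b by ring] at h3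
    linarith)
  refine this.trans (le_of_eq ?_)
  rw [integral_mul_const, integral_add (integrable_const _) (iS.const_mul _), integral_const_mul, integral_finsetSum _ fun i _ => (ie i).1]
  simp_rw [fun i => (ie i).2]
  have hN : (0:ℝ) < N := npos
  have e : Real.exp (-b) * ∑ i : Fin N, Real.exp (l^2/2) = 1 := by
    simp only [Finset.sum_const, Finset.card_univ, Fintype.card_fin, nsmul_eq_mul]
    rw [← mul_assoc, mul_comm (Real.exp (-b)), mul_assoc, ← Real.exp_add, show -b + l^2/2 = - Real.log N by rw [hb]; ring, Real.exp_neg, Real.exp_log hN]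
    field_simp
  rw [e]
  simp [hb]; field_simp; try ring

lemma max_up (N : ℕ) [NeZero N] (h : BV a) (σ : ℝ) (hσ : 0 ≤ σ) (hs : ∀ k, ∑ j, (a k j)^2 ≤ σ^2) (l : ℝ) (hl : 0 < l) :
    GS (cp N a) (fun _ => 0) ≤ GS a (fun _ => 0) + σ * (Real.log N / l + l / 2) := by
  have bb : BV (fun (i i' : Fin N) => if i = i' then (1:ℝ) else 0) := BV.of_finite _
  have b1 : BV (fun ik : Fin N × K => a ik.2) := h.comp (fun ik : Fin N × K => ik.2)
  have b2 : BV (fun (ik : Fin N × K) i' => σ * (if ik.1 = i' then (1:ℝ) else 0)) := (bb.smul σ).comp (fun ik : Fin N × K => ik.1)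
  have h1 := SF (cp_BV N h) (b1.elim b2) (BM.const 0) (fun k k' => by
    obtain ⟨i, k⟩ := k
    obtain ⟨i', k'⟩ := k'
    rw [Fintype.sum_prod_type, Fintype.sum_sum_type]
    simp only [Sum.elim_inl, Sum.elim_inr, cp]
    by_cases hi : i = i'
    · subst hi
      simp only [sub_self]
      have : ∀ x : Fin N, ∑ j, ((if i = x then a k j else 0) - (if i = x then a k' j else 0))^2 = if i = x then ∑ j, (a k j - a k' j)^2 else 0 := by
        intro x; split_ifs <;> simp
      simp_rw [this]
      simp
    · have e1 : ∀ x : Fin N, ∑ j, ((if i = x then a k j else 0) - (if i' = x then a k' j else 0))^2 = (if i = x then ∑ j, (a k j)^2 else 0) + (if i' = x then ∑ j, (a k' j)^2 else 0) := by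
        intro x
        by_cases h1 : i = x
        · have h2 : i' ≠ x := fun h => hi (h1.trans h.symm)
          simp [h1, h2]
        · by_cases h2 : i' = x <;> simp [h1, h2]
      have e2 : ∀ x : Fin N, (σ * (if i = x then (1:ℝ) else 0) - σ * (if i' = x then (1:ℝ) else 0))^2 = (if i = x then σ^2 else 0) + (if i' = x then σ^2 else 0) := by
        intro x
        by_cases h1 : i = x
        · have h2 : i' ≠ x := fun h => hi (h1.trans h.symm)
          simp [h1, h2]
        · by_cases h2 : i' = x <;> simp [h1, h2]
      simp_rw [e1, e2, Finset.sum_add_distrib]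
      simp only [Finset.sum_ite_eq, Finset.mem_univ, if_true]
      have e3 : ∑ j, (a k j - a k' j)^2 = 2 * ∑ j, (a k j)^2 + 2 * ∑ j, (a k' j)^2 - ∑ j, (a k j + a k' j)^2 := by
        rw [Finset.mul_sum, Finset.mul_sum, ← Finset.sum_add_distrib, ← Finset.sum_sub_distrib]
        exact Finset.sum_congr rfl fun j _ => by ring
      have e4 : ∑ j, (a k j + a k' j)^2 ≤ 2 * ∑ j, (a k j)^2 + 2 * ∑ j, (a k' j)^2 := by
        rw [Finset.mul_sum, Finset.mul_sum, ← Finset.sum_add_distrib]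
        exact Finset.sum_le_sum fun j _ => by nlinarith [sq_nonneg (a k j - a k' j)]
      have e5 : ∑ j, (a k j + a k' j)^2 = ∑ j, (a k j)^2 + ∑ j, (a k' j)^2 + 2 * ∑ j, a k j * a k' j := by
        rw [Finset.mul_sum, ← Finset.sum_add_distrib, ← Finset.sum_add_distrib]
        exact Finset.sum_congr rfl fun j _ => by ring
      have := hs k
      have := hs k'
      linarith)
  have h2 := GS_elim_add0 b1 b2 (BM.const 0)
  have h3 := GS_reindex h (BM.const 0) (fun ik : Fin N × K => ik.2)
  have h4 := GS_reindex (bb.smul σ) (BM.const 0) (fun ik : Fin N × K => ik.1)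
  have h5 := GS_smul (a := fun (i i' : Fin N) => if i = i' then (1:ℝ) else 0) (m := fun _ => 0) σ hσ
  simp only [mul_zero] at h5
  have h6 := mul_le_mul_of_nonneg_left (gmax N l hl) hσ
  linarith

lemma GS_cp (N : ℕ) [NeZero N] (h : BV a) : Integrable (fun Y : Fin N → J → ℝ => sp (cp N a) (fun _ => 0) (fun ij => Y ij.1 ij.2)) (Measure.pi fun _ => gam J) ∧
    GS (cp N a) (fun _ => 0) = ∫ Y : Fin N → J → ℝ, sp (cp N a) (fun _ => 0) (fun ij => Y ij.1 ij.2) ∂(Measure.pi fun _ => gam J) := by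
  have mp := mp_uncurry N J
  have i := sp_int (cp_BV N h) (BM.const 0)
  refine ⟨(mp.integrable_comp i.aestronglyMeasurable).2 i, ?_⟩
  have := integral_map (φ := fun (Y : Fin N → J → ℝ) (ij : Fin N × J) => Y ij.1 ij.2) mp.aemeasurable (f := sp (cp N a) (fun _ => 0)) (by rw [mp.map_eq]; exact i.aestronglyMeasurable)
  rw [mp.map_eq] at this
  exact this

lemma low_dev (h : BV a) (σ : ℝ) (hσ : 0 ≤ σ) (hs : ∀ k, ∑ j, (a k j)^2 ≤ σ^2) :
    ∫ y, max (GS a (fun _ => 0) - sp a (fun _ => 0) y) 0 ∂gam J ≤ 2 * σ := by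
  classical
  have hup := max_up 2 h σ hσ hs 1 one_pos
  have hlog : Real.log (2:ℕ) / 1 + 1 / 2 ≤ (2:ℝ) := by
    have := Real.log_two_lt_d9; push_cast; linarith
  obtain ⟨ic, ec⟩ := GS_cp 2 h
  set μ := GS a (fun _ => 0) with hμ
  set F := sp a (fun _ => 0) with hF
  have iF : Integrable F (gam J) := sp_int h (BM.const 0)
  have hFm : Measurable F := (sp_cont h (BM.const 0)).measurable
  let χ : (J → ℝ) → ℝ := fun y => if F y ≤ μ then 1 else 0
  have hχ : Measurable χ := Measurable.ite (measurableSet_le hFm measurable_const) measurable_const measurable_const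
  have iχ : Integrable χ (gam J) := Integrable.of_bound hχ.aestronglyMeasurable 1 (Filter.Eventually.of_forall fun y => by
    simp only [χ]; split_ifs <;> simp)
  have iχF : Integrable (fun y => (1 - χ y) * F y) (gam J) := by
    refine iF.bdd_mul (c := 1) (by fun_prop) (Filter.Eventually.of_forall fun y => ?_)
    simp only [χ]; split_ifs <;> simp
  have mp := measurePreserving_finTwoArrow (gam J)
  let G : (J → ℝ) × (J → ℝ) → ℝ := fun z => (1 - χ z.1) * F z.1 * 1 + χ z.1 * F z.2
  have iG1 : Integrable (fun z : (J → ℝ) × (J → ℝ) => (1 - χ z.1) * F z.1 * 1) ((gam J).prod (gam J)) := iχF.mul_prod (integrable_const (1:ℝ))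
  have iG2 : Integrable (fun z : (J → ℝ) × (J → ℝ) => χ z.1 * F z.2) ((gam J).prod (gam J)) := iχ.mul_prod iF
  have iG : Integrable G ((gam J).prod (gam J)) := iG1.add iG2
  have eG : ∫ z, G z ∂((gam J).prod (gam J)) = μ + ∫ y, max (μ - F y) 0 ∂gam J := by
    simp only [G]
    rw [integral_add iG1 iG2, integral_prod_mul (fun y => (1 - χ y) * F y) (fun _ => (1:ℝ)), integral_prod_mul χ F]
    have e1 : ∫ y, F y ∂gam J = μ := rfl
    have e2 : ∀ y, max (μ - F y) 0 = μ * χ y - F y + (1 - χ y) * F y := fun y => by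
      simp only [χ]; split_ifs with hc
      · rw [max_eq_left (by linarith)]; ring
      · rw [max_eq_right (by linarith)]; ring
    simp_rw [e2]
    have iq : Integrable (fun y => μ * χ y - F y) (gam J) := (iχ.const_mul μ).sub iF
    rw [integral_add iq iχF, integral_sub (iχ.const_mul μ) iF, integral_const_mul, e1]
    simp; ring
  have key : ∫ z, G z ∂((gam J).prod (gam J)) ≤ GS (cp 2 a) (fun _ => 0) := by
    rw [ec, ← mp.integral_comp' (g := G)]
    refine integral_mono ((mp.integrable_comp iG.aestronglyMeasurable).2 iG) ic fun Y => ?_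
    have h0 := le_cp h Y 0
    have h1 := le_cp h Y 1
    simp only [G, χ]
    change (1 - if F (Y 0) ≤ μ then 1 else 0) * F (Y 0) * 1 + (if F (Y 0) ≤ μ then 1 else 0) * F (Y 1) ≤ _
    split_ifs
    · simpa using h1
    · simpa using h0
  have h6 := mul_le_mul_of_nonneg_left hlog hσ
  linarith

lemma up_dev (N : ℕ) [NeZero N] (h : BV a) (σ : ℝ) (hσ : 0 ≤ σ) (hs : ∀ k, ∑ j, (a k j)^2 ≤ σ^2) (l : ℝ) (hl : 0 < l) (u : ℝ) (hu : 0 ≤ u) :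
    u * (1 - ((gam J).real {y | sp a (fun _ => 0) y < GS a (fun _ => 0) + u})^N) ≤ 2 * σ + σ * (Real.log N / l + l / 2) := by
  classical
  have hup := max_up N h σ hσ hs l hl
  have hlow := low_dev h σ hσ hs
  obtain ⟨ic, ec⟩ := GS_cp N h
  set μ := GS a (fun _ => 0) with hμ
  set F := sp a (fun _ => 0) with hF
  have iF : Integrable F (gam J) := sp_int h (BM.const 0)
  have hFm : Measurable F := (sp_cont h (BM.const 0)).measurable
  let S : Set (J → ℝ) := {y | F y < μ + u}
  have hS : MeasurableSet S := measurableSet_lt hFm measurable_const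
  let A : Set (Fin N → J → ℝ) := Set.univ.pi fun _ => S
  have hA : MeasurableSet A := MeasurableSet.univ_pi fun _ => hS
  have mA : (Measure.pi fun _ : Fin N => gam J).real A = ((gam J).real S)^N := by
    simp only [Measure.real, A, Measure.pi_pi]; simp
  have mp := measurePreserving_eval (fun _ : Fin N => gam J) 0
  have im : Integrable (fun y => max (μ - F y) 0) (gam J) := ((integrable_const μ).sub iF).pos_part
  have im' : Integrable (fun Y : Fin N → J → ℝ => max (μ - F (Y 0)) 0) (Measure.pi fun _ => gam J) := (mp.integrable_comp im.aestronglyMeasurable).2 im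
  have em' : ∫ Y : Fin N → J → ℝ, max (μ - F (Y 0)) 0 ∂(Measure.pi fun _ => gam J) = ∫ y, max (μ - F y) 0 ∂gam J := by
    have := integral_map (φ := Function.eval (0 : Fin N)) (μ := Measure.pi fun _ : Fin N => gam J) mp.aemeasurable (f := fun y => max (μ - F y) 0) (by rw [mp.map_eq]; exact im.aestronglyMeasurable)
    rw [mp.map_eq] at this
    exact this.symm
  have iA : Integrable (A.indicator fun _ => (1:ℝ)) (Measure.pi fun _ => gam J) := (integrable_const _).indicator hA
  have key : ∫ Y : Fin N → J → ℝ, ((μ + u) - u * A.indicator (fun _ => (1:ℝ)) Y - max (μ - F (Y 0)) 0) ∂(Measure.pi fun _ => gam J) ≤ GS (cp N a) (fun _ => 0) := by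
    rw [ec]
    refine integral_mono (((integrable_const _).sub (iA.const_mul u)).sub im') ic fun Y => ?_
    simp only
    by_cases hY : Y ∈ A
    · rw [Set.indicator_of_mem hY]
      have h0 := le_cp h Y 0
      have := le_max_left (μ - F (Y 0)) 0
      linarith
    · rw [Set.indicator_of_notMem hY]
      have : ∃ i, μ + u ≤ F (Y i) := by
        by_contra hc
        push Not at hc
        exact hY fun i _ => hc i
      obtain ⟨i, hi⟩ := this
      have h0 := le_cp h Y i
      have := le_max_right (μ - F (Y 0)) 0
      linarith
  have iB : Integrable (fun Y : Fin N → J → ℝ => (μ + u) - u * A.indicator (fun _ => (1:ℝ)) Y) (Measure.pi fun _ => gam J) := (integrable_const _).sub (iA.const_mul u)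
  rw [integral_sub iB im', integral_sub (integrable_const _) (iA.const_mul u), integral_const_mul, em', integral_indicator_const _ hA, mA] at key
  simp only [integral_const, smul_eq_mul, probReal_univ, one_mul, mul_one] at key
  change u * (1 - ((gam J).real S)^N) ≤ _
  linarith
end

lemma conc (s u : ℝ) (hs0 : 0 < s) (hu : 0 < u) : ∃ c > (0:ℝ), ∃ n₀ : ℕ, ∀ n ≥ n₀, ∀ {K J : Type} [Fintype J] [Nonempty K] (a : K → J → ℝ),
    BV a → (∀ k, ∑ j, (a k j)^2 ≤ s^2 / n) → gam J {y | GS a (fun _ => 0) + u ≤ sp a (fun _ => 0) y} ≤ ENNReal.ofReal (Real.exp (-c * n)) := by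
  set κ := u / (12 * s) with hκ
  have hκ0 : 0 < κ := by positivity
  have t1 : Filter.Tendsto (fun n : ℕ => 2 * s / √n + s / (κ * n)) Filter.atTop (nhds 0) := by
    have a1 : Filter.Tendsto (fun n : ℕ => 2 * s / √n) Filter.atTop (nhds 0) :=
      Filter.Tendsto.div_atTop tendsto_const_nhds (Real.tendsto_sqrt_atTop.comp tendsto_natCast_atTop_atTop)
    have a2 : Filter.Tendsto (fun n : ℕ => s / (κ * n)) Filter.atTop (nhds 0) :=
      Filter.Tendsto.div_atTop tendsto_const_nhds (tendsto_natCast_atTop_atTop.const_mul_atTop hκ0)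
    simpa using a1.add a2
  obtain ⟨n₀, hn₀⟩ := Filter.eventually_atTop.1 (t1.eventually (gt_mem_nhds (show 0 < u/4 by positivity)))
  refine ⟨κ^2, by positivity, max n₀ 1, fun n hn K J _ _ a h hs => ?_⟩
  have hn1 : 1 ≤ n := (le_max_right _ _).trans hn
  have hn2 := hn₀ n ((le_max_left _ _).trans hn)
  have hn0 : (0:ℝ) < n := by exact_mod_cast hn1
  have hsn : 0 < √(n:ℝ) := Real.sqrt_pos.2 hn0
  set N := ⌈Real.exp (κ^2 * n)⌉₊ with hN
  have hNp : 0 < N := Nat.ceil_pos.2 (Real.exp_pos _)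
  haveI : NeZero N := ⟨hNp.ne'⟩
  have hN1 : Real.exp (κ^2 * n) ≤ N := Nat.le_ceil _
  have hN2 : (N:ℝ) ≤ Real.exp (κ^2 * n + 1) := by
    have h1 := (Nat.ceil_lt_add_one (Real.exp_pos (κ^2*n)).le).le
    have h2 : 1 ≤ Real.exp (κ^2 * n) := Real.one_le_exp (by positivity)
    have h3 := Real.add_one_le_exp (1:ℝ)
    rw [Real.exp_add]
    nlinarith
  have hlog : Real.log N ≤ κ^2 * n + 1 := by
    rw [Real.log_le_iff_le_exp (by exact_mod_cast hNp)]; exact hN2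
  have hd := up_dev N h (s / √n) (by positivity) (fun k => by rw [div_pow, Real.sq_sqrt hn0.le]; exact hs k) (κ * √n) (by positivity) u hu.le
  set μ := GS a (fun _ => 0) with hμ
  set F := sp a (fun _ => 0) with hF
  have hFm : Measurable F := (sp_cont h (BM.const 0)).measurable
  set P := (gam J).real {y | F y < μ + u} with hP
  have hb : 2 * (s / √n) + s / √n * (Real.log N / (κ * √n) + κ * √n / 2) ≤ u / 2 := by
    have : s / √n * (Real.log N / (κ * √n) + κ * √n / 2) ≤ s / √n * ((κ^2 * n + 1) / (κ * √n) + κ * √n / 2) := by gcongr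
    have e : s / √n * ((κ^2 * n + 1) / (κ * √n) + κ * √n / 2) = s * κ + s / (κ * n) + s * κ / 2 := by
      have : √(n:ℝ)^2 = n := Real.sq_sqrt hn0.le
      rw [← this, Real.sqrt_sq hsn.le]
      field_simp
    have e2 : s * κ = u / 12 := by rw [hκ]; field_simp
    have e3 : 2 * (s / √n) = 2 * s / √n := by ring
    rw [e2] at e
    linarith
  have hPN : 1/2 ≤ P^N := by
    have := hd.trans hb
    by_contra hc
    push Not at hc
    nlinarith
  have hcompl : {y | μ + u ≤ F y} = {y | F y < μ + u}ᶜ := by ext y; simp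
  have hq : (gam J).real {y | μ + u ≤ F y} = 1 - P := by
    rw [hcompl, probReal_compl_eq_one_sub (measurableSet_lt hFm measurable_const)]
  set q := (gam J).real {y | μ + u ≤ F y} with hq'
  have hqN : q * N ≤ 1 := by
    by_contra hc
    push Not at hc
    have h1 : P ≤ Real.exp (-q) := by have := Real.add_one_le_exp (-q); linarith
    have h2 : P^N ≤ Real.exp (-q)^N := pow_le_pow_left₀ measureReal_nonneg h1 N
    rw [← Real.exp_nat_mul] at h2
    have h3 : Real.exp (N * -q) < Real.exp (-1) := Real.exp_lt_exp.2 (by linarith)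
    have h4 := Real.exp_neg_one_lt_d9
    linarith
  have hfin : q ≤ Real.exp (-κ^2 * n) := by
    have : q * Real.exp (κ^2 * n) ≤ 1 := (mul_le_mul_of_nonneg_left hN1 measureReal_nonneg).trans hqN
    rw [show -κ^2 * (n:ℝ) = -(κ^2 * n) by ring, Real.exp_neg, ← one_div, le_div_iff₀ (Real.exp_pos _)]
    exact this
  rw [← ofReal_measureReal]
  exact ENNReal.ofReal_le_ofReal hfin
end PS
open MeasureTheory ProbabilityTheory
set_option linter.unusedSectionVars false
namespace PS

lemma maxSphere_eq (p n : ℕ) (Y : (Fin p → Fin n) → ℝ) : maxSphere p n Y = sp (fun x : Sph n => hv p x.1) (fun _ => 0) Y := by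
  unfold maxSphere sp
  rw [sSup_image']
  refine iSup_congr fun x => ?_
  rw [H_eq]; simp [fld]

lemma hv_sq (p : ℕ) {n : ℕ} [NeZero n] (x : Sph n) : ∑ j, (hv p x.1 j)^2 = 1 / n := by
  have := hv_inner p x.1 x.1
  rw [Rs_self, one_pow] at this
  rw [← this]
  exact Finset.sum_congr rfl fun j _ => sq _

lemma En_low (p n : ℕ) [NeZero n] (v : ℝ) (hv0 : 0 < v) :
    gam (Fin p → Fin n) {Y | maxSphere p n Y ≤ En p n - v} ≤ ENNReal.ofReal (2 * (1/√n) / v) := by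
  have hb : BV (fun x : Sph n => hv p x.1) := hv_BV p
  have h1 := low_dev hb (1/√n) (by positivity) (fun k => by
    rw [hv_sq, div_pow, Real.sq_sqrt (by positivity)]; simp)
  have im : Integrable (fun y => max (En p n - sp (fun x : Sph n => hv p x.1) (fun _ => 0) y) 0) (gam (Fin p → Fin n)) :=
    ((integrable_const _).sub (sp_int hb (BM.const 0))).pos_part
  have h2 := mul_meas_ge_le_integral_of_nonneg (Filter.Eventually.of_forall fun y => le_max_right _ _) im v
  have h3 : {Y | maxSphere p n Y ≤ En p n - v} ⊆ {y | v ≤ max (En p n - sp (fun x : Sph n => hv p x.1) (fun _ => 0) y) 0} := by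
    intro Y hY
    simp only [Set.mem_ofPred_eq, maxSphere_eq] at hY ⊢
    exact le_max_of_le_left (by linarith)
  refine (measure_mono h3).trans ?_
  rw [← ENNReal.ofReal_toReal (measure_ne_top (gam (Fin p → Fin n)) _)]
  refine ENNReal.ofReal_le_ofReal ?_
  rw [le_div_iff₀ hv0, mul_comm]
  exact h2.trans h1

lemma En_le (p : ℕ) (E : ℝ) (hE : ∀ ε > (0 : ℝ),
      Filter.Tendsto (fun n => (tensorGaussian p n) {Y | ε ≤ |maxSphere p n Y - E|})
        Filter.atTop (nhds 0)) (v : ℝ) (hv0 : 0 < v) : ∀ᶠ n : ℕ in Filter.atTop, En p n ≤ E + v := by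
  have t1 := hE (v/2) (by linarith)
  have t2 : Filter.Tendsto (fun n : ℕ => ENNReal.ofReal (2 * (1/√n) / (v/2))) Filter.atTop (nhds 0) := by
    rw [← ENNReal.ofReal_zero]
    refine ENNReal.tendsto_ofReal ?_
    have : Filter.Tendsto (fun n : ℕ => 1/√(n:ℝ)) Filter.atTop (nhds 0) :=
      Filter.Tendsto.div_atTop tendsto_const_nhds (Real.tendsto_sqrt_atTop.comp tendsto_natCast_atTop_atTop)
    simpa using (this.const_mul 2).div_const (v/2)
  have t3 := t1.add t2
  rw [add_zero] at t3
  filter_upwards [t3.eventually_lt_const (show (0:ENNReal) < 1 by simp), Filter.eventually_ge_atTop 1] with n hn hn1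
  have : NeZero n := ⟨by omega⟩
  by_contra hc
  push Not at hc
  have h1 := En_low p n (v/2) (by linarith)
  have hu : (Set.univ : Set ((Fin p → Fin n) → ℝ)) ⊆ {Y | v/2 ≤ |maxSphere p n Y - E|} ∪ {Y | maxSphere p n Y ≤ En p n - v/2} := by
    intro Y _
    by_cases h : maxSphere p n Y ≤ En p n - v/2
    · exact Or.inr h
    · left
      push Not at h
      simp only [Set.mem_ofPred_eq]
      exact le_trans (by linarith) (le_abs_self _)
  have h2 : (1:ENNReal) ≤ gam (Fin p → Fin n) {Y | v/2 ≤ |maxSphere p n Y - E|} + gam (Fin p → Fin n) {Y | maxSphere p n Y ≤ En p n - v/2} := by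
    rw [← measure_univ (μ := gam (Fin p → Fin n))]
    exact (measure_mono hu).trans (measure_union_le _ _)
  have h3 := h2.trans (add_le_add le_rfl h1)
  exact absurd hn (not_lt.2 h3)

section
variable {n : ℕ} [NeZero n]

lemma av_sq (p : ℕ) {c1 s1 c2 s2 : ℝ} (h1 : c1^2+s1^2 ≤ 1) (h2 : c2^2+s2^2 ≤ 1) (q : Sph n × Sph n) :
    ∑ j, (av p c1 s1 c2 s2 q j)^2 ≤ 2^2 / n := by
  have hx := hv_sq p q.1
  have hy := hv_sq p q.2
  have hn := npos (n := n)
  have : ∑ j, (av p c1 s1 c2 s2 q j)^2 ≤ ∑ j : Fin p → Fin n, (2 * (hv p q.1.1 j)^2 + 2 * (hv p q.2.1 j)^2) := by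
    rw [Fintype.sum_sum_type, ← Finset.sum_add_distrib]
    refine Finset.sum_le_sum fun j _ => ?_
    simp only [av, Sum.elim_inl, Sum.elim_inr]
    nlinarith [sq_nonneg (c1 * hv p q.1.1 j - c2 * hv p q.2.1 j), sq_nonneg (s1 * hv p q.1.1 j - s2 * hv p q.2.1 j),
      mul_le_mul_of_nonneg_right h1 (sq_nonneg (hv p q.1.1 j)), mul_le_mul_of_nonneg_right h2 (sq_nonneg (hv p q.2.1 j))]
  rw [Finset.sum_add_distrib, ← Finset.mul_sum, ← Finset.mul_sum, hx, hy] at this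
  refine this.trans (le_of_eq ?_)
  ring

lemma fld_av (p : ℕ) (c1 s1 c2 s2 : ℝ) {T : Type} (f : T → Sph n × Sph n) (y : (Fin p → Fin n) ⊕ (Fin p → Fin n) → ℝ) (k : T) :
    fld (fun k => av p c1 s1 c2 s2 (f k)) (fun _ => 0) y k =
      (c1 * Hpspin p n (fun j => y (Sum.inl j)) (f k).1.1 + s1 * Hpspin p n (fun j => y (Sum.inr j)) (f k).1.1) +
      (c2 * Hpspin p n (fun j => y (Sum.inl j)) (f k).2.1 + s2 * Hpspin p n (fun j => y (Sum.inr j)) (f k).2.1) := by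
  simp only [fld, av, Fintype.sum_sum_type, Sum.elim_inl, Sum.elim_inr, H_eq, Finset.mul_sum, add_zero, ← Finset.sum_add_distrib]
  exact Finset.sum_congr rfl fun j _ => by ring
end

lemma ev (p : ℕ) (u : ℝ) (hu : 0 < u) : ∃ c > (0:ℝ), ∃ n₀ : ℕ, ∀ n ≥ n₀, ∀ [NeZero n] {c1 s1 c2 s2 : ℝ}, c1^2+s1^2 ≤ 1 → c2^2+s2^2 ≤ 1 →
    ∀ {T : Type} (f : T → Sph n × Sph n) (G : ℝ), (∀ [Nonempty T], GS (fun k => av p c1 s1 c2 s2 (f k)) (fun _ => 0) ≤ G) →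
    gam ((Fin p → Fin n) ⊕ (Fin p → Fin n)) {y | ∃ k, G + u ≤ (c1 * Hpspin p n (fun j => y (Sum.inl j)) (f k).1.1 + s1 * Hpspin p n (fun j => y (Sum.inr j)) (f k).1.1) +
      (c2 * Hpspin p n (fun j => y (Sum.inl j)) (f k).2.1 + s2 * Hpspin p n (fun j => y (Sum.inr j)) (f k).2.1)} ≤ ENNReal.ofReal (Real.exp (-c * n)) := by
  obtain ⟨c, hc, n₀, h⟩ := conc 2 u two_pos hu
  refine ⟨c, hc, n₀, fun n hn _ c1 s1 c2 s2 h1 h2 T f G hG => ?_⟩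
  rcases isEmpty_or_nonempty T with hT | hT
  · simp
  · have hb : BV (fun k => av p c1 s1 c2 s2 (f k)) := (av_BV p c1 s1 c2 s2).comp f
    refine (measure_mono ?_).trans (h n hn (fun k => av p c1 s1 c2 s2 (f k)) hb fun k => av_sq p h1 h2 _)
    rintro y ⟨k, hk⟩
    rw [← fld_av p c1 s1 c2 s2 f y k] at hk
    have := le_sp hb (BM.const 0) y k
    have := hG
    simp only [Set.mem_ofPred_eq]
    linarith

lemma GS_one (p : ℕ) {n : ℕ} [NeZero n] {c s : ℝ} (h : c^2+s^2=1) :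
    GS (fun x : Sph n => av p c s 0 0 (x, x)) (fun _ => 0) ≤ En p n := by
  refine le_of_eq (SF_eq ((av_BV p c s 0 0).comp fun x : Sph n => (x,x)) (hv_BV p) (BM.const 0) fun i j => ?_)
  rw [Fintype.sum_sum_type, ← Finset.sum_add_distrib]
  refine Finset.sum_congr rfl fun l _ => ?_
  simp only [av, Sum.elim_inl, Sum.elim_inr]
  have : s^2 = 1 - c^2 := by linarith
  ring_nf
  rw [this]; ring

lemma Hp_neg {p : ℕ} (hpe : Even p) (n : ℕ) (Y : (Fin p → Fin n) → ℝ) (x : Fin n → ℝ) : Hpspin p n Y (fun i => -1 * x i) = Hpspin p n Y x := by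
  unfold Hpspin
  simp only [Finset.prod_mul_distrib, Finset.prod_const, Finset.card_univ, Fintype.card_fin, hpe.neg_one_pow, one_mul]

/-- deterministic part -/
lemma det {p n : ℕ} [NeZero n] (hpe : Even p) (Y Y' : (Fin p → Fin n) → ℝ) (E r L e δ : ℝ) (hr : 0 < r) (t : Set ℝ)
    (hL : 0 ≤ L) (hδ : 2 * δ * L ≤ e) (he : 0 ≤ e)
    (hcov : ∀ τ ∈ Set.Icc (0:ℝ) (Real.pi/2), ∃ τ' ∈ t, |τ - τ'| ≤ δ)
    (hb : ∀ x : Sph n, |Hpspin p n Y x.1| ≤ L) (hb' : ∀ x : Sph n, |Hpspin p n Y' x.1| ≤ L)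
    (h1 : ∀ a ∈ t, ∀ b ∈ t, ∀ x y : Sph n, r ≤ Rs x.1 y.1 → Rs x.1 y.1 ≤ 2 * r →
      (Real.cos a * Hpspin p n Y x.1 + Real.sin a * Hpspin p n Y' x.1) + (Real.cos b * Hpspin p n Y y.1 + Real.sin b * Hpspin p n Y' y.1) < 2 * E - 4 * e)
    (h2 : ∀ x y : Sph n, r ≤ Rs x.1 y.1 → Hpspin p n Y x.1 + Hpspin p n Y' y.1 < 2 * E - 4 * e) :
    HasOGP (pspinFamily p n Y Y') (sphereSet n) (olap n) (E - e) r (2*r) ∧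
      SeparatedAbove (Hpspin p n Y) (Hpspin p n Y') (sphereSet n) (olap n) (E - e) r := by
  have hol : ∀ x y : Fin n → ℝ, olap n x y = |Rs x y| := fun x y => by
    unfold olap Rs; rw [abs_div, abs_of_pos (npos (n := n))]
  have hneg : ∀ y : Sph n, (fun i => -1 * y.1 i) ∈ sphereSet n := fun y => by
    have := sph_sq y
    exact (Finset.sum_congr rfl fun i _ => by ring).trans this
  -- choose sign
  have hsg : ∀ x y : Sph n, ∃ z : Sph n, Rs x.1 z.1 = |Rs x.1 y.1| ∧ ∀ Z, Hpspin p n Z z.1 = Hpspin p n Z y.1 := fun x y => by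
    rcases le_total 0 (Rs x.1 y.1) with h | h
    · exact ⟨y, (abs_of_nonneg h).symm, fun _ => rfl⟩
    · refine ⟨⟨_, hneg y⟩, ?_, fun Z => Hp_neg hpe n Z y.1⟩
      simp only
      rw [Rs_smul_right, abs_of_nonpos h]; ring
  constructor
  · rintro f1 ⟨τ1, hτ1, rfl⟩ f2 ⟨τ2, hτ2, rfl⟩ x hx y hy hfx hfy
    rw [hol]
    by_contra hc
    have hR1 := Rs_abs ⟨x, hx⟩ ⟨y, hy⟩
    simp only [Set.mem_union, Set.mem_Icc, not_or, not_and, not_le] at hc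
    have g1 := hc.1 (abs_nonneg _)
    have g2 : |Rs x y| < 2 * r := by
      by_contra h
      exact absurd (hc.2 (not_lt.1 h)) (not_lt.2 hR1)
    obtain ⟨z, hz, hHz⟩ := hsg ⟨x, hx⟩ ⟨y, hy⟩
    obtain ⟨a, ha, hda⟩ := hcov τ1 hτ1
    obtain ⟨b, hb2, hdb⟩ := hcov τ2 hτ2
    simp only at hz hHz hfx hfy
    have k := h1 a ha b hb2 ⟨x, hx⟩ z (by simp only; rw [hz]; exact g1.le) (by simp only; rw [hz]; exact g2.le)
    rw [hHz, hHz] at k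
    have err : ∀ (w : Sph n) (τ a : ℝ), |τ - a| ≤ δ → Real.cos τ * Hpspin p n Y w.1 + Real.sin τ * Hpspin p n Y' w.1 - e ≤
        Real.cos a * Hpspin p n Y w.1 + Real.sin a * Hpspin p n Y' w.1 := by
      intro w τ a hd
      have hc : |Real.cos τ - Real.cos a| ≤ δ := (Real.abs_cos_sub_cos_le _ _).trans hd
      have hs : |Real.sin τ - Real.sin a| ≤ δ := (Real.abs_sin_sub_sin_le _ _).trans hd
      have e1 : |(Real.cos τ - Real.cos a) * Hpspin p n Y w.1| ≤ δ * L := by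
        rw [abs_mul]; exact mul_le_mul hc (hb w) (abs_nonneg _) ((abs_nonneg _).trans hc)
      have e2 : |(Real.sin τ - Real.sin a) * Hpspin p n Y' w.1| ≤ δ * L := by
        rw [abs_mul]; exact mul_le_mul hs (hb' w) (abs_nonneg _) ((abs_nonneg _).trans hc)
      have e3 := (abs_le.1 e1).2
      have e4 := (abs_le.1 e2).2
      nlinarith
    have k1 := err ⟨x, hx⟩ τ1 a hda
    have k2 := err ⟨y, hy⟩ τ2 b hdb
    simp only at k1 k2 k
    linarith
  · intro x hx y hy hfx hfy
    rw [hol]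
    by_contra hc
    push Not at hc
    obtain ⟨z, hz, hHz⟩ := hsg ⟨x, hx⟩ ⟨y, hy⟩
    simp only at hz hHz
    have k := h2 ⟨x, hx⟩ z (by simp only; rw [hz]; exact hc.le)
    rw [hHz] at k
    simp only at k
    linarith

end PS
open MeasureTheory ProbabilityTheory
set_option linter.unusedSectionVars false
namespace PS

lemma exp_absorb (c K : ℝ) (hc : 0 < c) : ∀ᶠ n : ℕ in Filter.atTop, K * Real.exp (-c * n) ≤ Real.exp (-(c/2) * n) := by
  have t : Filter.Tendsto (fun n : ℕ => Real.exp (c/2 * n)) Filter.atTop Filter.atTop :=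
    Real.tendsto_exp_atTop.comp (tendsto_natCast_atTop_atTop.const_mul_atTop (by linarith))
  filter_upwards [t.eventually_ge_atTop K] with n hn
  have : Real.exp (-(c/2) * n) = Real.exp (c/2*n) * Real.exp (-c*n) := by
    rw [← Real.exp_add]; congr 1; ring
  rw [this]
  exact mul_le_mul_of_nonneg_right hn (Real.exp_pos _).le

/-- abstract union bound -/
lemma ub {J ι : Type} [Fintype J] [Fintype ι] (S : Set ((J → ℝ) × (J → ℝ))) (A : ι → Set (J ⊕ J → ℝ)) (b b' : ℝ) (hb0 : 0 ≤ b')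
    (hb' : Fintype.card ι * b ≤ b') (hA : ∀ i, gam (J ⊕ J) (A i) ≤ ENNReal.ofReal b)
    (h : ∀ y, (∀ i, y ∉ A i) → ((fun j => y (Sum.inl j)), (fun j => y (Sum.inr j))) ∈ S) :
    ENNReal.ofReal (1 - b') ≤ ((gam J).prod (gam J)) S := by
  have mp := measurePreserving_sumPiEquivProdPi (fun _ : J ⊕ J => gaussianReal 0 1)
  have e1 : ((gam J).prod (gam J)) S = gam (J ⊕ J) (MeasurableEquiv.sumPiEquivProdPi (fun _ : J ⊕ J => ℝ) ⁻¹' S) :=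
    (mp.measure_preimage_equiv S).symm
  have hu : (Set.univ : Set (J ⊕ J → ℝ)) ⊆ (MeasurableEquiv.sumPiEquivProdPi (fun _ : J ⊕ J => ℝ) ⁻¹' S) ∪ ⋃ i, A i := by
    intro y _
    by_cases hy : ∀ i, y ∉ A i
    · exact Or.inl (h y hy)
    · push Not at hy
      exact Or.inr (Set.mem_iUnion.2 hy)
  have h2 : (1:ENNReal) ≤ ((gam J).prod (gam J)) S + ENNReal.ofReal b' := by
    rw [← measure_univ (μ := gam (J ⊕ J)), e1]
    refine (measure_mono hu).trans ((measure_union_le _ _).trans (add_le_add le_rfl ?_))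
    refine (measure_iUnion_fintype_le _ _).trans ((Finset.sum_le_sum fun i _ => hA i).trans ?_)
    rw [Finset.sum_const, Finset.card_univ, nsmul_eq_mul, ← ENNReal.ofReal_natCast, ← ENNReal.ofReal_mul (by positivity)]
    exact ENNReal.ofReal_le_ofReal hb'
  have h3 : ENNReal.ofReal (1 - b') ≤ 1 - ENNReal.ofReal b' := by
    rw [ENNReal.ofReal_sub _ hb0, ENNReal.ofReal_one]
  exact h3.trans (tsub_le_iff_right.2 h2)

lemma main (p : ℕ) (hp : 4 ≤ p) (hpeven : Even p) (E : ℝ)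
    (hE : ∀ ε > (0 : ℝ),
      Filter.Tendsto (fun n => (tensorGaussian p n) {Y | ε ≤ |maxSphere p n Y - E|})
        Filter.atTop (nhds 0)) :
    ∃ ε > (0 : ℝ), ∃ ν₁ ν₂ : ℝ, 0 ≤ ν₁ ∧ ν₁ < ν₂ ∧ ν₂ ≤ 1 ∧
      ∃ c > (0 : ℝ), ∃ n₀ : ℕ, ∀ n ≥ n₀,
        ENNReal.ofReal (1 - Real.exp (-c * n)) ≤
          ((tensorGaussian p n).prod (tensorGaussian p n))
            {YY' | HasOGP (pspinFamily p n YY'.1 YY'.2) (sphereSet n) (olap n)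
                     (E - ε) ν₁ ν₂ ∧
                   SeparatedAbove (Hpspin p n YY'.1) (Hpspin p n YY'.2)
                     (sphereSet n) (olap n) (E - ε) ν₁} := by
  obtain ⟨r, hr, hr1, η, hη, C, hB⟩ := B3 hp hpeven (|E| + 1) (by positivity)
  set e := η / 16 with he
  have he0 : 0 < e := by positivity
  set L := |E| + 1 + e with hL
  have hL0 : 0 < L := by positivity
  set δ := e / (2 * L) with hδ
  have hδ0 : 0 < δ := by positivity
  obtain ⟨t, htI, htf, hcov⟩ := (isCompact_Icc (a := (0:ℝ)) (b := Real.pi/2)).finite_cover_balls hδ0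
  have := htf.fintype
  obtain ⟨c, hc, n₁, hev⟩ := ev p e he0
  have tC : Filter.Tendsto (fun n : ℕ => C/√(n:ℝ)) Filter.atTop (nhds 0) :=
    Filter.Tendsto.div_atTop tendsto_const_nhds (Real.tendsto_sqrt_atTop.comp tendsto_natCast_atTop_atTop)
  refine ⟨e, he0, r, 2*r, hr.le, by linarith, hr1, c/2, by positivity, ?_⟩
  rw [← Filter.eventually_atTop]
  filter_upwards [Filter.eventually_ge_atTop n₁, Filter.eventually_ge_atTop 1, En_le p E hE e he0, En_le p E hE 1 one_pos,
    tC.eventually_le_const he0, exp_absorb c (Fintype.card ((Bool × Bool) ⊕ ((t × t) ⊕ Unit))) hc] with n hn1 hn0 hEe hE1 hCn hexp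
  have : NeZero n := ⟨by omega⟩
  have hEM : En p n ≤ |E| + 1 := by linarith [le_abs_self E]
  let sg : Bool → ℝ := fun b => if b then 1 else -1
  have hsg : ∀ b, sg b ^ 2 = 1 := fun b => by simp only [sg]; split_ifs <;> norm_num
  let ca : Bool × Bool → ℝ := fun b => if b.1 then sg b.2 else 0
  let sa : Bool × Bool → ℝ := fun b => if b.1 then 0 else sg b.2
  have hcs : ∀ b, ca b ^ 2 + sa b ^ 2 = 1 := fun b => by
    simp only [ca, sa]; split_ifs <;> simp [hsg]
  let P (c1 s1 c2 s2 : ℝ) (x y : Sph n) (w : (Fin p → Fin n) ⊕ (Fin p → Fin n) → ℝ) : ℝ :=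
    (c1 * Hpspin p n (fun j => w (Sum.inl j)) x.1 + s1 * Hpspin p n (fun j => w (Sum.inr j)) x.1) +
      (c2 * Hpspin p n (fun j => w (Sum.inl j)) y.1 + s2 * Hpspin p n (fun j => w (Sum.inr j)) y.1)
  set G2 := 2 * En p n - η + C / √n with hG2
  let T1 := {q : Sph n × Sph n // r ≤ Rs q.1.1 q.2.1 ∧ Rs q.1.1 q.2.1 ≤ 2 * r}
  let T2 := {q : Sph n × Sph n // r ≤ Rs q.1.1 q.2.1}
  let A1 : Bool × Bool → Set ((Fin p → Fin n) ⊕ (Fin p → Fin n) → ℝ) := fun b =>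
    {w | ∃ x : Sph n, En p n + e ≤ P (ca b) (sa b) 0 0 x x w}
  let A2 : t × t → Set ((Fin p → Fin n) ⊕ (Fin p → Fin n) → ℝ) := fun b =>
    {w | ∃ q : T1, G2 + e ≤ P (Real.cos b.1.1) (Real.sin b.1.1) (Real.cos b.2.1) (Real.sin b.2.1) q.1.1 q.1.2 w}
  let A3 : Unit → Set ((Fin p → Fin n) ⊕ (Fin p → Fin n) → ℝ) := fun _ =>
    {w | ∃ q : T2, G2 + e ≤ P 1 0 0 1 q.1.1 q.1.2 w}
  refine ub _ (Sum.elim A1 (Sum.elim A2 A3)) (Real.exp (-c * n)) _ (Real.exp_pos _).le hexp ?_ ?_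
  · rintro (b | b | b)
    · exact hev n hn1 (hcs b).le (by norm_num) (fun x : Sph n => (x, x)) (En p n) (GS_one p (hcs b))
    · refine hev n hn1 (Real.cos_sq_add_sin_sq _).le (Real.cos_sq_add_sin_sq _).le (fun q : T1 => q.1) G2 ?_
      intro _
      refine hB n hEM (fun q : T1 => q.1) (fun k => k.2.1) (Real.cos_sq_add_sin_sq _) (Real.cos_sq_add_sin_sq _) ?_ (Or.inr fun k => k.2.2)
      rw [← Real.cos_sub]
      have i1 := htI b.1.2
      have i2 := htI b.2.2
      exact Real.cos_nonneg_of_mem_Icc ⟨by linarith [i1.1, i2.2], by linarith [i1.2, i2.1]⟩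
    · refine hev n hn1 (by norm_num) (by norm_num) (fun q : T2 => q.1) G2 ?_
      intro _
      exact hB n hEM (fun q : T2 => q.1) (fun k => k.2) (by norm_num) (by norm_num) (by norm_num) (Or.inl (by norm_num))
  · intro w hw
    have hG : G2 + e ≤ 2 * E - 4 * e := by rw [hG2]; linarith
    have w1 : ∀ b x, P (ca b) (sa b) 0 0 x x w < En p n + e := fun b x => by
      by_contra h
      exact hw (Sum.inl b) ⟨x, not_lt.1 h⟩
    have w2 : ∀ (b : t × t) (q : T1), P (Real.cos b.1.1) (Real.sin b.1.1) (Real.cos b.2.1) (Real.sin b.2.1) q.1.1 q.1.2 w < G2 + e := fun b q => by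
      by_contra h
      exact hw (Sum.inr (Sum.inl b)) ⟨q, not_lt.1 h⟩
    have w3 : ∀ (q : T2), P 1 0 0 1 q.1.1 q.1.2 w < G2 + e := fun q => by
      by_contra h
      exact hw (Sum.inr (Sum.inr ())) ⟨q, not_lt.1 h⟩
    refine det hpeven _ _ E r L e δ hr t hL0.le ?_ he0.le ?_ ?_ ?_ ?_ ?_
    · rw [hδ]; refine le_of_eq ?_; field_simp
    · intro τ hτ
      obtain ⟨a, ha, h⟩ := Set.mem_iUnion₂.1 (hcov hτ)
      exact ⟨a, ha, (Real.dist_eq τ a ▸ Metric.mem_ball.1 h).le⟩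
    · intro x
      have h1 := w1 (true, true) x
      have h2 := w1 (true, false) x
      simp [P, ca, sa, sg] at h1 h2
      rw [abs_le]; constructor <;> linarith
    · intro x
      have h1 := w1 (false, true) x
      have h2 := w1 (false, false) x
      simp [P, ca, sa, sg] at h1 h2
      rw [abs_le]; constructor <;> linarith
    · intro a ha b hb x y h1 h2
      exact (w2 (⟨a, ha⟩, ⟨b, hb⟩) ⟨(x, y), h1, h2⟩).trans_le hG
    · intro x y h1
      have := (w3 ⟨(x, y), h1⟩).trans_le hG
      simpa [P] using this

end PS
/-- Let `p ≥ 4` be even and `E = E_p(𝒮)` the spherical ground state energy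
(the in-probability limit of `max_{x ∈ 𝒮_n} H_n(x;Y)`).  Then there exist `ε > 0`,
`0 ≤ ν₁ < ν₂ ≤ 1`, `c > 0` and `n₀` such that for all `n ≥ n₀`, with probability at least
`1 - exp(-c n)` over independent Gaussian `p`-tensors `Y, Y'`, the family `𝒜(Y,Y')` has the
`(E - ε, ν₁, ν₂)`-OGP on `𝒮_n` with overlap `R(x,y) = |⟨x,y⟩|/n`, and `H_n(·;Y)`,
`H_n(·;Y')` are `ν₁`-separated above `E - ε`. -/
theorem stmt_9 (p : ℕ) (hp : 4 ≤ p) (hpeven : Even p) (E : ℝ)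
    (hE : ∀ ε > (0 : ℝ),
      Filter.Tendsto (fun n => (tensorGaussian p n) {Y | ε ≤ |maxSphere p n Y - E|})
        Filter.atTop (nhds 0)) :
    ∃ ε > (0 : ℝ), ∃ ν₁ ν₂ : ℝ, 0 ≤ ν₁ ∧ ν₁ < ν₂ ∧ ν₂ ≤ 1 ∧
      ∃ c > (0 : ℝ), ∃ n₀ : ℕ, ∀ n ≥ n₀,
        ENNReal.ofReal (1 - Real.exp (-c * n)) ≤
          ((tensorGaussian p n).prod (tensorGaussian p n))
            {YY' | HasOGP (pspinFamily p n YY'.1 YY'.2) (sphereSet n) (olap n)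
                     (E - ε) ν₁ ν₂ ∧
                   SeparatedAbove (Hpspin p n YY'.1) (Hpspin p n YY'.2)
                     (sphereSet n) (olap n) (E - ε) ν₁} := by
  exact PS.main p hp hpeven E hE
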